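/- In Rado's busy beaver model, every Turing machine with 4 states and 2 symbols that halts when started in state A on the all-blank tape performs at most 107 steps and leaves at most 13 non-blank cells, and both bounds are attained by some such machine; that is, S(4,2) = 107 and Σ(4,2) = 13. -/

import Mathlib

/-- Move direction of the tape head. -/
inductive Dir : Type
  | L
  | R

/-- The head displacement of a direction. -/
def Dir.move : Dir → ℤ
  | Dir.L => -1
  | Dir.R => 1

/-- A Turing machine with `n` states and `k` symbols, in Rado's busy beaver model.
States are `Fin n` (state `A` is `0`, `B` is `1`, ...), symbols are `Fin k` with `0`
the blank symbol. A transition yields the written symbol, the move direction and the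
next state, where `none` denotes the halting state `H`. -/
abbrev Machine (n k : ℕ) : Type :=
  Fin n → Fin k → Fin k × Dir × Option (Fin n)

/-- A configuration: current state (`none` = halted), head position, tape. -/
structure Cfg (n k : ℕ) where
  state : Option (Fin n)
  pos : ℤ
  tape : ℤ → Fin k

/-- One computation step (halted configurations are fixed). -/
def step {n k : ℕ} (M : Machine n k) (c : Cfg n k) : Cfg n k :=
  match c.state with
  | none => c
  | some q =>
      { state := (M q (c.tape c.pos)).2.2
        pos := c.pos + (M q (c.tape c.pos)).2.1.move
        tape := Function.update c.tape c.pos (M q (c.tape c.pos)).1 }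

/-- The initial configuration: state `A`, head at cell `0`, all-blank tape. -/
def init (n k : ℕ) [NeZero k] : Cfg n k :=
  { state := if h : 0 < n then some ⟨0, h⟩ else none
    pos := 0
    tape := fun _ => 0 }

/-- `HaltsIn M c t`: started from `c`, the machine `M` halts after exactly `t` steps. -/
def HaltsIn {n k : ℕ} (M : Machine n k) (c : Cfg n k) (t : ℕ) : Prop :=
  ((step M)^[t] c).state = none ∧ ∀ i < t, ((step M)^[i] c).state ≠ none

/-- The number of non-blank cells of a configuration. -/
noncomputable def sigmaCount {n k : ℕ} [NeZero k] (c : Cfg n k) : ℕ :=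
  Set.ncard {i : ℤ | c.tape i ≠ 0}

/-- Rado's condition: every transition into the halting state writes `1` and moves right. -/
def Valid {n k : ℕ} [NeZero k] (M : Machine n k) : Prop :=
  ∀ q a, (M q a).2.2 = none → (M q a).1 = 1 ∧ (M q a).2.1 = Dir.R

/-- The busy beaver step function `S(n,k)`: the maximum number of steps of a halting
`n`-state `k`-symbol machine started on the all-blank tape. -/
noncomputable def bbS (n k : ℕ) [NeZero k] : ℕ :=
  sSup {t : ℕ | ∃ M : Machine n k, Valid M ∧ HaltsIn M (init n k) t}

/-- The busy beaver score function `Σ(n,k)`: the maximum number of non-blank cells left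
by a halting `n`-state `k`-symbol machine started on the all-blank tape. -/
noncomputable def bbSigma (n k : ℕ) [NeZero k] : ℕ :=
  sSup {m : ℕ | ∃ M : Machine n k, Valid M ∧
    ∃ t : ℕ, HaltsIn M (init n k) t ∧ sigmaCount ((step M)^[t] (init n k)) = m}

noncomputable section

namespace BB4

/-! ### Lists of naturals as vectors of lanes -/

def hd : List Nat → Nat := List.rec 0 (fun x _ _ => x)

def tl : List Nat → List Nat := List.rec [] (fun _ t _ => t)

def nth (l : List Nat) : Nat → Nat :=
  List.rec (fun _ => 0) (fun x _ ih n => Nat.rec x (fun m _ => ih m) n) l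

def mux1 (d x y : Nat) : Nat := Nat.xor y (Nat.land d (Nat.xor x y))

def andNot (x y : Nat) : Nat := Nat.xor x (Nat.land x y)

def mux (d : Nat) (xs : List Nat) : List Nat → List Nat :=
  List.rec (fun ys => List.rec [] (fun y _ ih => mux1 d 0 y :: ih) ys)
    (fun x _ ih ys => mux1 d x (hd ys) :: ih (tl ys)) xs

def dot (xs : List Nat) : List Nat → Nat :=
  List.rec (fun _ => 0) (fun x _ ih ys => Nat.lor (Nat.land x (hd ys)) (ih (tl ys))) xs

def radd (xs : List Nat) : List Nat → List Nat :=
  List.rec (fun ys => ys)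
    (fun x t ih ys => List.rec (x :: t) (fun y t' _ => Nat.lor x y :: ih t') ys) xs

def rscale (m : Nat) : List Nat → List Nat :=
  List.rec [] (fun x _ ih => Nat.land m x :: ih)

def rany : List Nat → Nat := List.rec 0 (fun x _ ih => Nat.lor x ih)

def rdiff (xs : List Nat) : List Nat → Nat :=
  List.rec (fun _ => 0) (fun x _ ih ys => Nat.lor (andNot x (hd ys)) (ih (tl ys))) xs

/-! ### Simulation of many machines -/

/-- Transition tables of all lanes: write, direction, high and low bit of the next state, halt. -/
structure Cols where
  W : List Nat
  D : List Nat
  A : List Nat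
  B : List Nat
  H : List Nat

structure Sim where
  act : Nat
  qa : Nat
  qb : Nat
  s : Nat
  l : List Nat
  r : List Nat
  u : List Nat
  ov : Nat

def sel (act qa qb s : Nat) : List Nat :=
  let q1 := Nat.land act qa
  let q0 := andNot act qa
  let q01 := Nat.land q0 qb
  let q00 := andNot q0 qb
  let q11 := Nat.land q1 qb
  let q10 := andNot q1 qb
  [andNot q00 s, Nat.land q00 s, andNot q01 s, Nat.land q01 s,
   andNot q10 s, Nat.land q10 s, andNot q11 s, Nat.land q11 s]

/-- Update of a thermometer code under increments `inc` and decrements `dec`. -/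
def thermo (inc dec : Nat) (u : List Nat) : Nat → List Nat :=
  List.rec (fun _ => []) (fun x t ih prev =>
    andNot (Nat.lor x (Nat.land inc prev)) (andNot dec (hd t)) :: ih x) u

def last (u : List Nat) : Nat → Nat := List.rec (fun d => d) (fun x _ ih _ => ih x) u

/-- The direction mask of the step about to be performed. -/
def dirOf (C : Cols) (S : Sim) : Nat := dot (sel S.act S.qa S.qb S.s) C.D

def stp (C : Cols) (S : Sim) : Sim :=
  let sl := sel S.act S.qa S.qb S.s
  let w := dot sl C.W
  let d := dot sl C.D
  { act := andNot S.act (dot sl C.H)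
    qa := dot sl C.A
    qb := dot sl C.B
    s := mux1 d (hd S.r) (hd S.l)
    l := mux d (w :: S.l) (tl S.l)
    r := mux d (tl S.r) (w :: S.r)
    u := thermo (andNot w S.s) (andNot (Nat.land S.act S.s) w) S.u S.act
    ov := Nat.lor S.ov (Nat.land (andNot w S.s) (last S.u S.act)) }

def stps (C : Cols) (n : Nat) : Sim → Sim :=
  Nat.rec (fun S => S) (fun _ ih S => ih (stp C S)) n

/-- Excursion trackers: thermometer codes of the depth used on either side. -/
structure Trk where
  el : List Nat
  al : List Nat
  er : List Nat
  ar : List Nat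

def trk (F d : Nat) (K : Trk) : Trk :=
  { el := mux (Nat.lor d (hd K.al)) K.el (F :: K.el)
    al := mux d (F :: K.al) (tl K.al)
    er := mux (andNot d (hd K.ar)) (F :: K.er) K.er
    ar := mux d (tl K.ar) (F :: K.ar) }

def neq (xs : List Nat) : List Nat → Nat :=
  List.rec (fun ys => rany ys)
    (fun x _ ih ys => Nat.lor (Nat.xor x (hd ys)) (ih (tl ys))) xs

/-- Lanes on which the two half tapes differ in a visited cell, or the visited depth is lost. -/
def neqIn (e : List Nat) : List Nat → List Nat → List Nat → Nat :=
  List.rec (fun _ _ _ => 0)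
    (fun x _ ih a xs ys => Nat.lor (andNot x (andNot (hd a) (Nat.xor (hd xs) (hd ys))))
      (ih (tl a) (tl xs) (tl ys))) e

def looping (S S' : Sim) (K : Trk) : Nat :=
  andNot S'.act (Nat.lor (Nat.lor (Nat.xor S.qa S'.qa) (Nat.xor S.qb S'.qb))
    (Nat.lor (Nat.xor S.s S'.s)
      (Nat.land (Nat.lor (neq S.r S'.r) (neqIn K.el K.al S.l S'.l))
        (Nat.lor (neq S.l S'.l) (neqIn K.er K.ar S.r S'.r)))))

/-- Lanes found looping in the next `n` steps. -/
def loops (C : Cols) (F : Nat) (S : Sim) (n : Nat) : Sim → Trk → Nat :=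
  Nat.rec (fun _ _ => 0) (fun _ ih S' K =>
    let S1 := stp C S'
    let K1 := trk F (dirOf C S') K
    Nat.lor (looping S S1 K1) (ih S1 K1)) n

def sim0 (F : Nat) (u : List Nat) : Sim := ⟨F, 0, 0, 0, [], [], u, 0⟩

/-- Lanes not settled: neither halted within `n + k + h` steps with few marks
nor looping. -/
def unsettled (C : Cols) (F : Nat) (u : List Nat) (n k h : Nat) : Nat :=
  let S := stps C n (sim0 F u)
  let S' := stps C h (stps C k S)
  andNot (Nat.lor S'.act (Nat.lor S'.ov (nth S'.u 12))) (loops C F S k S ⟨[], [], [], []⟩)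

/-! ### The closure decider -/

def madd (A : List (List Nat)) : List (List Nat) → List (List Nat) :=
  List.rec (fun B => B)
    (fun x t ih B => List.rec (x :: t) (fun y t' _ => radd x y :: ih t') B) A

def mscale (m : Nat) : List (List Nat) → List (List Nat) :=
  List.rec [] (fun x _ ih => rscale m x :: ih)

def vm (x : List Nat) : List (List Nat) → List Nat :=
  List.rec (fun _ => []) (fun x _ ih B => List.rec []
    (fun r B' _ => cond (Nat.beq x 0) (ih B') (radd (rscale x r) (ih B'))) B) x

def mm (A B : List (List Nat)) : List (List Nat) :=
  List.rec [] (fun x _ ih => vm x B :: ih) A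

def mdots (B : List (List Nat)) (x : List Nat) : List Nat :=
  List.rec [] (fun y _ ih => dot x y :: ih) B

def mmt (A B : List (List Nat)) : List (List Nat) :=
  List.rec [] (fun x _ ih => mdots B x :: ih) A

def outer (x y : List Nat) : List (List Nat) :=
  List.rec [] (fun a _ ih => cond (Nat.beq a 0) [] (rscale a y) :: ih) x

def tm (A : List (List Nat)) : List (List Nat) → List (List Nat) :=
  List.rec (fun _ => []) (fun x _ ih B => List.rec []
    (fun r B' _ => madd (outer x r) (ih B')) B) A

def rowscale (e : List Nat) : List (List Nat) → List (List Nat) :=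
  List.rec (fun _ => []) (fun x _ ih B => List.rec []
    (fun r B' _ => rscale x r :: ih B') B) e

def rowany : List (List Nat) → List Nat := List.rec [] (fun x _ ih => rany x :: ih)

def colany : List (List Nat) → List Nat := List.rec [] (fun x _ ih => radd x ih)

def many : List (List Nat) → Nat := List.rec 0 (fun x _ ih => Nat.lor (rany x) ih)

def mdiff (A : List (List Nat)) : List (List Nat) → Nat :=
  List.rec (fun _ => 0) (fun x _ ih B =>
    List.rec (Nat.lor (rany x) (ih [])) (fun y B' _ => Nat.lor (rdiff x y) (ih B')) B) A

/-- Reachable configurations and tape edges of the abstract machines. -/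
structure Clo where
  C : List (List (List Nat))
  l0 : List Nat
  l1 : List Nat
  r0 : List Nat
  r1 : List Nat

/-- Transition matrices (by symbol) of the two tape automata. -/
structure Aut where
  l0 : List (List Nat)
  l1 : List (List Nat)
  r0 : List (List Nat)
  r1 : List (List Nat)

def rand (xs : List Nat) : List Nat → List Nat :=
  List.rec (fun _ => []) (fun x _ ih ys => Nat.land x (hd ys) :: ih (tl ys)) xs

def lits (F : Nat) (b : Bool) : List Nat → List Nat :=
  List.rec [] (fun x _ ih => cond b x (andNot F x) :: ih)

def tmask (F : Nat) (T : Cols) (d w a b : Bool) : List Nat :=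
  rand (lits F false T.H) (rand (rand (lits F d T.D) (lits F w T.W))
    (rand (lits F a T.A) (lits F b T.B)))

def ysum (t : List Nat) : List (List (List Nat)) → List (List Nat) :=
  List.rec (fun _ => []) (fun x _ ih C => List.rec []
    (fun A C' _ => madd (cond (Nat.beq x 0) [] (mscale x A)) (ih C')) C) t

/-- Configurations about to enter a fixed state, by direction and written symbol. -/
structure Out where
  l0 : List (List Nat)
  l1 : List (List Nat)
  r0 : List (List Nat)
  r1 : List (List Nat)

def out (F : Nat) (T : Cols) (C : List (List (List Nat))) (a b : Bool) : Out :=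
  { l0 := ysum (tmask F T false false a b) C
    l1 := ysum (tmask F T false true a b) C
    r0 := ysum (tmask F T true false a b) C
    r1 := ysum (tmask F T true true a b) C }

def mnth (C : List (List (List Nat))) : Nat → List (List Nat) :=
  List.rec (fun _ => []) (fun x _ ih n => Nat.rec x (fun m _ => ih m) n) C

/-- New configurations in a state with head symbol described by the edges `el`, `er`
and matrices `gl`, `gr`. -/
def into (G : Aut) (el er : List Nat) (gl gr : List (List Nat)) (Y : Out) : List (List Nat) :=
  madd (mmt (madd (tm G.l0 Y.r0) (tm G.l1 Y.r1)) (rowscale er gr))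
    (mm (rowscale el gl) (madd (mm Y.l0 G.r0) (mm Y.l1 G.r1)))

def rnd (F : Nat) (T : Cols) (G : Aut) (S : Clo) : Clo :=
  let y0 := out F T S.C false false
  let y1 := out F T S.C false true
  let y2 := out F T S.C true false
  let y3 := out F T S.C true true
  let l0 := radd S.l0 (radd (radd (rowany y0.r0) (rowany y1.r0))
    (radd (rowany y2.r0) (rowany y3.r0)))
  let l1 := radd S.l1 (radd (radd (rowany y0.r1) (rowany y1.r1))
    (radd (rowany y2.r1) (rowany y3.r1)))
  let r0 := radd S.r0 (radd (radd (colany y0.l0) (colany y1.l0))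
    (radd (colany y2.l0) (colany y3.l0)))
  let r1 := radd S.r1 (radd (radd (colany y0.l1) (colany y1.l1))
    (radd (colany y2.l1) (colany y3.l1)))
  { C := [madd (mnth S.C 0) (into G l0 r0 G.l0 G.r0 y0), madd (mnth S.C 1)
    (into G l1 r1 G.l1 G.r1 y0),
      madd (mnth S.C 2) (into G l0 r0 G.l0 G.r0 y1), madd (mnth S.C 3) (into G l1 r1 G.l1 G.r1 y1),
      madd (mnth S.C 4) (into G l0 r0 G.l0 G.r0 y2), madd (mnth S.C 5) (into G l1 r1 G.l1 G.r1 y2),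
      madd (mnth S.C 6) (into G l0 r0 G.l0 G.r0 y3), madd (mnth S.C 7) (into G l1 r1 G.l1 G.r1 y3)]
    l0 := l0, l1 := l1, r0 := r0, r1 := r1 }

def rnds (F : Nat) (T : Cols) (G : Aut) (n : Nat) : Clo → Clo :=
  Nat.rec (fun S => S) (fun _ ih S => ih (rnd F T G S)) n

def cdiff (A : List (List (List Nat))) : List (List (List Nat)) → Nat :=
  List.rec (fun _ => 0) (fun x _ ih B =>
    List.rec (Nat.lor (many x) (ih [])) (fun y B' _ => Nat.lor (mdiff x y) (ih B')) B) A

def hits (h : List Nat) : List (List (List Nat)) → Nat :=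
  List.rec (fun _ => 0) (fun x _ ih C => List.rec 0
    (fun A C' _ => Nat.lor (Nat.land x (many A)) (ih C')) C) h

def clo0 (F : Nat) : Clo := ⟨[[[F]]], [F], [], [F], []⟩

/-- Lanes on which `S` is not closed. -/
def unclosed (F : Nat) (T : Cols) (G : Aut) (S : Clo) : Nat :=
  let S' := rnd F T G S
  Nat.lor (Nat.lor (hits T.H S.C) (cdiff S'.C S.C))
    (Nat.lor (Nat.lor (Nat.lor (rdiff S'.l0 S.l0) (rdiff S'.l1 S.l1))
        (Nat.lor (rdiff S'.r0 S.r0) (rdiff S'.r1 S.r1)))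
      (Nat.lor (Nat.lor (Nat.lor (rdiff S.l0 (rowany G.l0)) (rdiff S.l1 (rowany G.l1)))
        (Nat.lor (rdiff S.r0 (rowany G.r0)) (rdiff S.r1 (rowany G.r1))))
        (Nat.lor (Nat.lor (cdiff [[[F]]] S.C) (Nat.lor (rdiff [F] S.l0) (rdiff [F] S.r0)))
          (Nat.lor (mdiff [[F]] G.l0) (mdiff [[F]] G.r0)))))

def closure (F : Nat) (T : Cols) (G : Aut) (n : Nat) : Nat :=
  unclosed F T G (rnds F T G n (clo0 F))

/-! ### Enumeration -/

inductive Item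
  | node (c : Nat) (m : Nat)
  | row (c : Nat) (x z : Nat)
  | nh (c : Nat)
  | bad

def pop (n k : Nat) : Nat :=
  Nat.rec (fun _ => 0) (fun _ ih n => Bool.rec
    (Nat.add (Nat.land n 1) (ih (Nat.shiftRight n 1))) 0 (Nat.beq n 0)) k n

/-- Run to the first undefined transition: `[j, ones]` or `[]`. -/
def run (c : Nat) (n : Nat) : Nat → Nat → Nat → List Nat :=
  Nat.rec (fun _ _ _ => []) (fun _ ih j l r => (fun v =>
    Bool.rec
      (Bool.rec
        (ih (Nat.add (Nat.mul 10 (Nat.shiftRight v 2)) (Nat.mul 5 (Nat.land r 1)))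
          (Nat.add (Nat.mul 2 l) (Nat.land v 1)) (Nat.shiftRight r 1))
        (ih (Nat.add (Nat.mul 10 (Nat.shiftRight v 2)) (Nat.mul 5 (Nat.land l 1)))
          (Nat.shiftRight l 1) (Nat.add (Nat.mul 2 r) (Nat.land v 1)))
        (Nat.beq (Nat.land v 2) 0))
      [j, Nat.add (pop l 110) (pop r 110)]
      (Nat.ble 16 v)) (Nat.land (Nat.shiftRight c j) 31)) n

/-- Fill in the undefined transition at offset `j`. -/
def fill (c j v : Nat) : Nat := Nat.xor c (Nat.shiftLeft (Nat.xor 16 v) j)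

def kids (c m j n : Nat) : List Item :=
  Nat.rec [] (fun v ih => Item.node (fill c j v)
    (cond (Nat.ble m (Nat.div v 4)) (Nat.div v 4) m) :: ih) n

/-- Branch on the first undefined transition. -/
def branch : Item → List Item :=
  Item.rec (fun c m => List.rec [Item.nh c] (fun j t _ =>
      cond (Nat.ble (hd t) 12)
        (kids c m j (cond (Nat.ble 2 m) 16 (Nat.mul 4 (Nat.add m 2)))) [Item.bad]) (run c 40 0 0 0))
    (fun c x z => [Item.row c x z]) (fun c => [Item.nh c]) [Item.bad]

def flat (f : Item → List Item) : List Item → List Item :=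
  List.rec [] (fun x _ ih => List.append (f x) ih)

def defined (c j : Nat) : Bool := Nat.beq (Nat.land (Nat.shiftRight c j) 16) 0

/-- Undefined transitions other than `j`. -/
def undef (c j n : Nat) : List Nat :=
  Nat.rec [] (fun k ih => cond (Nat.beq (Nat.mul 5 k) j) ih
    (cond (defined c (Nat.mul 5 k)) ih (Nat.mul 5 k :: ih))) n

def rows (c j : Nat) (t : List Nat) : List Item :=
  List.rec [Item.bad] (fun y u _ => List.rec [Item.bad] (fun z v _ =>
    List.rec [Item.row c j y, Item.row c j z] (fun _ _ _ => [Item.bad]) v) u) t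

def leaf : Item → List Item :=
  Item.rec (fun c _ => List.rec [Item.nh c] (fun j t _ =>
      cond (Nat.ble (hd t) 12) (rows c j (undef c j 8)) [Item.bad]) (run c 40 0 0 0))
    (fun c x z => [Item.row c x z]) (fun c => [Item.nh c]) [Item.bad]

def drop {α : Type} (l : List α) (n : Nat) : List α :=
  Nat.rec (fun l => l) (fun _ ih l => ih (List.rec [] (fun _ t _ => t) l)) n l

def take {α : Type} (l : List α) : Nat → List α :=
  List.rec (fun _ => []) (fun x _ ih n => Nat.rec [] (fun m _ => x :: ih m) n) l

def blank : Nat := 0x8421084210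

def root : List Item :=
  [Item.node (fill blank 0 2) 0, Item.node (fill blank 0 3) 0,
   Item.node (fill blank 0 6) 1, Item.node (fill blank 0 7) 1]

def frontier : List Item := flat branch (flat branch root)

def grow (l : List Item) : List Item := flat leaf (flat branch (flat branch l))

/-! ### Settling a slice -/

def full (n : Nat) : Nat := Nat.sub (Nat.shiftLeft 1 n) 1

def lmap (f : Nat → Nat) (l : List Nat) : List Nat := List.rec [] (fun x _ ih => f x :: ih) l

def len (l : List Nat) : Nat := List.rec 0 (fun _ _ ih => Nat.add ih 1) l

/-- Concatenate blocks of `w` bits. -/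
def cat (w : Nat) (l : List Nat) : Nat :=
  List.rec 0 (fun x _ ih => Nat.add x (Nat.shiftLeft ih w)) l

def chops (n : Nat) : List Nat → List Nat :=
  Nat.rec (fun _ => []) (fun _ ih l =>
    List.rec [] (fun _ _ _ => cat 128 (lmap (Nat.land (full 128)) (take l 64)) :: ih
      (drop l 64)) l) n

/-- Concatenate the low 128 bits of every 64 numbers. -/
def chop (l : List Nat) : List Nat := chops (len l) l

def combMask : Nat := cat 128 (lmap (fun _ => 1) (List.replicate 64 0))

/-- Collect bit `k` of numbers concatenated by `chop`. -/
def comb (l : List Nat) (k : Nat) : Nat :=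
  cat 64 (lmap (fun x => Nat.mod (Nat.land (Nat.shiftRight x k) combMask)
    0xfffffffffffffffffffffffffffffffe) l)

def tab (f : Nat → Nat → Nat) : Cols :=
  (fun g => ⟨g 0, g 1, g 3, g 2, g 4⟩)
    (fun e => [f 0 e, f 5 e, f 10 e, f 15 e, f 20 e, f 25 e, f 30 e, f 35 e])

/-- The transition tables of a list of machines. -/
def codeTab (l : List Nat) : Cols :=
  (fun b => tab (fun j e => comb b (Nat.add j e))) (chop l)

/-- The rows of a list of items, with `x` and `z` encoded from bits 40 and 80. -/
def rowCodes (l : List Item) : List Nat :=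
  List.rec [] (fun x _ ih => Item.rec (fun _ _ => ih)
    (fun c x z => Nat.lor c (Nat.lor (Nat.shiftLeft 1 (Nat.add 40 x))
      (Nat.shiftLeft 1 (Nat.add 80 z))) :: ih)
    (fun _ => ih) ih x) l

/-- Stack `2 ^ k` copies of `x`, of `n` bits each. -/
def stack (n k x : Nat) : Nat :=
  Nat.rec x (fun i ih => Nat.lor ih (Nat.shiftLeft ih (Nat.shiftLeft n i))) k

/-- Within `2 ^ k` blocks of `n` bits, those whose number has bit `e`. -/
def pat (n e k : Nat) : Nat :=
  Nat.rec (full n) (fun i ih => cond (Nat.beq i e) (Nat.shiftLeft ih (Nat.shiftLeft n i))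
    (Nat.lor ih (Nat.shiftLeft ih (Nat.shiftLeft n i)))) k

/-- Lane `i n + r` is row `r` with the transitions at `z` and `x` filled in with the low
and high bits of `i < 256`. -/
def rowTab (n : Nat) (l : List Nat) : Cols :=
  (fun b p => tab (fun j e => (fun x z => Nat.lor
      (andNot (stack n 8 (comb b (Nat.add j e))) (Nat.lor x z))
      (cond (Nat.beq e 4) 0 (Nat.lor (Nat.land x (nth p (Nat.add 4 e))) (Nat.land z (nth p e)))))
    (stack n 8 (comb b (Nat.add 40 j))) (stack n 8 (comb b (Nat.add 80 j)))))
  (chop l) (lmap (fun e => pat n e 8) [0, 1, 2, 3, 4, 5, 6, 7])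

def noBad (l : List Item) : Bool :=
  List.rec true (fun x _ ih => Item.rec (fun _ _ => false) (fun _ _ _ => ih) (fun _ => ih)
    false x) l

def nhs (l : List Item) : List Nat :=
  List.rec [] (fun x _ ih => Item.rec (fun _ _ => ih) (fun _ _ _ => ih) (fun c => c :: ih) ih x) l

/-- A set `V` of lanes together with their transition tables. -/
structure Bag where
  V : Nat
  T : Cols

def cmap (f : Nat → Nat) (T : Cols) : Cols :=
  ⟨lmap f T.W, lmap f T.D, lmap f T.A, lmap f T.B, lmap f T.H⟩

/-- Move lanes down by `s` wherever there is room. -/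
def slide (s : Nat) (b : Bag) : Bag :=
  (fun m => ⟨Nat.xor b.V (Nat.lor m (Nat.shiftLeft m s)),
      cmap (fun x => mux1 m (Nat.shiftRight x s) x) b.T⟩)
    (andNot (Nat.shiftRight b.V s) b.V)

/-- Drop the lanes from `n` on if there are none. -/
def trim (n : Nat) (b : Bag) : Bag :=
  cond (Nat.beq (Nat.shiftRight b.V n) 0) ⟨b.V, cmap (Nat.land (full n)) b.T⟩ b

/-- Squeeze the lanes from `[0, 2n)` into `[0, n)`. -/
def halve (n : Nat) (b : Bag) : Bag :=
  trim n (Nat.rec (fun b => b) (fun i ih b =>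
    cond (Nat.beq (Nat.shiftRight b.V n) 0) b
      ((fun r => ih (slide (Nat.add n r) (slide (Nat.sub n r) b)))
        (Nat.mod (Nat.mul 611 (Nat.mul i i)) n))) 60 b)

def halves (n k : Nat) : Bag → Bag :=
  Nat.rec (fun _ b => b) (fun _ ih n b => ih (Nat.div (Nat.add n 1) 2)
    (halve (Nat.div (Nat.add n 1) 2) b)) k n

def ther : List Nat := [0, 0, 0, 0, 0, 0, 0, 0, 0, 0, 0, 0, 0, 0, 0, 0, 0, 0, 0, 0]

/-- Drop the lanes below `N` which are settled. -/
def settle (N n k h : Nat) (b : Bag) : Bag :=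
  ⟨andNot b.V (andNot (full N) (unsettled b.T (full N) ther n k h)), b.T⟩

/-- Put `y` above the low `n` bits of `x`, for lists. -/
def above (n : Nat) (x : List Nat) : List Nat → List Nat :=
  List.rec (fun y => lmap (fun b => Nat.shiftLeft b n) y)
    (fun a _ ih y => Nat.lor (Nat.land (full n) a) (Nat.shiftLeft (hd y) n) :: ih (tl y)) x

/-- Add the machines `l` to a bag with lanes below `n`. -/
def add (n : Nat) (l : List Nat) (b : Bag) : Bag :=
  cond (Nat.beq (Nat.shiftRight b.V n) 0)
    ((fun T => ⟨Nat.lor b.V (Nat.shiftLeft (full (len l)) n),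
      ⟨above n b.T.W T.W, above n b.T.D T.D, above n b.T.A T.A, above n b.T.B T.B,
        above n b.T.H T.H⟩⟩) (codeTab l))
    ⟨1, ⟨[], [], [], [], [1]⟩⟩

def pad (l : List Nat) : List Nat :=
  [nth l 0, nth l 1, nth l 2, nth l 3, nth l 4, nth l 5, nth l 6, nth l 7]

def cpad (T : Cols) : Cols := ⟨pad T.W, pad T.D, pad T.A, pad T.B, pad T.H⟩

/-- The `n` masks of which the one at `k` is full. -/
def one (F n k : Nat) : List Nat :=
  Nat.rec (fun _ => []) (fun _ ih i => cond (Nat.beq i k) F 0 :: ih (Nat.succ i)) n 0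

def gmat (F n : Nat) (d : List Nat) : List (List Nat) :=
  List.rec [] (fun k _ ih => one F n k :: ih) d

/-- Drop the lanes below `N` settled by the closure with a fixed automaton. -/
def sift (N n : Nat) (d e : List Nat) (b : Bag) : Bag :=
  ⟨andNot b.V (andNot (full N) (closure (full N) (cpad b.T)
    ⟨gmat (full N) 4 d, gmat (full N) 4 e, gmat (full N) 4 d, gmat (full N) 4 e⟩ n)), b.T⟩

/-- Indices of the bits of `m` below `2 ^ d`, shifted by `i`, mapped by `f`. -/
def bits (f : Nat → Nat) (d : Nat) : Nat → Nat → List Nat → List Nat :=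
  Nat.rec (fun m i acc => cond (Nat.beq m 0) acc (f i :: acc)) (fun d ih m i acc =>
    cond (Nat.beq m 0) acc
      (ih (Nat.land m (full (Nat.shiftLeft 1 d))) i
        (ih (Nat.shiftRight m (Nat.shiftLeft 1 d)) (Nat.add i (Nat.shiftLeft 1 d)) acc))) d

def cell (x i : Nat) : Nat := Nat.land (Nat.shiftRight x i) 1

def interleave (w : List Nat) : List Nat → List Nat → List Nat → List Nat → List Nat :=
  List.rec (fun _ _ _ _ => []) (fun x _ ih d b a h =>
    x :: hd d :: hd b :: hd a :: hd h :: ih (tl d) (tl b) (tl a) (tl h)) w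

/-- The code of lane `i`, given the columns by increasing bit number. -/
def codeOf (l : List Nat) (i : Nat) : Nat :=
  List.rec 0 (fun x _ ih => Nat.add (cell x i) (Nat.mul 2 ih)) l

def codes (b : Bag) : List Nat :=
  bits (codeOf (interleave (pad b.T.W) (pad b.T.D) (pad b.T.B) (pad b.T.A) (pad b.T.H))) 20 b.V 0 []

/-- The machines of a list of items which are not settled. -/
def rest (l : List Item) : Bag :=
  (fun r => (fun n => (fun l' =>
    (fun N1 N2 =>
      sift (Nat.add (Nat.div (Nat.add N2 (len l')) 8) 1) 32 [0, 2, 0, 2] [1, 3, 1, 3]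
        (halves (Nat.add N2 (len l')) 3
          (sift (Nat.add N2 (len l')) 24 [0, 2, 3, 2] [1, 3, 1, 1]
            (add N2 l' (halves N1 2 (settle N1 32 40 35
              (halves (Nat.mul 256 n) 3
                (settle (Nat.mul 256 n) 16 16 0 ⟨full (Nat.mul 256 n), rowTab n r⟩))))))))
      (Nat.mul 32 n) (Nat.mul 8 n)) (nhs l)) (len r))
    (rowCodes l)

def eqList (l : List Nat) : List Nat → Bool :=
  List.rec (List.rec true (fun _ _ _ => false))
    (fun x _ ih => List.rec false (fun y t _ => cond (Nat.beq x y) (ih t) false)) l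

/-- All machines of the items `l` are fine, provided that those with codes in `D` are. -/
def leaves (l : List Item) (D : List Nat) : Bool :=
  cond (noBad l) ((fun b => cond (Nat.beq (Nat.shiftRight b.V 1048576) 0)
    (eqList (codes b) (lmap (Nat.land (full 40)) D)) false) (rest l)) false

end BB4
end

namespace BB4

theorem nth_eq (l : List Nat) (k : Nat) : nth l k = l.getD k 0 := by
  induction l generalizing k with
  | nil => rfl
  | cons x l ih =>
    cases k with
    | zero => rfl
    | succ k => exact (ih k).trans (by simp)

@[simp] theorem nth_nil (k : Nat) : nth [] k = 0 := rfl

@[simp] theorem nth_cons_zero (x : Nat) (l : List Nat) : nth (x :: l) 0 = x := rfl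

@[simp] theorem nth_cons_succ (x : Nat) (l : List Nat) (k : Nat) :
    nth (x :: l) (k + 1) = nth l k := rfl

theorem hd_eq (l : List Nat) : hd l = nth l 0 := by cases l <;> rfl

@[simp] theorem nth_tl (l : List Nat) (k : Nat) : nth (tl l) k = nth l (k + 1) := by
  cases l <;> rfl

/-- Bit `i` of entry `k`. -/
def bit (i : Nat) (l : List Nat) (k : Nat) : Bool := (nth l k).testBit i

@[simp] theorem bit_nil (i k : Nat) : bit i [] k = false := by simp [bit]

@[simp] theorem bit_cons_zero (i x : Nat) (l : List Nat) : bit i (x :: l) 0 = x.testBit i := rfl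

@[simp] theorem bit_cons_succ (i x : Nat) (l : List Nat) (k : Nat) :
    bit i (x :: l) (k + 1) = bit i l k := rfl

@[simp] theorem bit_tl (i : Nat) (l : List Nat) (k : Nat) : bit i (tl l) k = bit i l (k + 1) := by
  simp [bit]

@[simp] theorem testBit_hd (i : Nat) (l : List Nat) : (hd l).testBit i = bit i l 0 := by
  simp [bit, hd_eq]

@[simp] theorem testBit_land (x y i : Nat) :
    (Nat.land x y).testBit i = (x.testBit i && y.testBit i) := Nat.testBit_and x y i

@[simp] theorem testBit_lor (x y i : Nat) :
    (Nat.lor x y).testBit i = (x.testBit i || y.testBit i) := Nat.testBit_or x y i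

@[simp] theorem testBit_lxor (x y i : Nat) :
    (Nat.xor x y).testBit i = (x.testBit i ^^ y.testBit i) := Nat.testBit_xor x y i

@[simp] theorem testBit_andNot (x y i : Nat) :
    (andNot x y).testBit i = (x.testBit i && !y.testBit i) := by
  simp only [andNot, testBit_lxor, testBit_land]
  cases x.testBit i <;> cases y.testBit i <;> rfl

@[simp] theorem testBit_mux1 (d x y i : Nat) :
    (mux1 d x y).testBit i = bif d.testBit i then x.testBit i else y.testBit i := by
  simp only [mux1, testBit_lxor, testBit_land]
  cases d.testBit i <;> cases x.testBit i <;> cases y.testBit i <;> rfl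

@[simp] theorem bit_mux (i d : Nat) (x y : List Nat) (k : Nat) :
    bit i (mux d x y) k = bif d.testBit i then bit i x k else bit i y k := by
  induction x generalizing y k with
  | nil =>
    induction y generalizing k with
    | nil => simp [mux]
    | cons a y ih =>
      have h : mux d [] (a :: y) = mux1 d 0 a :: mux d [] y := rfl
      rw [h]
      cases k with
      | zero => simp
      | succ k => simpa using ih k
  | cons a x ih =>
    have h : mux d (a :: x) y = mux1 d a (hd y) :: mux d x (tl y) := rfl
    rw [h]
    cases k with
    | zero => simp
    | succ k => simp [ih]

theorem dot_cons (x : Nat) (xs ys : List Nat) :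
    dot (x :: xs) ys = Nat.lor (Nat.land x (hd ys)) (dot xs (tl ys)) := rfl

theorem testBit_dot {i : Nat} {x y : List Nat} :
    (dot x y).testBit i = true ↔ ∃ k, bit i x k = true ∧ bit i y k = true := by
  induction x generalizing y with
  | nil => simp [dot]
  | cons a x ih =>
    rw [dot_cons]
    simp only [testBit_lor, testBit_land, Bool.or_eq_true, Bool.and_eq_true, ih, testBit_hd, bit_tl]
    constructor
    · rintro (h | ⟨k, h⟩)
      · exact ⟨0, h⟩
      · exact ⟨k + 1, h⟩
    · rintro ⟨_ | k, h⟩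
      · exact Or.inl h
      · exact Or.inr ⟨k, h⟩

@[simp] theorem bit_radd (i : Nat) (x y : List Nat) (k : Nat) :
    bit i (radd x y) k = (bit i x k || bit i y k) := by
  induction x generalizing y k with
  | nil => simp [radd]
  | cons a x ih =>
    cases y with
    | nil =>
      have h : radd (a :: x) [] = a :: x := rfl
      simp [h]
    | cons b y =>
      have h : radd (a :: x) (b :: y) = Nat.lor a b :: radd x y := rfl
      rw [h]
      cases k with
      | zero => simp
      | succ k => simp [ih]

@[simp] theorem bit_rscale (i m : Nat) (x : List Nat) (k : Nat) :
    bit i (rscale m x) k = (m.testBit i && bit i x k) := by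
  induction x generalizing k with
  | nil => simp [rscale]
  | cons a x ih =>
    have h : rscale m (a :: x) = Nat.land m a :: rscale m x := rfl
    rw [h]
    cases k with
    | zero => simp
    | succ k => simp [ih]

theorem testBit_rany {i : Nat} {x : List Nat} :
    (rany x).testBit i = true ↔ ∃ k, bit i x k = true := by
  induction x with
  | nil => simp [rany]
  | cons a x ih =>
    have h : rany (a :: x) = Nat.lor a (rany x) := rfl
    simp only [h, testBit_lor, Bool.or_eq_true, ih]
    constructor
    · rintro (h | ⟨k, h⟩)
      · exact ⟨0, h⟩
      · exact ⟨k + 1, h⟩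
    · rintro ⟨_ | k, h⟩
      · exact Or.inl h
      · exact Or.inr ⟨k, h⟩

theorem bit_le_of_rdiff {i : Nat} {x y : List Nat} (h : (rdiff x y).testBit i = false) (k : Nat)
    (hk : bit i x k = true) : bit i y k = true := by
  induction x generalizing y k with
  | nil => simp at hk
  | cons a x ih =>
    have e : rdiff (a :: x) y = Nat.lor (andNot a (hd y)) (rdiff x (tl y)) := rfl
    rw [e] at h
    simp only [testBit_lor, testBit_andNot, Bool.or_eq_false_iff, testBit_hd] at h
    cases k with
    | zero => simp at hk; simpa [hk] using h.1
    | succ k => simpa using ih h.2 k (by simpa using hk)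

theorem bit_eq_of_neq {i : Nat} {x y : List Nat} (h : (neq x y).testBit i = false) (k : Nat) :
    bit i x k = bit i y k := by
  induction x generalizing y k with
  | nil =>
    have e : ¬ (rany y).testBit i = true := by simpa [neq] using h
    rw [testBit_rany] at e
    simpa using fun hk => e ⟨k, hk⟩
  | cons a x ih =>
    have e : neq (a :: x) y = Nat.lor (Nat.xor a (hd y)) (neq x (tl y)) := rfl
    rw [e] at h
    simp only [testBit_lor, testBit_lxor, Bool.or_eq_false_iff, testBit_hd] at h
    cases k with
    | zero => simpa using h.1
    | succ k => simpa using ih h.2 k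

theorem bit_of_neqIn {i : Nat} {e a x y : List Nat} (h : (neqIn e a x y).testBit i = false)
    (k : Nat) (hk : bit i e k = true) : bit i a k = true ∧ bit i x k = bit i y k := by
  induction e generalizing a x y k with
  | nil => simp at hk
  | cons b e ih =>
    have h' : neqIn (b :: e) a x y = Nat.lor (andNot b (andNot (hd a) (Nat.xor (hd x) (hd y))))
      (neqIn e (tl a) (tl x) (tl y)) := rfl
    rw [h'] at h
    simp only [testBit_lor, testBit_andNot, testBit_lxor, Bool.or_eq_false_iff, testBit_hd] at h
    cases k with
    | zero =>
      simp only [bit_cons_zero] at hk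
      have := h.1
      rw [hk] at this
      revert this
      cases bit i a 0 <;> cases bit i x 0 <;> cases bit i y 0 <;> simp
    | succ k => simpa using ih h.2 k (by simpa using hk)


/-! ### Semantics on half tapes -/

/-- A transition table indexed by `2 * state + symbol`: symbol written, whether to move right,
whether to halt, and the next state. -/
structure Tab where
  w : ℕ → Bool
  d : ℕ → Bool
  h : ℕ → Bool
  q : ℕ → ℕ

/-- State, scanned symbol, the two half tapes and the number of ones. -/
structure Conf where
  q : ℕ
  s : Bool
  l : ℕ → Bool
  r : ℕ → Bool
  o : ℤ

def Conf.key (c : Conf) : ℕ := 2 * c.q + c.s.toNat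

def push (b : Bool) (f : ℕ → Bool) : ℕ → Bool
  | 0 => b
  | k + 1 => f k

def pull (f : ℕ → Bool) (k : ℕ) : Bool := f (k + 1)

@[simp] theorem push_zero (b : Bool) (f : ℕ → Bool) : push b f 0 = b := rfl

@[simp] theorem push_succ (b : Bool) (f : ℕ → Bool) (k : ℕ) : push b f (k + 1) = f k := rfl

def Tab.next (T : Tab) (c : Conf) : Conf :=
  if T.d c.key then
    ⟨T.q c.key, c.r 0, push (T.w c.key) c.l, pull c.r, c.o + (T.w c.key).toInt - c.s.toInt⟩
  else
    ⟨T.q c.key, c.l 0, pull c.l, push (T.w c.key) c.r, c.o + (T.w c.key).toInt - c.s.toInt⟩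

def Conf.start : Conf := ⟨0, false, fun _ => false, fun _ => false, 0⟩

/-- The configuration after `n` steps. -/
def Tab.conf (T : Tab) (n : ℕ) : Conf := T.next^[n] Conf.start

theorem Tab.conf_succ (T : Tab) (n : ℕ) : T.conf (n + 1) = T.next (T.conf n) :=
  Function.iterate_succ_apply' _ _ _

/-- The halting transition is reached after `n` steps. -/
def Tab.HaltsAt (T : Tab) (n : ℕ) : Prop :=
  T.h (T.conf n).key = true ∧ ∀ m < n, T.h (T.conf m).key = false

def Tab.Never (T : Tab) : Prop := ∀ n, T.h (T.conf n).key = false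

/-- The machine obeys the busy beaver bounds. -/
def Tab.Good (T : Tab) : Prop :=
  ∀ n, T.HaltsAt n → n + 1 ≤ 107 ∧ (T.conf n).o + 1 - (T.conf n).s.toInt ≤ 13

theorem Tab.Never.good {T : Tab} (h : T.Never) : T.Good := fun n hn => by
  have := hn.1
  rw [h n] at this
  exact absurd this Bool.false_ne_true

def Tab.Small (T : Tab) : Prop := ∀ k, T.q k < 4

theorem Conf.key_lt {c : Conf} (h : c.q < 4) : c.key < 8 := by
  unfold Conf.key
  cases c.s <;> simp <;> omega

@[simp] theorem Tab.next_q (T : Tab) (c : Conf) : (T.next c).q = T.q c.key := by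
  unfold Tab.next; split <;> rfl

@[simp] theorem Tab.next_o (T : Tab) (c : Conf) :
    (T.next c).o = c.o + (T.w c.key).toInt - c.s.toInt := by
  unfold Tab.next; split <;> rfl

theorem Tab.conf_q_lt {T : Tab} (h : T.Small) (n : ℕ) : (T.conf n).q < 4 := by
  cases n with
  | zero => simp [Tab.conf, Conf.start]
  | succ n => rw [Tab.conf_succ, Tab.next_q]; exact h _

theorem Tab.key_lt {T : Tab} (h : T.Small) (n : ℕ) : (T.conf n).key < 8 :=
  Conf.key_lt (Tab.conf_q_lt h n)

/-- `T'` agrees with `T` where the latter does not halt. -/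
def Tab.Sub (T T' : Tab) : Prop :=
  ∀ k < 8, T.h k = false → T'.h k = false ∧ T'.w k = T.w k ∧ T'.d k = T.d k ∧ T'.q k = T.q k

theorem Tab.Sub.next {T T' : Tab} (h : T.Sub T') {c : Conf} (hc : c.key < 8)
    (hh : T.h c.key = false) : T'.next c = T.next c := by
  obtain ⟨-, hw, hd, hq⟩ := h _ hc hh
  simp [Tab.next, hw, hd, hq]

theorem Tab.Sub.conf {T T' : Tab} (h : T.Sub T') (hT : T.Small) {n : ℕ}
    (hn : ∀ m < n, T.h (T.conf m).key = false) : T'.conf n = T.conf n := by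
  induction n with
  | zero => rfl
  | succ n ih =>
    rw [Tab.conf_succ, Tab.conf_succ, ih fun m hm => hn m (by omega),
      h.next (Tab.key_lt hT n) (hn n (by omega))]

theorem Tab.Sub.never {T T' : Tab} (h : T.Sub T') (hT : T.Small) (hn : T.Never) : T'.Never :=
  fun n => by
    rw [h.conf hT fun m _ => hn m]
    exact (h _ (Tab.key_lt hT n) (hn n)).1

/-- Machines with the same non-halting transitions. -/
theorem Tab.Sub.good {T T' : Tab} (h : T.Sub T') (h' : ∀ k < 8, T.h k = true → T'.h k = true)
    (hT : T.Small) (hg : T.Good) : T'.Good := by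
  intro n hn
  have key : ∀ m ≤ n, ∀ j < m, T.h (T.conf j).key = false := by
    intro m
    induction m with
    | zero => intro _ j hj; omega
    | succ m ih =>
      intro hm j hj
      rcases Nat.lt_succ_iff_lt_or_eq.1 hj with hj | rfl
      · exact ih (by omega) j hj
      · have e := h.conf hT (ih (by omega))
        by_contra hc
        have := h' _ (Tab.key_lt hT j) (by simpa using hc)
        rw [← e, hn.2 j (by omega)] at this
        exact Bool.false_ne_true this
  have e := h.conf hT (key n le_rfl)
  have hh : T.HaltsAt n := by
    refine ⟨?_, key n le_rfl⟩
    by_contra hc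
    have := (h _ (Tab.key_lt hT n) (by simpa using hc)).1
    rw [← e, hn.1] at this
    exact Bool.false_ne_true this.symm
  rw [e]
  exact hg n hh

theorem Tab.HaltsAt.unique {T : Tab} {m n : ℕ} (hm : T.HaltsAt m) (hn : T.HaltsAt n) : m = n := by
  by_contra hne
  rcases Nat.lt_or_gt_of_ne hne with h | h
  · exact Bool.false_ne_true ((hn.2 m h).symm.trans hm.1)
  · exact Bool.false_ne_true ((hm.2 n h).symm.trans hn.1)

/-! #### Symmetries -/

def Tab.flip (T : Tab) : Tab := { T with d := fun k => !T.d k }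

def Conf.flip (c : Conf) : Conf := { c with l := c.r, r := c.l }

theorem Tab.flip_next (T : Tab) (c : Conf) : T.flip.next c.flip = (T.next c).flip := by
  have h : c.flip.key = c.key := rfl
  unfold Tab.next
  rw [h]
  cases hd : T.d c.key <;> simp [Tab.flip, Conf.flip, hd]

theorem Tab.flip_conf (T : Tab) (n : ℕ) : T.flip.conf n = (T.conf n).flip := by
  induction n with
  | zero => rfl
  | succ n ih => rw [Tab.conf_succ, Tab.conf_succ, ih, Tab.flip_next]

theorem Tab.good_of_flip {T : Tab} (h : T.flip.Good) : T.Good := by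
  intro n hn
  have := h n ⟨by rw [Tab.flip_conf]; exact hn.1, fun m hm => by
    rw [Tab.flip_conf]; exact hn.2 m hm⟩
  rwa [Tab.flip_conf] at this

/-- Rename the states. -/
def Tab.rename (f : ℕ → ℕ) (T : Tab) : Tab where
  w k := T.w (2 * f (k / 2) + k % 2)
  d k := T.d (2 * f (k / 2) + k % 2)
  h k := T.h (2 * f (k / 2) + k % 2)
  q k := f (T.q (2 * f (k / 2) + k % 2))

def Conf.rename (f : ℕ → ℕ) (c : Conf) : Conf := { c with q := f c.q }

theorem Conf.rename_key {f : ℕ → ℕ} (hf : ∀ q, f (f q) = q) (c : Conf) :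
    2 * f ((c.rename f).key / 2) + (c.rename f).key % 2 = c.key := by
  have : (c.rename f).key / 2 = f c.q ∧ (c.rename f).key % 2 = c.s.toNat := by
    unfold Conf.key Conf.rename
    cases c.s <;> simp
    omega
  rw [this.1, this.2, hf]
  rfl

theorem Tab.rename_next {f : ℕ → ℕ} (hf : ∀ q, f (f q) = q) (T : Tab) (c : Conf) :
    (T.rename f).next (c.rename f) = (T.next c).rename f := by
  unfold Tab.next Tab.rename
  simp only [Conf.rename_key hf]
  cases hd : T.d c.key <;> simp [Conf.rename]

theorem Tab.rename_conf {f : ℕ → ℕ} (hf : ∀ q, f (f q) = q) (h0 : f 0 = 0) (T : Tab) (n : ℕ) :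
    (T.rename f).conf n = (T.conf n).rename f := by
  induction n with
  | zero => simp [Tab.conf, Conf.start, Conf.rename, h0]
  | succ n ih => rw [Tab.conf_succ, Tab.conf_succ, ih, Tab.rename_next hf]

theorem Tab.good_of_rename {f : ℕ → ℕ} (hf : ∀ q, f (f q) = q) (h0 : f 0 = 0) {T : Tab}
    (h : (T.rename f).Good) : T.Good := by
  have key : ∀ n, (T.rename f).h ((T.rename f).conf n).key = T.h (T.conf n).key := fun n => by
    rw [Tab.rename_conf hf h0]
    exact congrArg T.h (Conf.rename_key hf _)
  intro n hn
  have := h n ⟨by rw [key]; exact hn.1, fun m hm => by rw [key]; exact hn.2 m hm⟩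
  rwa [Tab.rename_conf hf h0] at this

/-! #### Loops -/

/-- The configurations differ at most in the left half tape from cell `n` on. -/
structure Conf.Agree (n : ℕ) (c c' : Conf) : Prop where
  q : c'.q = c.q
  s : c'.s = c.s
  r : c'.r = c.r
  l : ∀ k < n, c'.l k = c.l k

theorem Conf.Agree.key {n : ℕ} {c c' : Conf} (h : c.Agree n c') : c'.key = c.key := by
  simp [Conf.key, h.q, h.s]

theorem Conf.Agree.mono {m n : ℕ} {c c' : Conf} (h : c.Agree n c') (hm : m ≤ n) : c.Agree m c' :=
  ⟨h.q, h.s, h.r, fun k hk => h.l k (by omega)⟩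

theorem Conf.Agree.trans {n : ℕ} {c c' c'' : Conf} (h : c.Agree n c') (h' : c'.Agree n c'') :
    c.Agree n c'' :=
  ⟨h'.q.trans h.q, h'.s.trans h.s, h'.r.trans h.r, fun k hk => (h'.l k hk).trans (h.l k hk)⟩

theorem Conf.Agree.right {n : ℕ} {c c' : Conf} (h : c.Agree n c') {T : Tab}
    (hd : T.d c.key = true) : (T.next c).Agree (n + 1) (T.next c') := by
  unfold Tab.next
  simp only [h.key, hd, if_true, h.r]
  refine ⟨rfl, rfl, rfl, fun k hk => ?_⟩
  cases k with
  | zero => rfl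
  | succ k => exact h.l k (by omega)

theorem Conf.Agree.left {n : ℕ} {c c' : Conf} (h : c.Agree (n + 1) c') {T : Tab}
    (hd : T.d c.key = false) : (T.next c).Agree n (T.next c') := by
  unfold Tab.next
  simp only [h.key, hd, h.r, h.l 0 (by omega)]
  exact ⟨rfl, rfl, rfl, fun k hk => h.l (k + 1) (by omega)⟩

/-- Configurations agreeing with `c` to depth `e` agree with the configuration `n` steps later to
depth `a`, and these steps do not halt. -/
def Tab.Loop (T : Tab) (c : Conf) (n e a : ℕ) : Prop :=
  (∀ m < n, T.h (T.next^[m] c).key = false) ∧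
    ∀ j c', c.Agree (e + j) c' → (∀ m < n, T.h (T.next^[m] c').key = false) ∧
      (T.next^[n] c).Agree (a + j) (T.next^[n] c')

theorem Tab.Loop.refl (T : Tab) (c : Conf) : T.Loop c 0 0 0 :=
  ⟨fun m hm => by omega, fun j c' h => ⟨fun m hm => by omega, h⟩⟩

theorem Tab.Loop.step {T : Tab} {c : Conf} {n e a e' a' : ℕ} (h : T.Loop c n e a)
    (hh : T.h (T.next^[n] c).key = false)
    (hs : if T.d (T.next^[n] c).key then e' = e ∧ a' = a + 1
      else if a = 0 then e' = e + 1 ∧ a' = 0 else e' = e ∧ a' = a - 1) :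
    T.Loop c (n + 1) e' a' := by
  refine ⟨fun m hm => ?_, fun j c' hj => ?_⟩
  · rcases Nat.lt_succ_iff_lt_or_eq.1 hm with hm | rfl
    · exact h.1 m hm
    · exact hh
  have key : ∀ i, c.Agree (e + i) c' → ∀ m < n + 1, T.h (T.next^[m] c').key = false := by
    intro i hi m hm
    rcases Nat.lt_succ_iff_lt_or_eq.1 hm with hm | rfl
    · exact (h.2 i c' hi).1 m hm
    · rw [(h.2 i c' hi).2.key]; exact hh
  rw [Function.iterate_succ_apply', Function.iterate_succ_apply']
  split at hs
  next hd =>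
    obtain ⟨rfl, rfl⟩ := hs
    refine ⟨key j hj, ?_⟩
    have := (h.2 j c' hj).2.right hd
    rwa [show a + 1 + j = a + j + 1 by omega]
  next hd =>
    split at hs
    next ha =>
      obtain ⟨rfl, rfl⟩ := hs
      have hj' : c.Agree (e + (j + 1)) c' := by rwa [show e + (j + 1) = e + 1 + j by omega]
      refine ⟨key _ hj', ?_⟩
      have := (h.2 _ c' hj').2
      rw [ha, show 0 + (j + 1) = 0 + j + 1 by omega] at this
      exact this.left (by simpa using hd)
    next ha =>
      obtain ⟨rfl, rfl⟩ := hs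
      refine ⟨key j hj, ?_⟩
      have := (h.2 j c' hj).2
      rw [show a + j = a - 1 + j + 1 by omega] at this
      exact this.left (by simpa using hd)

theorem Tab.Loop.never {T : Tab} {c : Conf} {n e a : ℕ} (h : T.Loop c n e a) (hn : 0 < n)
    (hea : e ≤ a) (hc : c.Agree e (T.next^[n] c)) (m : ℕ) : T.h (T.next^[m] c).key = false := by
  have key : ∀ m c', c.Agree e c' → T.h (T.next^[m] c').key = false := by
    intro m
    induction m using Nat.strong_induction_on with
    | _ m ih =>
      intro c' hc'
      obtain ⟨h1, h2⟩ := h.2 0 c' hc'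
      rcases Nat.lt_or_ge m n with hm | hm
      · exact h1 m hm
      · obtain ⟨m, rfl⟩ := Nat.exists_eq_add_of_le hm
        rw [Nat.add_comm, Function.iterate_add_apply]
        exact ih m (by omega) _ (hc.trans (h2.mono hea))
  exact key m c ⟨rfl, rfl, rfl, fun _ _ => rfl⟩

theorem Tab.never_of_iterate {T : Tab} {n : ℕ} (h : ∀ m < n, T.h (T.conf m).key = false)
    (h' : ∀ m, T.h (T.next^[m] (T.conf n)).key = false) : T.Never := by
  intro m
  rcases Nat.lt_or_ge m n with hm | hm
  · exact h m hm
  · obtain ⟨m, rfl⟩ := Nat.exists_eq_add_of_le hm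
    rw [Tab.conf, Nat.add_comm, Function.iterate_add_apply]
    exact h' m

theorem Tab.flip_iterate (T : Tab) (c : Conf) (n : ℕ) :
    T.flip.next^[n] c.flip = (T.next^[n] c).flip := by
  induction n with
  | zero => rfl
  | succ n ih => rw [Function.iterate_succ_apply', Function.iterate_succ_apply', ih, Tab.flip_next]


/-! ### Correctness of the simulation -/

/-- The machine in lane `i`. -/
def lane (T : Cols) (i : ℕ) : Tab where
  w := bit i T.W
  d := bit i T.D
  h := bit i T.H
  q k := 2 * (bit i T.A k).toNat + (bit i T.B k).toNat

theorem lane_small (T : Cols) (i : ℕ) : (lane T i).Small := fun k => by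
  simp only [lane]
  cases bit i T.A k <;> cases bit i T.B k <;> simp

theorem testBit_dot_sel (i act a b s : ℕ) (x : List ℕ) :
    (dot (sel act a b s) x).testBit i = (act.testBit i &&
      bit i x (2 * (2 * (a.testBit i).toNat + (b.testBit i).toNat) + (s.testBit i).toNat)) := by
  have h : ∀ y : List ℕ, dot [] y = 0 := fun _ => rfl
  simp only [sel, dot_cons, h, testBit_lor, testBit_land, testBit_andNot, testBit_hd, bit_tl,
    Nat.zero_testBit]
  cases act.testBit i <;> cases a.testBit i <;> cases b.testBit i <;> cases s.testBit i <;> simp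

/-- Lane `i` is in configuration `c`. -/
structure Sim.At (i : ℕ) (S : Sim) (c : Conf) : Prop where
  act : S.act.testBit i = true
  q : c.q = 2 * (S.qa.testBit i).toNat + (S.qb.testBit i).toNat
  s : c.s = S.s.testBit i
  l : ∀ k, bit i S.l k = c.l k
  r : ∀ k, bit i S.r k = c.r k

theorem Sim.At.key {i : ℕ} {S : Sim} {c : Conf} (h : S.At i c) : c.key =
    2 * (2 * (S.qa.testBit i).toNat + (S.qb.testBit i).toNat) + (S.s.testBit i).toNat := by
  rw [Conf.key, h.q, h.s]

theorem Sim.At.dot {i : ℕ} {S : Sim} {c : Conf} (h : S.At i c) (x : List ℕ) :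
    (dot (sel S.act S.qa S.qb S.s) x).testBit i = bit i x c.key := by
  rw [testBit_dot_sel, h.act, h.key, Bool.true_and]

theorem Sim.At.stp_act {i : ℕ} {S : Sim} {c : Conf} (h : S.At i c) (C : Cols) :
    (stp C S).act.testBit i = !(lane C i).h c.key := by
  simp [stp, h.dot, h.act, lane]

theorem bit_cons (i x : ℕ) (l : List ℕ) : bit i (x :: l) = push (x.testBit i) (bit i l) := by
  funext k; cases k <;> rfl

theorem Sim.At.step {i : ℕ} {S : Sim} {c : Conf} (h : S.At i c) {C : Cols}
    (hh : (lane C i).h c.key = false) : (stp C S).At i ((lane C i).next c) := by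
  refine ⟨by rw [h.stp_act, hh]; rfl, ?_, ?_, fun k => ?_, fun k => ?_⟩
  · rw [Tab.next_q]; simp [stp, h.dot, lane]
  all_goals
    simp only [stp, testBit_mux1, bit_mux, h.dot, testBit_hd, bit_tl, h.l, h.r, Tab.next, lane,
      bit_cons]
    have hl : bit i S.l = c.l := funext h.l
    have hr : bit i S.r = c.r := funext h.r
    by_cases hd : bit i C.D c.key = true <;> simp [hd, hl, hr, pull]

theorem stp_act_of_not {i : ℕ} {S : Sim} (h : S.act.testBit i = false) (C : Cols) :
    (stp C S).act.testBit i = false := by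
  simp [stp, h]

theorem length_thermo (x y : ℕ) (u : List ℕ) (p : ℕ) : (thermo x y u p).length = u.length := by
  induction u generalizing p with
  | nil => rfl
  | cons a u ih => exact congrArg (· + 1) (ih a)

theorem bit_thermo (i x y : ℕ) (u : List ℕ) (p k : ℕ) (hk : k < u.length) :
    bit i (thermo x y u p) k = ((bit i u k || (x.testBit i && bit i (p :: u) k)) &&
      !(y.testBit i && !bit i u (k + 1))) := by
  induction u generalizing p k with
  | nil => simp at hk
  | cons a u ih =>
    have e : thermo x y (a :: u) p =
        andNot (Nat.lor a (Nat.land x p)) (andNot y (hd u)) :: thermo x y u a := rfl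
    rw [e]
    cases k with
    | zero => simp
    | succ k => simpa using ih a k (by simpa using hk)

theorem bit_last {i d : ℕ} {u : List ℕ} (h : (last u d).testBit i = false) :
    bit i (d :: u) u.length = false := by
  induction u generalizing d with
  | nil => exact h
  | cons a u ih => exact ih (d := a) h

/-- The thermometer code bounds `o`. -/
def Sim.Count (i : ℕ) (S : Sim) (o : ℤ) : Prop :=
  S.ov.testBit i = false → o ≤ S.u.length ∧ ∀ k < S.u.length, bit i S.u k = false → o ≤ k

theorem Sim.Count.step {i : ℕ} {S : Sim} {c : Conf} (h : S.At i c) {o : ℤ} (hc : S.Count i o)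
    (C : Cols) :
    (stp C S).Count i (o + ((lane C i).w c.key).toInt - c.s.toInt) := by
  intro hov
  simp only [stp, testBit_lor, testBit_land, testBit_andNot, h.dot, Bool.or_eq_false_iff] at hov
  obtain ⟨h1, h2⟩ := hov
  obtain ⟨h3, h4⟩ := hc h1
  have hs := h.s
  have hw : (lane C i).w c.key = bit i C.W c.key := rfl
  simp only [stp, length_thermo]
  rw [hw, hs]
  rw [← hs] at h2
  refine ⟨?_, fun k hk hb => ?_⟩
  · rw [← hs]
    cases hw' : bit i C.W c.key <;> cases hs' : c.s <;> simp [hw', hs'] at h2 ⊢ <;> try omega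
    have := bit_last h2
    rcases hu : S.u.length with _ | n
    · rw [hu] at this
      simp [h.act] at this
    · rw [hu] at this
      have := h4 n (by omega) (by simpa using this)
      push_cast
      omega
  · rw [bit_thermo _ _ _ _ _ _ hk] at hb
    simp only [testBit_andNot, testBit_land, h.dot, h.act] at hb
    rw [← hs] at hb ⊢
    have h5 := h4 k hk
    have h6 : bit i S.u (k + 1) = false → o ≤ k + 1 := by
      intro h7
      rcases Nat.lt_or_ge (k + 1) S.u.length with h8 | h8
      · exact_mod_cast h4 _ h8 h7
      · have : S.u.length = k + 1 := by omega
        rw [this] at h3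
        exact_mod_cast h3
    have h7 : bit i (S.act :: S.u) k = false → o + 1 ≤ k := by
      intro h8
      cases k with
      | zero => simp [h.act] at h8
      | succ k =>
        have := h4 k (by omega) (by simpa using h8)
        push_cast
        omega
    cases hw' : bit i C.W c.key <;> cases hs' : c.s <;> simp [hw', hs'] at hb ⊢
    · exact h5 hb
    · by_cases hb' : bit i S.u k = true
      · have := h6 (hb hb'); omega
      · have := h5 (by simpa using hb'); omega
    · exact h7 hb.2
    · exact h5 hb

theorem Sim.Count.stp_of_not {i : ℕ} {S : Sim} (h : S.act.testBit i = false) {o : ℤ}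
    (hc : S.Count i o) (C : Cols) : (stp C S).Count i o := by
  have hd : ∀ x, (dot (sel S.act S.qa S.qb S.s) x).testBit i = false := fun x => by
    rw [testBit_dot_sel, h, Bool.false_and]
  intro hov
  simp only [stp, testBit_lor, testBit_land, testBit_andNot, hd, Bool.or_eq_false_iff] at hov
  obtain ⟨h3, h4⟩ := hc hov.1
  simp only [stp, length_thermo]
  refine ⟨h3, fun k hk hb => h4 k hk ?_⟩
  rw [bit_thermo _ _ _ _ _ _ hk] at hb
  simpa [hd, h] using hb

theorem stps_succ (C : Cols) (n : ℕ) (S : Sim) : stps C (n + 1) S = stps C n (stp C S) := rfl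

theorem stps_add (C : Cols) (m n : ℕ) (S : Sim) : stps C n (stps C m S) = stps C (m + n) S := by
  induction m generalizing S with
  | zero => rw [Nat.zero_add]; rfl
  | succ m ih => rw [Nat.succ_add, stps_succ, stps_succ, ih]

theorem stps_succ' (C : Cols) (n : ℕ) (S : Sim) : stps C (n + 1) S = stp C (stps C n S) :=
  (stps_add C n 1 S).symm

/-- What the simulation knows about lane `i` after `n` steps. -/
def Sim.After (i : ℕ) (T : Tab) (n : ℕ) (S : Sim) : Prop :=
  ((∀ m < n, T.h (T.conf m).key = false) ∧ S.At i (T.conf n) ∧ S.Count i (T.conf n).o) ∨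
  (S.act.testBit i = false ∧ ∃ m < n, T.HaltsAt m ∧
    S.Count i ((T.conf m).o + (T.w (T.conf m).key).toInt - (T.conf m).s.toInt))

theorem Sim.After.succ {i n : ℕ} {C : Cols} {S : Sim} (h : S.After i (lane C i) n) :
    (stp C S).After i (lane C i) (n + 1) := by
  rcases h with ⟨h1, h2, h3⟩ | ⟨h1, m, hm, h2, h3⟩
  · cases hh : (lane C i).h ((lane C i).conf n).key with
    | false =>
      refine Or.inl ⟨fun m hm => ?_, ?_, ?_⟩
      · rcases Nat.lt_succ_iff_lt_or_eq.1 hm with hm | rfl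
        · exact h1 m hm
        · exact hh
      · rw [Tab.conf_succ]; exact h2.step hh
      · rw [Tab.conf_succ, Tab.next_o]; exact h3.step h2 C
    | true =>
      exact Or.inr ⟨by rw [h2.stp_act, hh]; rfl, n, by omega, ⟨hh, h1⟩, h3.step h2 C⟩
  · exact Or.inr ⟨stp_act_of_not h1 C, m, by omega, h2, h3.stp_of_not h1 C⟩

theorem after_stps {i F : ℕ} (hF : F.testBit i = true) (C : Cols) (u : List ℕ) (n : ℕ) :
    (stps C n (sim0 F u)).After i (lane C i) n := by
  induction n with
  | zero =>
    refine Or.inl ⟨fun m hm => by omega, ⟨hF, ?_, ?_, ?_, ?_⟩, fun _ => ?_⟩ <;>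
      simp [stps, sim0, Tab.conf, Conf.start]
  | succ n ih => rw [stps_succ']; exact ih.succ

/-- The trackers represent proved loops. -/
def Trk.Sound (i : ℕ) (T : Tab) (c : Conf) (n : ℕ) (K : Trk) : Prop :=
  (∃ e a, (∀ k, bit i K.el k = decide (k < e)) ∧ (∀ k, bit i K.al k = decide (k < a)) ∧
    T.Loop c n e a) ∧
  ∃ e a, (∀ k, bit i K.er k = decide (k < e)) ∧ (∀ k, bit i K.ar k = decide (k < a)) ∧
    T.flip.Loop c.flip n e a

theorem Trk.Sound.step {i n F d : ℕ} {T : Tab} {c : Conf} {K : Trk} (h : K.Sound i T c n)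
    (hF : F.testBit i = true) (hd : d.testBit i = T.d (T.next^[n] c).key)
    (hh : T.h (T.next^[n] c).key = false) : (trk F d K).Sound i T c (n + 1) := by
  have hp : ∀ a k, push true (fun k => decide (k < a)) k = decide (k < a + 1) := by
    intro a k; cases k <;> simp
  obtain ⟨⟨e, a, h1, h2, h3⟩, e', a', h1', h2', h3'⟩ := h
  have h1 := funext h1
  have h2 := funext h2
  have h1' := funext h1'
  have h2' := funext h2'
  have hk : T.flip.d (T.flip.next^[n] c.flip).key = !T.d (T.next^[n] c).key := by
    rw [Tab.flip_iterate]; rfl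
  constructor
  · cases hd' : T.d (T.next^[n] c).key with
    | true =>
      refine ⟨e, a + 1, fun k => ?_, fun k => ?_, h3.step hh (by simp [hd'])⟩
      · simp [trk, hd, hd', h1]
      · simp only [trk, bit_mux, bit_cons, hd, hd', h2, hF, cond_true, hp]
    | false =>
      by_cases ha : a = 0
      · refine ⟨e + 1, 0, fun k => ?_, fun k => ?_, h3.step hh (by simp [hd', ha])⟩
        · simp only [trk, bit_mux, testBit_lor, testBit_hd, hd, hd', h2, ha, bit_cons, h1, hF, hp,
            lt_irrefl, decide_false, Bool.or_self, cond_false]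
        · simp [trk, hd, hd', h2, ha]
      · refine ⟨e, a - 1, fun k => ?_, fun k => ?_, h3.step hh (by simp [hd', ha])⟩
        · simp [trk, hd, hd', h2, h1, Nat.pos_of_ne_zero ha]
        · simp only [trk, bit_mux, bit_tl, hd, hd', h2, cond_false]
          exact decide_eq_decide.2 (by omega)
  · have hh' : T.flip.h (T.flip.next^[n] c.flip).key = false := by
      rw [Tab.flip_iterate]; exact hh
    cases hd' : T.d (T.next^[n] c).key with
    | false =>
      refine ⟨e', a' + 1, fun k => ?_, fun k => ?_, h3'.step hh' (by simp [hk, hd'])⟩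
      · simp [trk, hd, hd', h1']
      · simp only [trk, bit_mux, bit_cons, hd, hd', h2', hF, cond_false, hp]
    | true =>
      by_cases ha : a' = 0
      · refine ⟨e' + 1, 0, fun k => ?_, fun k => ?_, h3'.step hh' (by simp [hk, hd', ha])⟩
        · simp only [trk, bit_mux, testBit_andNot, testBit_hd, hd, hd', h2', ha, bit_cons, h1', hF,
            hp, lt_irrefl, decide_false, Bool.not_false, Bool.and_self, cond_true]
        · simp [trk, hd, hd', h2', ha]
      · refine ⟨e', a' - 1, fun k => ?_, fun k => ?_, h3'.step hh' (by simp [hk, hd', ha])⟩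
        · simp [trk, hd, hd', h2', h1', Nat.pos_of_ne_zero ha]
        · simp only [trk, bit_mux, bit_tl, hd, hd', h2', cond_true]
          exact decide_eq_decide.2 (by omega)

theorem looping_sound {i n : ℕ} {T : Tab} {c : Conf} {S S' : Sim} {K : Trk} (hn : 0 < n)
    (hS : S.At i c) (hS' : S'.At i (T.next^[n] c)) (hK : K.Sound i T c n)
    (h : (looping S S' K).testBit i = true) (m : ℕ) : T.h (T.next^[m] c).key = false := by
  simp only [looping, testBit_andNot, testBit_lor, testBit_land, testBit_lxor, Bool.and_eq_true,
    Bool.not_eq_true', Bool.or_eq_false_iff, Bool.and_eq_false_iff, bne_eq_false_iff_eq] at h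
  obtain ⟨-, ⟨ha, hb⟩, hs, h⟩ := h
  have hq : (T.next^[n] c).q = c.q := by rw [hS.q, hS'.q, ha, hb]
  have hs : (T.next^[n] c).s = c.s := by rw [hS.s, hS'.s, hs]
  have hle : ∀ e a : ℕ, (∀ k < e, k < a) → e ≤ a := fun e a h => by
    by_contra hc
    have := h a (by omega)
    omega
  rcases h with ⟨hr, hl⟩ | ⟨hl, hr⟩
  · obtain ⟨⟨e, a, h1, h2, h3⟩, -⟩ := hK
    have h4 : ∀ k < e, k < a ∧ c.l k = (T.next^[n] c).l k := fun k hk => by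
      have := bit_of_neqIn hl k (by rw [h1]; simpa using hk)
      rw [h2, hS.l, hS'.l] at this
      simpa using this
    refine h3.never hn (hle _ _ fun k hk => (h4 k hk).1)
      ⟨hq, hs, funext fun k => ?_, fun k hk => (h4 k hk).2.symm⟩ m
    rw [← hS.r, ← hS'.r, bit_eq_of_neq hr]
  · obtain ⟨-, e, a, h1, h2, h3⟩ := hK
    have h4 : ∀ k < e, k < a ∧ c.r k = (T.next^[n] c).r k := fun k hk => by
      have := bit_of_neqIn hr k (by rw [h1]; simpa using hk)
      rw [h2, hS.r, hS'.r] at this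
      simpa using this
    have := h3.never hn (hle _ _ fun k hk => (h4 k hk).1) (by
      rw [Tab.flip_iterate]
      refine ⟨hq, hs, funext fun k => ?_, fun k hk => (h4 k hk).2.symm⟩
      exact (hS'.l k).symm.trans ((bit_eq_of_neq hl k).symm.trans (hS.l k))) m
    rw [Tab.flip_iterate] at this
    exact this

theorem loops_sound {i F : ℕ} (hF : F.testBit i = true) {C : Cols} {c : Conf} {S : Sim}
    (hS : S.At i c) (n m : ℕ) (S' : Sim) (K : Trk)
    (h' : S'.act.testBit i = true → S'.At i ((lane C i).next^[m] c) ∧ K.Sound i (lane C i) c m)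
    (h : (loops C F S n S' K).testBit i = true) (j : ℕ) :
    (lane C i).h ((lane C i).next^[j] c).key = false := by
  induction n generalizing m S' K with
  | zero => simp [loops] at h
  | succ n ih =>
    have e : loops C F S (n + 1) S' K = Nat.lor (looping S (stp C S') (trk F (dirOf C S') K))
      (loops C F S n (stp C S') (trk F (dirOf C S') K)) := rfl
    rw [e, testBit_lor, Bool.or_eq_true] at h
    have key : (stp C S').act.testBit i = true →
        (stp C S').At i ((lane C i).next^[m + 1] c) ∧
          (trk F (dirOf C S') K).Sound i (lane C i) c (m + 1) := by
      intro ha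
      cases ha' : S'.act.testBit i with
      | false =>
        rw [stp_act_of_not ha'] at ha
        exact absurd ha Bool.false_ne_true
      | true =>
        obtain ⟨h1, h2⟩ := h' ha'
        have hh : (lane C i).h ((lane C i).next^[m] c).key = false := by
          rw [h1.stp_act] at ha
          simpa using ha
        rw [Function.iterate_succ_apply']
        exact ⟨h1.step hh, h2.step hF (h1.dot _) hh⟩
    rcases h with h | h
    · have ha : (stp C S').act.testBit i = true := by
        rw [looping, testBit_andNot, Bool.and_eq_true] at h
        exact h.1
      exact looping_sound (Nat.succ_pos m) hS (key ha).1 (key ha).2 h j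
    · exact ih (m + 1) _ _ key h

theorem never_of_loops {i F : ℕ} (hF : F.testBit i = true) {C : Cols} {u : List ℕ} {n k : ℕ}
    (ha : (stps C n (sim0 F u)).act.testBit i = true)
    (h : (loops C F (stps C n (sim0 F u)) k (stps C n (sim0 F u)) ⟨[], [], [], []⟩).testBit i =
      true) : (lane C i).Never := by
  rcases after_stps hF C u n with ⟨h1, h2, -⟩ | ⟨h1, -⟩
  · refine Tab.never_of_iterate h1 (loops_sound hF h2 k 0 _ _ (fun _ => ⟨h2, ?_, ?_⟩) h)
    · exact ⟨0, 0, by simp, by simp, Tab.Loop.refl _ _⟩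
    · exact ⟨0, 0, by simp, by simp, Tab.Loop.refl _ _⟩
  · exact absurd (h1.symm.trans ha) Bool.false_ne_true

theorem loops_act {i F : ℕ} {C : Cols} {S S' : Sim} {n : ℕ} {K : Trk}
    (h : (loops C F S n S' K).testBit i = true) : S'.act.testBit i = true := by
  induction n generalizing S' K with
  | zero => simp [loops] at h
  | succ n ih =>
    have e : loops C F S (n + 1) S' K = Nat.lor (looping S (stp C S') (trk F (dirOf C S') K))
      (loops C F S n (stp C S') (trk F (dirOf C S') K)) := rfl
    rw [e, testBit_lor, Bool.or_eq_true] at h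
    by_contra hc
    have := stp_act_of_not (by simpa using hc) C
    rcases h with h | h
    · rw [looping, testBit_andNot, this] at h
      simp at h
    · rw [ih h] at this
      simp at this

theorem good_of_unsettled {i F : ℕ} (hF : F.testBit i = true) {C : Cols} {u : List ℕ} {n k m : ℕ}
    (hu : 12 < u.length) (hn : n + k + m ≤ 107)
    (h : (unsettled C F u n k m).testBit i = false) : (lane C i).Good := by
  simp only [unsettled, testBit_andNot, testBit_lor, Bool.and_eq_false_iff, Bool.not_eq_false',
    Bool.or_eq_false_iff, stps_add] at h
  rcases h with ⟨h1, h2, h3⟩ | h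
  · have hl : ∀ (j : ℕ) (S : Sim), (stps C j S).u.length = S.u.length := by
      intro j
      induction j with
      | zero => intro S; rfl
      | succ j ih => intro S; rw [stps_succ, ih]; exact length_thermo _ _ _ _
    rcases after_stps hF C u (n + k + m) with h4 | ⟨-, j, hj, h4, h5⟩
    · exact absurd (h1.symm.trans h4.2.1.act) Bool.false_ne_true
    · intro j' hj'
      obtain rfl := h4.unique hj'
      have := (h5 h2).2 12 (by rw [hl]; exact hu) h3
      refine ⟨by omega, ?_⟩
      have hb : 0 ≤ ((lane C i).w ((lane C i).conf j).key).toInt := by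
        cases (lane C i).w ((lane C i).conf j).key <;> simp
      push_cast at this
      omega
  · exact (never_of_loops hF (loops_act h) h).good


/-! ### Correctness of the closure decider -/

/-- Bit `i` of a matrix entry. -/
def mbit (i : ℕ) (A : List (List ℕ)) (a b : ℕ) : Bool := bit i (A.getD a []) b

@[simp] theorem mbit_nil (i a b : ℕ) : mbit i [] a b = false := by simp [mbit]

@[simp] theorem mbit_cons_zero (i : ℕ) (x : List ℕ) (A : List (List ℕ)) (b : ℕ) :
    mbit i (x :: A) 0 b = bit i x b := rfl

@[simp] theorem mbit_cons_succ (i : ℕ) (x : List ℕ) (A : List (List ℕ)) (a b : ℕ) :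
    mbit i (x :: A) (a + 1) b = mbit i A a b := rfl

@[simp] theorem mbit_madd (i : ℕ) (A B : List (List ℕ)) (a b : ℕ) :
    mbit i (madd A B) a b = (mbit i A a b || mbit i B a b) := by
  induction A generalizing B a with
  | nil => simp [madd]
  | cons x A ih =>
    cases B with
    | nil =>
      have h : madd (x :: A) [] = x :: A := rfl
      simp [h]
    | cons y B =>
      have h : madd (x :: A) (y :: B) = radd x y :: madd A B := rfl
      rw [h]
      cases a with
      | zero => simp
      | succ a => simp [ih]

theorem mbit_mscale {i m : ℕ} (hm : m.testBit i = true) (A : List (List ℕ)) (a b : ℕ) :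
    mbit i (mscale m A) a b = mbit i A a b := by
  induction A generalizing a with
  | nil => rfl
  | cons x A ih =>
    have h : mscale m (x :: A) = rscale m x :: mscale m A := rfl
    rw [h]
    cases a with
    | zero => simp [hm]
    | succ a => simp [ih]

theorem bit_vm {i : ℕ} {x : List ℕ} {B : List (List ℕ)} {j b : ℕ} (hx : bit i x j = true)
    (hB : mbit i B j b = true) : bit i (vm x B) b = true := by
  induction x generalizing B j with
  | nil => simp at hx
  | cons a x ih =>
    cases B with
    | nil => simp at hB
    | cons r B =>
      have h : vm (a :: x) (r :: B) = cond (Nat.beq a 0) (vm x B)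
          (radd (rscale a r) (vm x B)) := rfl
      rw [h]
      cases ha : Nat.beq a 0 with
      | true =>
        cases j with
        | zero => simp [Nat.eq_of_beq_eq_true ha] at hx
        | succ j => exact ih (by simpa using hx) (by simpa using hB)
      | false =>
        cases j with
        | zero =>
          simp only [bit_cons_zero, mbit_cons_zero] at hx hB
          simp [hx, hB]
        | succ j => simp [ih (j := j) (by simpa using hx) (by simpa using hB)]

theorem mbit_mm {i : ℕ} {A B : List (List ℕ)} {a j b : ℕ} (hA : mbit i A a j = true)
    (hB : mbit i B j b = true) : mbit i (mm A B) a b = true := by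
  induction A generalizing a with
  | nil => simp at hA
  | cons x A ih =>
    have h : mm (x :: A) B = vm x B :: mm A B := rfl
    rw [h]
    cases a with
    | zero => exact bit_vm hA hB
    | succ a => exact ih hA

theorem bit_mdots {i : ℕ} {B : List (List ℕ)} {x : List ℕ} {j b : ℕ} (hx : bit i x j = true)
    (hB : mbit i B b j = true) : bit i (mdots B x) b = true := by
  induction B generalizing b with
  | nil => simp at hB
  | cons y B ih =>
    have h : mdots (y :: B) x = dot x y :: mdots B x := rfl
    rw [h]
    cases b with
    | zero => exact testBit_dot.2 ⟨j, hx, hB⟩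
    | succ b => exact ih hB

theorem mbit_mmt {i : ℕ} {A B : List (List ℕ)} {a j b : ℕ} (hA : mbit i A a j = true)
    (hB : mbit i B b j = true) : mbit i (mmt A B) a b = true := by
  induction A generalizing a with
  | nil => simp at hA
  | cons x A ih =>
    have h : mmt (x :: A) B = mdots B x :: mmt A B := rfl
    rw [h]
    cases a with
    | zero => exact bit_mdots hA hB
    | succ a => exact ih hA

theorem mbit_outer {i : ℕ} {x y : List ℕ} {a b : ℕ} (hx : bit i x a = true)
    (hy : bit i y b = true) : mbit i (outer x y) a b = true := by
  induction x generalizing a with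
  | nil => simp at hx
  | cons z x ih =>
    have h : outer (z :: x) y = cond (Nat.beq z 0) [] (rscale z y) :: outer x y := rfl
    rw [h]
    cases a with
    | zero =>
      cases hz : Nat.beq z 0 with
      | true => simp [Nat.eq_of_beq_eq_true hz] at hx
      | false => simpa [hy] using hx
    | succ a => exact ih hx

theorem mbit_tm {i : ℕ} {A B : List (List ℕ)} {a j b : ℕ} (hA : mbit i A j a = true)
    (hB : mbit i B j b = true) : mbit i (tm A B) a b = true := by
  induction A generalizing B j with
  | nil => simp at hA
  | cons x A ih =>
    cases B with
    | nil => simp at hB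
    | cons r B =>
      have h : tm (x :: A) (r :: B) = madd (outer x r) (tm A B) := rfl
      rw [h, mbit_madd]
      cases j with
      | zero => exact Bool.or_eq_true_iff.2 (Or.inl (mbit_outer hA hB))
      | succ j => simp [ih hA hB]

theorem mbit_rowscale {i : ℕ} {e : List ℕ} {B : List (List ℕ)} {a b : ℕ} (he : bit i e a = true)
    (hB : mbit i B a b = true) : mbit i (rowscale e B) a b = true := by
  induction e generalizing B a with
  | nil => simp at he
  | cons x e ih =>
    cases B with
    | nil => simp at hB
    | cons r B =>
      have h : rowscale (x :: e) (r :: B) = rscale x r :: rowscale e B := rfl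
      rw [h]
      cases a with
      | zero =>
        simp only [bit_cons_zero, mbit_cons_zero] at he hB
        simp [he, hB]
      | succ a => exact ih he hB

theorem bit_rowany {i : ℕ} {A : List (List ℕ)} {a : ℕ} :
    bit i (rowany A) a = true ↔ ∃ b, mbit i A a b = true := by
  induction A generalizing a with
  | nil => simp [rowany]
  | cons x A ih =>
    have h : rowany (x :: A) = rany x :: rowany A := rfl
    rw [h]
    cases a with
    | zero => simp [testBit_rany]
    | succ a => simp [ih]

theorem bit_colany {i : ℕ} {A : List (List ℕ)} {a b : ℕ} (h : mbit i A a b = true) :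
    bit i (colany A) b = true := by
  induction A generalizing a with
  | nil => simp at h
  | cons x A ih =>
    have e : colany (x :: A) = radd x (colany A) := rfl
    rw [e, bit_radd]
    cases a with
    | zero => simp [show bit i x b = true from h]
    | succ a => simp [ih h]

theorem testBit_many {i : ℕ} {A : List (List ℕ)} {a b : ℕ} (h : mbit i A a b = true) :
    (many A).testBit i = true := by
  induction A generalizing a with
  | nil => simp at h
  | cons x A ih =>
    have e : many (x :: A) = Nat.lor (rany x) (many A) := rfl
    rw [e, testBit_lor]
    cases a with
    | zero => exact Bool.or_eq_true_iff.2 (Or.inl (testBit_rany.2 ⟨b, h⟩))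
    | succ a => simp [ih h]

theorem mbit_le_of_mdiff {i : ℕ} {A B : List (List ℕ)} (h : (mdiff A B).testBit i = false)
    {a b : ℕ} (hA : mbit i A a b = true) : mbit i B a b = true := by
  induction A generalizing B a with
  | nil => simp at hA
  | cons x A ih =>
    cases B with
    | nil =>
      have e : mdiff (x :: A) [] = Nat.lor (rany x) (mdiff A []) := rfl
      rw [e, testBit_lor, Bool.or_eq_false_iff] at h
      cases a with
      | zero => exact absurd (h.1.symm.trans (testBit_rany.2 ⟨b, hA⟩)) Bool.false_ne_true
      | succ a => simpa using ih h.2 hA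
    | cons y B =>
      have e : mdiff (x :: A) (y :: B) = Nat.lor (rdiff x y) (mdiff A B) := rfl
      rw [e, testBit_lor, Bool.or_eq_false_iff] at h
      cases a with
      | zero => exact bit_le_of_rdiff h.1 b hA
      | succ a => exact ih h.2 hA

theorem mbit_le_of_cdiff {i : ℕ} {A B : List (List (List ℕ))} (h : (cdiff A B).testBit i = false)
    {k a b : ℕ} (hA : mbit i (A.getD k []) a b = true) : mbit i (B.getD k []) a b = true := by
  induction A generalizing B k with
  | nil => simp at hA
  | cons x A ih =>
    cases B with
    | nil =>
      have e : cdiff (x :: A) [] = Nat.lor (many x) (cdiff A []) := rfl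
      rw [e, testBit_lor, Bool.or_eq_false_iff] at h
      cases k with
      | zero => exact absurd (h.1.symm.trans (testBit_many hA)) Bool.false_ne_true
      | succ k => simpa using ih h.2 (k := k) hA
    | cons y B =>
      have e : cdiff (x :: A) (y :: B) = Nat.lor (mdiff x y) (cdiff A B) := rfl
      rw [e, testBit_lor, Bool.or_eq_false_iff] at h
      cases k with
      | zero => exact mbit_le_of_mdiff h.1 hA
      | succ k => exact ih h.2 hA

theorem testBit_hits {i : ℕ} {h : List ℕ} {C : List (List (List ℕ))} {k a b : ℕ}
    (hh : bit i h k = true) (hC : mbit i (C.getD k []) a b = true) :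
    (hits h C).testBit i = true := by
  induction h generalizing C k with
  | nil => simp at hh
  | cons x h ih =>
    cases C with
    | nil => simp at hC
    | cons A C =>
      have e : hits (x :: h) (A :: C) = Nat.lor (Nat.land x (many A)) (hits h C) := rfl
      rw [e, testBit_lor, testBit_land]
      cases k with
      | zero => exact Bool.or_eq_true_iff.2 (Or.inl (Bool.and_eq_true_iff.2 ⟨hh, testBit_many hC⟩))
      | succ k => simp [ih hh hC]

theorem mbit_ysum {i : ℕ} {t : List ℕ} {C : List (List (List ℕ))} {k a b : ℕ}
    (ht : bit i t k = true) (hC : mbit i (C.getD k []) a b = true) :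
    mbit i (ysum t C) a b = true := by
  induction t generalizing C k with
  | nil => simp at ht
  | cons x t ih =>
    cases C with
    | nil => simp at hC
    | cons A C =>
      have e : ysum (x :: t) (A :: C) =
        madd (cond (Nat.beq x 0) [] (mscale x A)) (ysum t C) := rfl
      rw [e, mbit_madd]
      cases k with
      | zero =>
        have hx : x.testBit i = true := ht
        cases h0 : Nat.beq x 0 with
        | true => simp [Nat.eq_of_beq_eq_true h0] at hx
        | false =>
          rw [cond_false, mbit_mscale hx]
          simp [show mbit i A a b = true from hC]
      | succ k => simp [ih ht hC]

@[simp] theorem bit_rand (i : ℕ) (x y : List ℕ) (k : ℕ) :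
    bit i (rand x y) k = (bit i x k && bit i y k) := by
  induction x generalizing y k with
  | nil => simp [rand]
  | cons a x ih =>
    have h : rand (a :: x) y = Nat.land a (hd y) :: rand x (tl y) := rfl
    rw [h]
    cases k with
    | zero => simp
    | succ k => simp [ih]

theorem bit_lits {i F : ℕ} (hF : F.testBit i = true) {x : List ℕ} {k : ℕ} (hk : k < x.length) :
    bit i (lits F (bit i x k) x) k = true := by
  have key : ∀ b, bit i x k = b → bit i (lits F b x) k = true := by
    intro b hb
    induction x generalizing k with
    | nil => simp at hk
    | cons a x ih =>
      have h : lits F b (a :: x) = cond b a (andNot F a) :: lits F b x := rfl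
      rw [h]
      cases k with
      | zero =>
        rw [bit_cons_zero] at hb ⊢
        cases b <;> simp [hb, hF]
      | succ k => exact ih (by simpa using hk) hb
  exact key _ rfl

/-- All columns have an entry for every transition. -/
structure Cols.Long (T : Cols) : Prop where
  W : T.W.length = 8
  D : T.D.length = 8
  A : T.A.length = 8
  B : T.B.length = 8
  H : T.H.length = 8

theorem Cols.Long.tmask {T : Cols} (h : T.Long) {i F k : ℕ} (hF : F.testBit i = true) (hk : k < 8)
    (hh : bit i T.H k = false) :
    bit i (tmask F T (bit i T.D k) (bit i T.W k) (bit i T.A k) (bit i T.B k)) k = true := by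
  obtain ⟨h1, h2, h3, h4, h5⟩ := h
  simp only [BB4.tmask, bit_rand, bit_lits hF (h1 ▸ hk), bit_lits hF (h2 ▸ hk),
    bit_lits hF (h3 ▸ hk), bit_lits hF (h4 ▸ hk), Bool.and_true]
  have := bit_lits hF (h5 ▸ hk)
  rwa [hh] at this

/-- Transitions of the left automaton. -/
def Aut.l (G : Aut) (s : Bool) : List (List ℕ) := bif s then G.l1 else G.l0

def Aut.r (G : Aut) (s : Bool) : List (List ℕ) := bif s then G.r1 else G.r0

/-- Edges in use of the left tape. -/
def Clo.l (S : Clo) (s : Bool) : List ℕ := bif s then S.l1 else S.l0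

def Clo.r (S : Clo) (s : Bool) : List ℕ := bif s then S.r1 else S.r0

def Out.l (Y : Out) (w : Bool) : List (List ℕ) := bif w then Y.l1 else Y.l0

def Out.r (Y : Out) (w : Bool) : List (List ℕ) := bif w then Y.r1 else Y.r0

theorem mbit_into_right {i : ℕ} {G : Aut} {el er : List ℕ} {gl gr : List (List ℕ)} {Y : Out}
    {w : Bool} {a a' b b' : ℕ} (hY : mbit i (Y.r w) a b = true)
    (hG : mbit i (G.l w) a a' = true) (he : bit i er b' = true) (hg : mbit i gr b' b = true) :
    mbit i (into G el er gl gr Y) a' b' = true := by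
  have : mbit i (madd (tm G.l0 Y.r0) (tm G.l1 Y.r1)) a' b = true := by
    cases w
    · exact (mbit_madd _ _ _ _ _).trans (Bool.or_eq_true_iff.2 (Or.inl (mbit_tm hG hY)))
    · exact (mbit_madd _ _ _ _ _).trans (Bool.or_eq_true_iff.2 (Or.inr (mbit_tm hG hY)))
  rw [into, mbit_madd, mbit_mmt this (mbit_rowscale he hg), Bool.true_or]

theorem mbit_into_left {i : ℕ} {G : Aut} {el er : List ℕ} {gl gr : List (List ℕ)} {Y : Out}
    {w : Bool} {a a' b b' : ℕ} (hY : mbit i (Y.l w) a b = true)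
    (hG : mbit i (G.r w) b b' = true) (he : bit i el a' = true) (hg : mbit i gl a' a = true) :
    mbit i (into G el er gl gr Y) a' b' = true := by
  have : mbit i (madd (mm Y.l0 G.r0) (mm Y.l1 G.r1)) a b' = true := by
    cases w
    · exact (mbit_madd _ _ _ _ _).trans (Bool.or_eq_true_iff.2 (Or.inl (mbit_mm hY hG)))
    · exact (mbit_madd _ _ _ _ _).trans (Bool.or_eq_true_iff.2 (Or.inr (mbit_mm hY hG)))
  rw [into, mbit_madd, mbit_mm (mbit_rowscale he hg) this, Bool.or_true]

/-- The closure `S` describes the configuration `c` of lane `i`. -/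
def Clo.Covers (i : ℕ) (G : Aut) (S : Clo) (c : Conf) : Prop :=
  ∃ α β : ℕ → ℕ, (∀ k, mbit i (G.l (c.l k)) (α (k + 1)) (α k) = true ∧
      bit i (S.l (c.l k)) (α (k + 1)) = true) ∧
    (∀ k, mbit i (G.r (c.r k)) (β (k + 1)) (β k) = true ∧
      bit i (S.r (c.r k)) (β (k + 1)) = true) ∧
    mbit i (S.C.getD c.key []) (α 0) (β 0) = true

/-- The closure conditions for one lane. -/
structure Clo.Closed (i F : ℕ) (T : Cols) (G : Aut) (S : Clo) : Prop where
  hits : (hits T.H S.C).testBit i = false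
  C : ∀ k a b, mbit i ((rnd F T G S).C.getD k []) a b = true → mbit i (S.C.getD k []) a b = true
  l : ∀ s a, bit i ((rnd F T G S).l s) a = true → bit i (S.l s) a = true
  r : ∀ s a, bit i ((rnd F T G S).r s) a = true → bit i (S.r s) a = true
  tl : ∀ s a, bit i (S.l s) a = true → ∃ a', mbit i (G.l s) a a' = true
  tr : ∀ s a, bit i (S.r s) a = true → ∃ a', mbit i (G.r s) a a' = true
  start : S.Covers i G Conf.start

theorem closed_of_unclosed {i F : ℕ} (hF : F.testBit i = true) {T : Cols} {G : Aut} {S : Clo}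
    (h : (unclosed F T G S).testBit i = false) : S.Closed i F T G := by
  simp only [unclosed, testBit_lor, Bool.or_eq_false_iff] at h
  obtain ⟨⟨h1, h2⟩, ⟨⟨h3, h4⟩, h5, h6⟩, ⟨⟨h7, h8⟩, h9, h10⟩, ⟨h11, h12, h13⟩, h14, h15⟩ := h
  refine ⟨h1, fun _ _ _ => mbit_le_of_cdiff h2, fun s a => ?_, fun s a => ?_, fun s a ha => ?_,
    fun s a ha => ?_, fun _ => 0, fun _ => 0, fun k => ⟨?_, ?_⟩, fun k => ⟨?_, ?_⟩, ?_⟩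
  · cases s
    · exact bit_le_of_rdiff h3 a
    · exact bit_le_of_rdiff h4 a
  · cases s
    · exact bit_le_of_rdiff h5 a
    · exact bit_le_of_rdiff h6 a
  · cases s
    · exact bit_rowany.1 (bit_le_of_rdiff h7 a ha)
    · exact bit_rowany.1 (bit_le_of_rdiff h8 a ha)
  · cases s
    · exact bit_rowany.1 (bit_le_of_rdiff h9 a ha)
    · exact bit_rowany.1 (bit_le_of_rdiff h10 a ha)
  · exact mbit_le_of_mdiff h14 (by simpa using hF)
  · exact bit_le_of_rdiff h12 0 (by simpa using hF)
  · exact mbit_le_of_mdiff h15 (by simpa using hF)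
  · exact bit_le_of_rdiff h13 0 (by simpa using hF)
  · exact mbit_le_of_cdiff h11 (k := 0) (by simpa using hF)

theorem mbit_out_r {i F : ℕ} (hF : F.testBit i = true) {T : Cols} (hT : T.Long)
    {C : List (List (List ℕ))} {k a b : ℕ} (hk : k < 8) (hh : bit i T.H k = false)
    (hd : bit i T.D k = true) (hC : mbit i (C.getD k []) a b = true) :
    mbit i ((out F T C (bit i T.A k) (bit i T.B k)).r (bit i T.W k)) a b = true := by
  have := mbit_ysum (hT.tmask hF hk hh) hC
  rw [hd] at this
  cases hw : bit i T.W k <;> simpa [Out.r, out, hw] using this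

theorem mbit_out_l {i F : ℕ} (hF : F.testBit i = true) {T : Cols} (hT : T.Long)
    {C : List (List (List ℕ))} {k a b : ℕ} (hk : k < 8) (hh : bit i T.H k = false)
    (hd : bit i T.D k = false) (hC : mbit i (C.getD k []) a b = true) :
    mbit i ((out F T C (bit i T.A k) (bit i T.B k)).l (bit i T.W k)) a b = true := by
  have := mbit_ysum (hT.tmask hF hk hh) hC
  rw [hd] at this
  cases hw : bit i T.W k <;> simpa [Out.l, out, hw] using this

theorem bit_rnd_l {i F : ℕ} {T : Cols} {G : Aut} {S : Clo} {x y w : Bool} {a b : ℕ}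
    (h : mbit i ((out F T S.C x y).r w) a b = true) : bit i ((rnd F T G S).l w) a = true := by
  have := bit_rowany.2 ⟨b, h⟩
  cases x <;> cases y <;> cases w <;>
    simp only [Out.r, cond_true, cond_false] at this <;> simp [Clo.l, rnd, this]

theorem bit_rnd_r {i F : ℕ} {T : Cols} {G : Aut} {S : Clo} {x y w : Bool} {a b : ℕ}
    (h : mbit i ((out F T S.C x y).l w) a b = true) : bit i ((rnd F T G S).r w) b = true := by
  have := bit_colany h
  cases x <;> cases y <;> cases w <;>
    simp only [Out.l, cond_true, cond_false] at this <;> simp [Clo.r, rnd, this]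

theorem bit_le_rnd_l {i F : ℕ} {T : Cols} {G : Aut} {S : Clo} {w : Bool} {a : ℕ}
    (h : bit i (S.l w) a = true) : bit i ((rnd F T G S).l w) a = true := by
  cases w <;> simp only [Clo.l, cond_true, cond_false] at h <;> simp [Clo.l, rnd, h]

theorem bit_le_rnd_r {i F : ℕ} {T : Cols} {G : Aut} {S : Clo} {w : Bool} {a : ℕ}
    (h : bit i (S.r w) a = true) : bit i ((rnd F T G S).r w) a = true := by
  cases w <;> simp only [Clo.r, cond_true, cond_false] at h <;> simp [Clo.r, rnd, h]

theorem mbit_rnd {i F : ℕ} {T : Cols} {G : Aut} {S : Clo} {x y s : Bool} {a b : ℕ}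
    (h : mbit i (into G ((rnd F T G S).l s) ((rnd F T G S).r s) (G.l s) (G.r s)
      (out F T S.C x y)) a b = true) :
    mbit i ((rnd F T G S).C.getD (2 * (2 * x.toNat + y.toNat) + s.toNat) []) a b = true := by
  cases x <;> cases y <;> cases s <;>
    exact (mbit_madd _ _ _ _ _).trans ((congrArg (_ || ·) h).trans (Bool.or_true _))

theorem Clo.Closed.covers_next {i F : ℕ} (hF : F.testBit i = true) {T : Cols} (hT : T.Long)
    {G : Aut} {S : Clo} (h : S.Closed i F T G) {c : Conf} (hk : c.key < 8)
    (hc : S.Covers i G c) : (lane T i).h c.key = false ∧ S.Covers i G ((lane T i).next c) := by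
  obtain ⟨α, β, hα, hβ, hC⟩ := hc
  have hh : bit i T.H c.key = false := by
    by_contra hh
    exact Bool.false_ne_true (h.hits.symm.trans (testBit_hits (by simpa using hh) hC))
  refine ⟨hh, ?_⟩
  by_cases hd : bit i T.D c.key = true
  · have h1 := mbit_out_r hF hT hk hh hd hC
    have h2 := h.l _ _ (bit_rnd_l h1)
    obtain ⟨a, ha⟩ := h.tl _ _ h2
    have h3 : (lane T i).next c = ⟨2 * (bit i T.A c.key).toNat + (bit i T.B c.key).toNat, c.r 0,
        push (bit i T.W c.key) c.l, pull c.r,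
        c.o + (bit i T.W c.key).toInt - c.s.toInt⟩ := if_pos hd
    rw [h3]
    refine ⟨fun k => Nat.casesOn k a α, fun k => β (k + 1), fun k => ?_,
      fun k => hβ (k + 1), h.C _ _ _ (mbit_rnd ?_)⟩
    · cases k with
      | zero => exact ⟨ha, h2⟩
      | succ k => exact hα k
    · exact mbit_into_right h1 ha (bit_le_rnd_r (hβ 0).2) (hβ 0).1
  · have h1 := mbit_out_l hF hT hk hh (by simpa using hd) hC
    have h2 := h.r _ _ (bit_rnd_r h1)
    obtain ⟨b, hb⟩ := h.tr _ _ h2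
    have h3 : (lane T i).next c = ⟨2 * (bit i T.A c.key).toNat + (bit i T.B c.key).toNat, c.l 0,
        pull c.l, push (bit i T.W c.key) c.r,
        c.o + (bit i T.W c.key).toInt - c.s.toInt⟩ := if_neg hd
    rw [h3]
    refine ⟨fun k => α (k + 1), fun k => Nat.casesOn k b β, fun k => hα (k + 1), fun k => ?_,
      h.C _ _ _ (mbit_rnd ?_)⟩
    · cases k with
      | zero => exact ⟨hb, h2⟩
      | succ k => exact hβ k
    · exact mbit_into_left h1 hb (bit_le_rnd_l (hα 0).2) (hα 0).1

theorem never_of_unclosed {i F : ℕ} (hF : F.testBit i = true) {T : Cols} (hT : T.Long) {G : Aut}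
    {S : Clo} (h : (unclosed F T G S).testBit i = false) : (lane T i).Never := by
  have h := closed_of_unclosed hF h
  have key : ∀ n, S.Covers i G ((lane T i).conf n) := by
    intro n
    induction n with
    | zero => exact h.start
    | succ n ih =>
      rw [Tab.conf_succ]
      exact (h.covers_next hF hT (Tab.key_lt (lane_small T i) n) ih).2
  exact fun n => (h.covers_next hF hT (Tab.key_lt (lane_small T i) n) (key n)).1


/-! ### Columns -/

theorem beq_eq (m n : ℕ) : Nat.beq m n = decide (m = n) := by
  rw [Bool.eq_iff_iff, Nat.beq_eq, decide_eq_true_eq]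

theorem ble_eq (m n : ℕ) : Nat.ble m n = decide (m ≤ n) := by
  rw [Bool.eq_iff_iff, Nat.ble_eq, decide_eq_true_eq]

@[simp] theorem testBit_shl (x n i : ℕ) :
    (Nat.shiftLeft x n).testBit i = (decide (n ≤ i) && x.testBit (i - n)) :=
  Nat.testBit_shiftLeft x

@[simp] theorem testBit_shr (x n i : ℕ) : (Nat.shiftRight x n).testBit i = x.testBit (n + i) :=
  Nat.testBit_shiftRight x

theorem full_eq (n : ℕ) : full n = 2 ^ n - 1 := by
  have : Nat.shiftLeft 1 n = 2 ^ n := Nat.one_shiftLeft n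
  exact congrArg (· - 1) this

@[simp] theorem testBit_full (n i : ℕ) : (full n).testBit i = decide (i < n) := by
  rw [full_eq, Nat.testBit_two_pow_sub_one]

theorem full_lt (n : ℕ) : full n < 2 ^ n := by
  rw [full_eq]; exact Nat.sub_lt (Nat.two_pow_pos n) Nat.one_pos

theorem lmap_eq (f : ℕ → ℕ) (l : List ℕ) : lmap f l = l.map f := by
  induction l with
  | nil => rfl
  | cons x l ih => exact congrArg (f x :: ·) ih

theorem len_eq (l : List ℕ) : len l = l.length := by
  induction l with
  | nil => rfl
  | cons x l ih => exact congrArg (· + 1) ih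

theorem take_eq {α : Type} (l : List α) (n : ℕ) : take l n = l.take n := by
  induction l generalizing n with
  | nil => cases n <;> rfl
  | cons x l ih =>
    cases n with
    | zero => rfl
    | succ n => exact congrArg (x :: ·) (ih n)

theorem drop_eq {α : Type} (l : List α) (n : ℕ) : drop l n = l.drop n := by
  induction n generalizing l with
  | zero => rfl
  | succ n ih =>
    cases l with
    | nil => exact (ih []).trans (by simp)
    | cons x l => exact ih l

theorem nth_lmap {f : ℕ → ℕ} (hf : f 0 = 0) (l : List ℕ) (k : ℕ) :
    nth (lmap f l) k = f (nth l k) := by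
  induction l generalizing k with
  | nil => exact hf.symm
  | cons x l ih =>
    cases k with
    | zero => rfl
    | succ k => exact ih k

theorem testBit_cat_cons {w x : ℕ} (hx : x < 2 ^ w) (l : List ℕ) (i : ℕ) :
    (cat w (x :: l)).testBit i = if i < w then x.testBit i else (cat w l).testBit (i - w) := by
  have h : cat w (x :: l) = 2 ^ w * cat w l + x := by
    have : cat w (x :: l) = x + cat w l <<< w := rfl
    rw [this, Nat.shiftLeft_eq, Nat.add_comm, Nat.mul_comm]
  rw [h, Nat.testBit_two_pow_mul_add _ hx]

theorem cat_lt {w : ℕ} {l : List ℕ} (h : ∀ x ∈ l, x < 2 ^ w) {m : ℕ} (hm : l.length ≤ m) :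
    cat w l < 2 ^ (w * m) := by
  induction l generalizing m with
  | nil => exact Nat.two_pow_pos _
  | cons x l ih =>
    obtain ⟨m, rfl⟩ : ∃ m', m = m' + 1 := ⟨m - 1, by simp at hm; omega⟩
    refine Nat.lt_pow_two_of_testBit _ fun i hi => ?_
    have hi' : w * m + w ≤ i := by rw [Nat.mul_succ] at hi; exact hi
    rw [testBit_cat_cons (h x (by simp)), if_neg (by omega)]
    have := ih (fun y hy => h y (by simp [hy])) (m := m) (by simpa using hm)
    exact Nat.testBit_lt_two_pow (this.trans_le (Nat.pow_le_pow_right (by omega) (by omega)))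

/-- Bit `k` of every block. -/
theorem land_shr_cat {l : List ℕ} (h : ∀ x ∈ l, x < 2 ^ 128) {k : ℕ} (hk : k < 128) {m : ℕ}
    (hm : l.length ≤ m) :
    Nat.land (Nat.shiftRight (cat 128 l) k) (cat 128 (List.replicate m 1)) =
      cat 128 (l.map fun x => (x.testBit k).toNat) := by
  have hb : ∀ b : Bool, b.toNat < 2 ^ 128 := fun b => by cases b <;> norm_num
  refine Nat.eq_of_testBit_eq fun i => ?_
  rw [testBit_land, testBit_shr]
  induction l generalizing m i with
  | nil => simp [cat]
  | cons x l ih =>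
    obtain ⟨m, rfl⟩ : ∃ m', m = m' + 1 := ⟨m - 1, by simp at hm; omega⟩
    rw [List.replicate_succ, List.map_cons, testBit_cat_cons (h x (by simp)),
      testBit_cat_cons (by norm_num), testBit_cat_cons (hb _)]
    by_cases hi : i < 128
    · simp only [hi, if_true]
      rcases Nat.eq_zero_or_pos i with rfl | hi0
      · simp only [Nat.add_zero, hk, if_true]
        cases x.testBit k <;> rfl
      · have h1 : Nat.testBit 1 i = false := Nat.testBit_lt_two_pow (Nat.one_lt_two_pow (by omega))
        have h2 : ∀ b : Bool, b.toNat.testBit i = false := fun b => by cases b <;> simp [h1]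
        rw [h1, h2, Bool.and_false]
    · have := ih (fun y hy => h y (by simp [hy])) (m := m) (by simpa using hm) (i - 128)
      rw [if_neg (by omega), if_neg hi, if_neg hi, ← this, show k + i - 128 = k + (i - 128)
        by omega]

theorem cat_mod {l : List ℕ} (h : ∀ x ∈ l, x < 2) (hl : l.length ≤ 64) :
    Nat.mod (cat 128 l) 0xfffffffffffffffffffffffffffffffe = cat 1 l := by
  have key : cat 128 l ≡ cat 1 l [MOD 0xfffffffffffffffffffffffffffffffe] := by
    clear hl h
    induction l with
    | nil => rfl
    | cons x l ih =>
      have e : ∀ w, cat w (x :: l) = x + cat w l * 2 ^ w := fun w =>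
        congrArg (x + ·) (Nat.shiftLeft_eq _ _)
      rw [e, e]
      exact (Nat.ModEq.refl x).add (ih.mul (by decide))
  have hlt := cat_lt (w := 1) (by simpa using h) hl
  unfold Nat.ModEq at key
  rw [Nat.mod_eq_of_lt (a := cat 1 l) (by omega)] at key
  exact key

theorem testBit_cat_one {l : List Bool} (i : ℕ) :
    (cat 1 (l.map Bool.toNat)).testBit i = l.getD i false := by
  induction l generalizing i with
  | nil => simp [cat]
  | cons b l ih =>
    rw [List.map_cons, testBit_cat_cons (by cases b <;> simp)]
    cases i with
    | zero => cases b <;> rfl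
    | succ i => simpa using ih i

theorem combMask_eq : combMask = cat 128 (List.replicate 64 1) := rfl

theorem testBit_comb_chops {k : ℕ} (hk : k < 128) (n : ℕ) (l : List ℕ) (hn : l.length ≤ n) (p : ℕ) :
    (comb (chops n l) k).testBit p = bit k l p := by
  induction n generalizing l p with
  | zero =>
    have : l = [] := by simpa using hn
    rw [this]
    simp [chops, comb, cat, lmap]
  | succ n ih =>
    cases l with
    | nil => simp [chops, comb, cat, lmap]
    | cons x l =>
      have e : comb (chops (n + 1) (x :: l)) k = cat 64 (Nat.mod (Nat.land (Nat.shiftRight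
          (cat 128 (lmap (Nat.land (full 128)) (take (x :: l) 64))) k) combMask)
          0xfffffffffffffffffffffffffffffffe ::
        lmap (fun x => Nat.mod (Nat.land (Nat.shiftRight x k) combMask)
          0xfffffffffffffffffffffffffffffffe) (chops n (drop (x :: l) 64))) := rfl
      have h1 : ∀ y ∈ ((x :: l).take 64).map (Nat.land (full 128)), y < 2 ^ 128 := by
        intro y hy
        obtain ⟨z, -, rfl⟩ := List.mem_map.1 hy
        exact (Nat.and_le_left (n := full 128) (m := z)).trans_lt (full_lt _)
      have h2 : (((x :: l).take 64).map (Nat.land (full 128))).length ≤ 64 := by simp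
      rw [lmap_eq, take_eq, combMask_eq, land_shr_cat h1 hk h2, cat_mod _ (by simp)] at e
      · rw [e, testBit_cat_cons]
        · split
          next hp =>
            have : (fun x : ℕ => (x.testBit k).toNat) = Bool.toNat ∘ fun x => x.testBit k := rfl
            rw [this, ← List.map_map, testBit_cat_one]
            simp only [bit, nth_eq, List.getD_eq_getElem?_getD, List.getElem?_map,
              List.getElem?_take, hp, if_true]
            cases hx : (x :: l)[p]? with
            | none => simp
            | some y => simp [hk]
          next hp =>
            have := ih ((x :: l).drop 64) (by simp at hn ⊢; omega) (p - 64)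
            rw [drop_eq]
            refine this.trans ?_
            simp only [bit, nth_eq, List.getD_eq_getElem?_getD, List.getElem?_drop]
            rw [show 64 + (p - 64) = p by omega]
        · have := cat_lt (w := 1) (l := (((x :: l).take 64).map (Nat.land (full 128))).map
            fun x => (x.testBit k).toNat) (m := 64) (fun y hy => by
              obtain ⟨z, -, rfl⟩ := List.mem_map.1 hy
              exact Bool.toNat_lt _) (by simp)
          rwa [Nat.one_mul] at this
      · intro y hy
        obtain ⟨z, -, rfl⟩ := List.mem_map.1 hy
        exact Bool.toNat_lt _

theorem testBit_comb {k : ℕ} (hk : k < 128) (l : List ℕ) (p : ℕ) :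
    (comb (chop l) k).testBit p = bit k l p :=
  testBit_comb_chops hk _ l (len_eq l).ge p

theorem comb_lt {k : ℕ} (hk : k < 128) (l : List ℕ) : comb (chop l) k < 2 ^ l.length :=
  Nat.lt_pow_two_of_testBit _ fun i hi => by simp [testBit_comb hk, bit, nth_eq, hi]

/-- The machine encoded by `c`. -/
def dec (c : ℕ) : Tab where
  w k := c.testBit (5 * k)
  d k := c.testBit (5 * k + 1)
  h k := c.testBit (5 * k + 4)
  q k := 2 * (c.testBit (5 * k + 3)).toNat + (c.testBit (5 * k + 2)).toNat

theorem dec_small (c : ℕ) : (dec c).Small := fun k => by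
  simp only [dec]
  cases c.testBit (5 * k + 3) <;> cases c.testBit (5 * k + 2) <;> simp

theorem tab_long (f : ℕ → ℕ → ℕ) : (tab f).Long := ⟨rfl, rfl, rfl, rfl, rfl⟩

theorem nth_tab (f : ℕ → ℕ → ℕ) {k : ℕ} (hk : k < 8) :
    nth (tab f).W k = f (5 * k) 0 ∧ nth (tab f).D k = f (5 * k) 1 ∧ nth (tab f).A k = f (5 * k) 3 ∧
      nth (tab f).B k = f (5 * k) 2 ∧ nth (tab f).H k = f (5 * k) 4 := by
  interval_cases k <;> exact ⟨rfl, rfl, rfl, rfl, rfl⟩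

/-- The tables agree except where both halt. -/
def Tab.Same (T T' : Tab) : Prop :=
  ∀ k < 8, T.h k = T'.h k ∧ (T.h k = false → T'.w k = T.w k ∧ T'.d k = T.d k ∧ T'.q k = T.q k)

theorem Tab.Same.sub {T T' : Tab} (h : T.Same T') : T.Sub T' := fun k hk hh =>
  ⟨(h k hk).1.symm.trans hh, (h k hk).2 hh⟩

theorem Tab.Same.never {T T' : Tab} (h : T.Same T') (hT : T.Small) (hn : T.Never) : T'.Never :=
  h.sub.never hT hn

theorem Tab.Same.symm {T T' : Tab} (h : T.Same T') : T'.Same T := fun k hk =>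
  ⟨(h k hk).1.symm, fun hh => by
    obtain ⟨h1, h2, h3⟩ := (h k hk).2 ((h k hk).1.trans hh)
    exact ⟨h1.symm, h2.symm, h3.symm⟩⟩

theorem lane_codeTab (l : List ℕ) (i : ℕ) : (lane (codeTab l) i).Same (dec (nth l i)) := by
  intro k hk
  have h : ∀ e < 5, (comb (chop l) (Nat.add (5 * k) e)).testBit i = (nth l i).testBit (5 * k + e) :=
    fun e he => testBit_comb (show 5 * k + e < 128 by omega) l i
  obtain ⟨h1, h2, h3, h4, h5⟩ := nth_tab (fun j e => comb (chop l) (Nat.add j e)) hk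
  have g : codeTab l = tab (fun j e => comb (chop l) (Nat.add j e)) := rfl
  simp only [lane, dec, g, bit, h1, h2, h3, h4, h5, h 0 (by omega), h 1 (by omega),
    h 2 (by omega), h 3 (by omega), h 4 (by omega)]
  simp

/-! ### Stacked lanes -/

theorem stack_lt {n x : ℕ} (hx : x < 2 ^ n) (k : ℕ) : stack n k x < 2 ^ (n * 2 ^ k) := by
  induction k with
  | zero => simpa [stack] using hx
  | succ k ih =>
    refine Nat.lt_pow_two_of_testBit _ fun i hi => ?_
    have e : stack n (k + 1) x =
      Nat.lor (stack n k x) (Nat.shiftLeft (stack n k x) (n <<< k)) := rfl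
    have h1 : n * 2 ^ (k + 1) = n * 2 ^ k + n * 2 ^ k := by ring
    rw [e, testBit_lor, testBit_shl, Nat.shiftLeft_eq,
      Nat.testBit_lt_two_pow (ih.trans_le (Nat.pow_le_pow_right (by omega) (by omega))),
      Nat.testBit_lt_two_pow (ih.trans_le (Nat.pow_le_pow_right (by omega) (by omega)))]
    simp

theorem lane_index {n k i r : ℕ} (hi : i < 2 ^ k) (hr : r < n) : i * n + r < n * 2 ^ k := by
  have := Nat.mul_le_mul_right n (Nat.succ_le_of_lt hi)
  rw [Nat.succ_mul] at this
  rw [Nat.mul_comm n]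
  omega

theorem testBit_stack {n x : ℕ} (hx : x < 2 ^ n) (k : ℕ) {i r : ℕ} (hi : i < 2 ^ k) (hr : r < n) :
    (stack n k x).testBit (i * n + r) = x.testBit r := by
  induction k generalizing i with
  | zero =>
    have : i = 0 := by simpa using hi
    simp [this, stack]
  | succ k ih =>
    have e : stack n (k + 1) x =
      Nat.lor (stack n k x) (Nat.shiftLeft (stack n k x) (n <<< k)) := rfl
    rw [e, testBit_lor, testBit_shl, Nat.shiftLeft_eq]
    rcases Nat.lt_or_ge i (2 ^ k) with h | h
    · have := lane_index h hr
      rw [ih h]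
      simp [show ¬ n * 2 ^ k ≤ i * n + r by omega]
    · obtain ⟨j, rfl⟩ := Nat.exists_eq_add_of_le h
      have h1 : (2 ^ k + j) * n + r = n * 2 ^ k + (j * n + r) := by ring
      rw [h1, Nat.add_sub_cancel_left, ih (by rw [pow_succ] at hi; omega),
        Nat.testBit_lt_two_pow ((stack_lt hx k).trans_le (Nat.pow_le_pow_right (by omega)
          (by omega)))]
      simp

theorem pat_lt (n e k : ℕ) : pat n e k < 2 ^ (n * 2 ^ k) := by
  induction k with
  | zero => simpa [pat] using full_lt n
  | succ k ih =>
    refine Nat.lt_pow_two_of_testBit _ fun i hi => ?_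
    have h : pat n e (k + 1) = cond (Nat.beq k e) (Nat.shiftLeft (pat n e k) (n <<< k))
      (Nat.lor (pat n e k) (Nat.shiftLeft (pat n e k) (n <<< k))) := rfl
    have h1 : n * 2 ^ (k + 1) = n * 2 ^ k + n * 2 ^ k := by ring
    have h2 := Nat.testBit_lt_two_pow (ih.trans_le (Nat.pow_le_pow_right (by omega)
      (show n * 2 ^ k ≤ i by omega)))
    have h3 := Nat.testBit_lt_two_pow (ih.trans_le (Nat.pow_le_pow_right (by omega)
      (show n * 2 ^ k ≤ i - n * 2 ^ k by omega)))
    rw [h]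
    have h4 : (Nat.shiftLeft (pat n e k) (n <<< k)).testBit i = false := by
      rw [testBit_shl, Nat.shiftLeft_eq, h3, Bool.and_false]
    cases Nat.beq k e
    · rw [cond_false, testBit_lor, h2, h4]; rfl
    · exact h4

theorem testBit_pat (n e k : ℕ) {i r : ℕ} (hi : i < 2 ^ k) (hr : r < n) :
    (pat n e k).testBit (i * n + r) = (decide (k ≤ e) || i.testBit e) := by
  induction k generalizing i with
  | zero =>
    have : i = 0 := by simpa using hi
    simp [this, pat, hr]
  | succ k ih =>
    have h : pat n e (k + 1) = cond (Nat.beq k e) (Nat.shiftLeft (pat n e k) (n <<< k))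
      (Nat.lor (pat n e k) (Nat.shiftLeft (pat n e k) (n <<< k))) := rfl
    rw [h]
    clear h
    have h2 := beq_eq k e
    rcases Nat.lt_or_ge i (2 ^ k) with h | h
    · have h1 := lane_index h hr
      by_cases hk : k = e
      · subst hk
        rw [h2, decide_eq_true rfl, cond_true, testBit_shl, Nat.shiftLeft_eq]
        simp [show ¬ n * 2 ^ k ≤ i * n + r by omega, Nat.testBit_lt_two_pow h]
      · rw [h2, decide_eq_false hk, cond_false, testBit_lor, testBit_shl, ih h, Nat.shiftLeft_eq]
        simp [show ¬ n * 2 ^ k ≤ i * n + r by omega, show k ≤ e ↔ k + 1 ≤ e by omega]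
    · obtain ⟨j, rfl⟩ := Nat.exists_eq_add_of_le h
      have h1 : (2 ^ k + j) * n + r = n * 2 ^ k + (j * n + r) := by ring
      have hj : j < 2 ^ k := by rw [pow_succ] at hi; omega
      have h3 := Nat.testBit_lt_two_pow ((pat_lt n e k).trans_le (Nat.pow_le_pow_right (by omega)
          (show n * 2 ^ k ≤ n * 2 ^ k + (j * n + r) by omega)))
      by_cases hk : k = e
      · subst hk
        have : (2 ^ k + j).testBit k = true := by
          rw [Nat.testBit_two_pow_add_eq, Nat.testBit_lt_two_pow hj]; rfl
        rw [h1, this, h2, decide_eq_true rfl, cond_true, testBit_shl, Nat.shiftLeft_eq,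
          Nat.add_sub_cancel_left, ih hj]
        simp
      · rw [h2, decide_eq_false hk, cond_false, h1, testBit_lor, h3, testBit_shl, Nat.shiftLeft_eq,
          Nat.add_sub_cancel_left, ih hj]
        have h4 : (2 ^ k + j).testBit e = (decide (k + 1 ≤ e) && false || j.testBit e) := by
          rcases Nat.lt_or_ge e k with h | h
          · rw [Nat.testBit_two_pow_add_gt h]; simp
          · have h5 : 2 ^ k + j < 2 ^ e := hi.trans_le (Nat.pow_le_pow_right (by omega) (by omega))
            rw [Nat.testBit_lt_two_pow h5, Nat.testBit_lt_two_pow (by omega)]; simp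
        rw [h4]
        simp [show k ≤ e ↔ k + 1 ≤ e by omega]


/-! ### Rows -/

/-- The code of a machine with marks at two transitions. -/
def mark (c x z : ℕ) : ℕ :=
  Nat.lor c (Nat.lor (Nat.shiftLeft 1 (Nat.add 40 x)) (Nat.shiftLeft 1 (Nat.add 80 z)))

theorem testBit_mark (c x z p : ℕ) : (mark c x z).testBit p =
    (c.testBit p || (decide (p = 40 + x) || decide (p = 80 + z))) := by
  have h : ∀ n, (Nat.shiftLeft 1 n).testBit p = decide (p = n) := fun n => by
    have : Nat.shiftLeft 1 n = 2 ^ n := Nat.one_shiftLeft n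
    rw [this, Nat.testBit_two_pow]
    simp [eq_comm]
  rw [mark, testBit_lor, testBit_lor, h, h]
  rfl

theorem mem_rowCodes {l : List Item} {c x z : ℕ} (h : Item.row c x z ∈ l) :
    ∃ r < (rowCodes l).length, nth (rowCodes l) r = mark c x z := by
  have key : mark c x z ∈ rowCodes l := by
    induction l with
    | nil => cases h
    | cons y l ih =>
      rcases List.mem_cons.1 h with rfl | h'
      · exact List.mem_cons_self
      · cases y
        case row => exact List.mem_cons_of_mem _ (ih h')
        all_goals exact ih h'
  obtain ⟨r, hr, h⟩ := List.getElem_of_mem key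
  exact ⟨r, hr, by simp [nth_eq, hr, h]⟩

def rowCol (l : List ℕ) (j e : ℕ) : ℕ :=
  (fun x z => Nat.lor (andNot (stack l.length 8 (comb (chop l) (Nat.add j e))) (Nat.lor x z))
      (cond (Nat.beq e 4) 0 (Nat.lor
        (Nat.land x (nth (lmap (fun e => pat l.length e 8) [0, 1, 2, 3, 4, 5, 6, 7]) (Nat.add 4 e)))
        (Nat.land z (nth (lmap (fun e => pat l.length e 8) [0, 1, 2, 3, 4, 5, 6, 7]) e)))))
    (stack l.length 8 (comb (chop l) (Nat.add 40 j)))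
    (stack l.length 8 (comb (chop l) (Nat.add 80 j)))

theorem rowTab_eq (l : List ℕ) : rowTab l.length l = tab (rowCol l) := rfl

theorem testBit_rowCol {l : List ℕ} {i r k e : ℕ} (hi : i < 256) (hr : r < l.length) (hk : k < 8)
    (he : e < 5) : (rowCol l (5 * k) e).testBit (i * l.length + r) =
      bif (nth l r).testBit (80 + 5 * k) then
        decide (e ≠ 4) && (i.testBit e || ((nth l r).testBit (40 + 5 * k) && i.testBit (4 + e)))
      else bif (nth l r).testBit (40 + 5 * k) then decide (e ≠ 4) && i.testBit (4 + e)
      else (nth l r).testBit (5 * k + e) := by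
  have h : ∀ j < 128, (stack l.length 8 (comb (chop l) j)).testBit (i * l.length + r) =
      (nth l r).testBit j := fun j hj => by
    rw [testBit_stack (comb_lt hj l) 8 hi hr, testBit_comb hj]; rfl
  have h1 := h (Nat.add (5 * k) e) (show 5 * k + e < 128 by omega)
  have h2 := h (Nat.add 40 (5 * k)) (show 40 + 5 * k < 128 by omega)
  have h3 := h (Nat.add 80 (5 * k)) (show 80 + 5 * k < 128 by omega)
  have h0 : ∀ a b : ℕ, Nat.add a b = a + b := fun _ _ => rfl
  simp only [h0] at h1 h2 h3
  simp only [rowCol, h0, testBit_lor, testBit_andNot, h1, h2, h3, beq_eq]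
  by_cases h4 : e = 4
  · subst h4
    cases (nth l r).testBit (80 + 5 * k) <;> cases (nth l r).testBit (40 + 5 * k) <;> simp
  · have hp : ∀ j < 8, (nth (lmap (fun e => pat l.length e 8) [0, 1, 2, 3, 4, 5, 6, 7]) j).testBit
        (i * l.length + r) = i.testBit j := fun j hj => by
      have : nth (lmap (fun e => pat l.length e 8) [0, 1, 2, 3, 4, 5, 6, 7]) j =
        pat l.length j 8 := by interval_cases j <;> rfl
      rw [this, testBit_pat l.length j 8 hi hr]
      simp [hj]
    simp only [h4, decide_false, cond_false, testBit_lor, testBit_land, h2, h3,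
      hp e (by omega), hp (4 + e) (by omega)]
    cases (nth l r).testBit (80 + 5 * k) <;> cases (nth l r).testBit (40 + 5 * k) <;>
      simp [h4, Bool.or_comm]

/-- Every way to fill in the transitions `x` and `z` of `c` is found in some lane. -/
theorem good_of_rowTab {l : List ℕ} {r c x z : ℕ} (hr : r < l.length)
    (hl : nth l r = mark c (5 * x) (5 * z)) (hc : c < 2 ^ 40) (hx : x < 8) (hz : z < 8)
    (hxz : x ≠ z)
    (hg : ∀ i < 256 * l.length, (lane (rowTab l.length l) i).Good) {T : Tab} (hT : T.Small)
    (hs : (dec c).Sub T) (hh : ∀ k < 8, T.h k =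
    ((dec c).h k && !(decide (k = x) || decide (k = z)))) :
    T.Good := by
  let f : Fin 8 → Bool := ![T.w z, T.d z, (T.q z).testBit 0, (T.q z).testBit 1,
    T.w x, T.d x, (T.q x).testBit 0, (T.q x).testBit 1]
  have hi : Nat.ofBits f < 256 := Nat.ofBits_lt_two_pow f
  have hf : ∀ j (hj : j < 8), (Nat.ofBits f).testBit j = f ⟨j, hj⟩ := fun j hj =>
    Nat.testBit_ofBits_lt f j hj
  generalize Nat.ofBits f = i at hi hf
  have hb : ∀ p < 40, (nth l r).testBit p = c.testBit p := fun p hp => by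
    rw [hl, testBit_mark]
    simp [show ¬ p = 40 + 5 * x by omega, show ¬ p = 80 + 5 * z by omega]
  have hc' : ∀ p, 40 ≤ p → c.testBit p = false := fun p hp =>
    Nat.testBit_lt_two_pow (hc.trans_le (Nat.pow_le_pow_right (by omega) hp))
  have hb1 : ∀ k < 8, (nth l r).testBit (40 + 5 * k) = decide (k = x) := fun k hk => by
    rw [hl, testBit_mark, hc' _ (by omega)]
    simp [show ¬ 40 + 5 * k = 80 + 5 * z by omega]
  have hb2 : ∀ k < 8, (nth l r).testBit (80 + 5 * k) = decide (k = z) := fun k hk => by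
    rw [hl, testBit_mark, hc' _ (by omega)]
    simp [show ¬ 80 + 5 * k = 40 + 5 * x by omega]
  have hn : i * l.length + r < 256 * l.length := by
    have := lane_index (k := 8) hi hr
    rwa [Nat.mul_comm l.length] at this
  have hq : ∀ k, 2 * ((T.q k).testBit 1).toNat + ((T.q k).testBit 0).toNat = T.q k := fun k => by
    have := hT k
    interval_cases T.q k <;> rfl
  have hL : ∀ k < 8, (lane (rowTab l.length l) (i * l.length + r)).h k = T.h k ∧
      (T.h k = false → T.w k = (lane (rowTab l.length l) (i * l.length + r)).w k ∧
        T.d k = (lane (rowTab l.length l) (i * l.length + r)).d k ∧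
        T.q k = (lane (rowTab l.length l) (i * l.length + r)).q k) := by
    intro k hk
    obtain ⟨h1, h2, h3, h4, h5⟩ := nth_tab (rowCol l) hk
    have hB : ∀ e < 5, (rowCol l (5 * k) e).testBit (i * l.length + r) = _ := fun e he =>
      testBit_rowCol hi hr hk he
    simp only [hb1 k hk, hb2 k hk] at hB
    simp only [rowTab_eq, lane, bit, h1, h2, h3, h4, h5, hB 0 (by omega), hB 1 (by omega),
      hB 2 (by omega), hB 3 (by omega), hB 4 (by omega)]
    by_cases hkx : k = x
    · subst hkx
      simp [hxz, hh k hk, hf, f, hq, -Nat.testBit_zero]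
    · by_cases hkz : k = z
      · subst hkz
        simp [hkx, hh k hk, hf, f, hq, -Nat.testBit_zero]
      · simp only [hkx, hkz, decide_false, cond_false, hh k hk]
        refine ⟨by simp [hb, dec, show 5 * k + 4 < 40 by omega], fun hk' => ?_⟩
        obtain ⟨-, h6, h7, h8⟩ := hs k hk (by simpa using hk')
        rw [h6, h7, h8]
        simp [hb, dec, show 5 * k + 3 < 40 by omega, show 5 * k + 2 < 40 by omega,
          show 5 * k + 1 < 40 by omega, show 5 * k < 40 by omega]
  exact Tab.Sub.good (fun k hk h => ⟨(hL k hk).1.symm.trans h, (hL k hk).2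
    ((hL k hk).1.symm.trans h)⟩)
    (fun k hk h => (hL k hk).1.symm.trans h) (lane_small _ _) (hg _ hn)


/-! ### Bags -/

def Bag.All (P : Tab → Prop) (b : Bag) : Prop := ∀ i, b.V.testBit i = true → P (lane b.T i)

theorem bit_lmap {f : ℕ → ℕ} {i j : ℕ} (hf : ∀ x, (f x).testBit j = x.testBit i) (l : List ℕ) :
    bit j (lmap f l) = bit i l := by
  funext k
  induction l generalizing k with
  | nil => exact (bit_nil j k).trans (bit_nil i k).symm
  | cons x l ih =>
    cases k with
    | zero => exact hf x
    | succ k => exact ih k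

theorem lane_cmap {f : ℕ → ℕ} {i j : ℕ} (hf : ∀ x, (f x).testBit j = x.testBit i) (T : Cols) :
    lane (cmap f T) j = lane T i := by
  simp only [lane, cmap, bit_lmap hf]

theorem Bag.All.of_slide {P : Tab → Prop} {s : ℕ} {b : Bag} (h : (slide s b).All P) : b.All P := by
  intro i hi
  have hV : ∀ j, (slide s b).V.testBit j = (b.V.testBit j ^^
      ((b.V.testBit (s + j) && !b.V.testBit j) ||
        (decide (s ≤ j) && (b.V.testBit (s + (j - s)) && !b.V.testBit (j - s))))) := fun j => by
    simp only [slide, testBit_lxor, testBit_lor, testBit_shl, testBit_andNot, testBit_shr]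
  have hT : (slide s b).T = cmap (fun x => mux1 (andNot (Nat.shiftRight b.V s) b.V)
    (Nat.shiftRight x s) x) b.T := rfl
  by_cases h1 : s ≤ i ∧ b.V.testBit (i - s) = false
  · have h2 : s + (i - s) = i := by omega
    have h3 := h (i - s) (by rw [hV]; simp [h1.2, h2, hi])
    rwa [hT, lane_cmap (i := i) fun x => by simp [h1.2, h2, hi]] at h3
  · have h3 := h i (by
      rw [hV, hi]
      by_cases hs : s ≤ i
      · simp only [hs, true_and, Bool.not_eq_false] at h1
        simp [h1]
      · simp [hs])
    rwa [hT, lane_cmap (i := i) fun x => by simp [hi]] at h3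

theorem eq_zero_of_shr {V n : ℕ} (h : Nat.beq (Nat.shiftRight V n) 0 = true) {i : ℕ}
    (hi : V.testBit i = true) : i < n := by
  by_contra hn
  have := testBit_shr V n (i - n)
  rw [Nat.eq_of_beq_eq_true h, show n + (i - n) = i by omega, hi, Nat.zero_testBit] at this
  cases this

theorem Bag.All.of_trim {P : Tab → Prop} {n : ℕ} {b : Bag} (h : (trim n b).All P) : b.All P := by
  unfold trim at h
  cases hn : Nat.beq (Nat.shiftRight b.V n) 0 with
  | false => rwa [hn] at h
  | true =>
    rw [hn] at h
    intro i hi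
    have h1 := h i hi
    rwa [cond_true, lane_cmap (i := i) fun x => by simp [eq_zero_of_shr hn hi]] at h1

theorem Bag.All.of_halve {P : Tab → Prop} {n : ℕ} {b : Bag} (h : (halve n b).All P) : b.All P := by
  replace h := Bag.All.of_trim h
  revert h
  generalize 60 = m
  induction m generalizing b with
  | zero => exact id
  | succ m ih =>
    intro h
    change Bag.All P (cond (Nat.beq (Nat.shiftRight b.V n) 0) b _) at h
    cases hn : Nat.beq (Nat.shiftRight b.V n) 0 with
    | true => rwa [hn] at h
    | false =>
      rw [hn] at h
      exact Bag.All.of_slide (Bag.All.of_slide (ih h))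

theorem Bag.All.of_halves {P : Tab → Prop} {n k : ℕ} {b : Bag} (h : (halves n k b).All P) :
    b.All P := by
  induction k generalizing n b with
  | zero => exact h
  | succ k ih => exact Bag.All.of_halve (ih h)

theorem Bag.All.of_settle {N n k m : ℕ} (hn : n + k + m ≤ 107) {b : Bag}
    (h : (settle N n k m b).All Tab.Good) : b.All Tab.Good := by
  intro i hi
  by_cases hu : i < N ∧ (unsettled b.T (full N) ther n k m).testBit i = false
  · exact good_of_unsettled (F := full N) (u := ther) (by simp [hu.1]) (by decide) hn hu.2
  · refine h i ?_
    simp only [settle, testBit_andNot, testBit_full, hi]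
    by_cases hN : i < N
    · simpa [hN] using hu
    · simp [hN]

theorem lane_cpad (T : Cols) (i : ℕ) : (lane (cpad T) i).Same (lane T i) := by
  have hp : ∀ (l : List ℕ), ∀ k < 8, bit i (pad l) k = bit i l k := fun l k hk => by
    interval_cases k <;> rfl
  intro k hk
  simp [lane, cpad, hp _ k hk]

theorem Bag.All.of_sift {N n : ℕ} {d e : List ℕ} {b : Bag}
    (h : (sift N n d e b).All Tab.Never) : b.All Tab.Never := by
  intro i hi
  by_cases hu : i < N ∧ (closure (full N) (cpad b.T)
      ⟨gmat (full N) 4 d, gmat (full N) 4 e, gmat (full N) 4 d, gmat (full N) 4 e⟩ n).testBit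
        i = false
  · exact (lane_cpad b.T i).never (lane_small _ _)
      (never_of_unclosed (F := full N) (by simp [hu.1]) ⟨rfl, rfl, rfl, rfl, rfl⟩ hu.2)
  · refine h i ?_
    simp only [sift, testBit_andNot, testBit_full, hi]
    by_cases hN : i < N
    · simpa [hN] using hu
    · simp [hN]

theorem bit_above {n i : ℕ} (x y : List ℕ) :
    bit i (above n x y) = if i < n then bit i x else bit (i - n) y := by
  funext k
  induction x generalizing y k with
  | nil =>
    have : bit i (above n [] y) k = if i < n then false else bit (i - n) y k := by
      change bit i (lmap (fun b => Nat.shiftLeft b n) y) k = _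
      simp only [bit, nth_lmap (f := fun b => Nat.shiftLeft b n) (Nat.zero_shiftLeft n),
        testBit_shl]
      by_cases h : i < n
      · simp [h]
      · simp [h, Nat.le_of_not_lt h]
    rw [this]
    split <;> simp
  | cons a x ih =>
    cases k with
    | zero =>
      change (Nat.lor (Nat.land (full n) a) (Nat.shiftLeft (hd y) n)).testBit i = _
      rw [testBit_lor, testBit_land, testBit_full, testBit_shl, testBit_hd]
      by_cases h : i < n
      · simp [h]
      · simp [h, Nat.le_of_not_lt h]
    | succ k =>
      refine (ih (tl y) k).trans ?_
      split
      · rfl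
      · rw [bit_tl]

theorem Bag.All.of_add {n : ℕ} {l : List ℕ} {b : Bag} (h : (add n l b).All Tab.Never) :
    b.All Tab.Never ∧ ∀ c ∈ l, (dec c).Never := by
  unfold add at h
  cases hn : Nat.beq (Nat.shiftRight b.V n) 0 with
  | false =>
    rw [hn] at h
    have h0 : (lane ⟨[], [], [], [], [1]⟩ 0).h 0 = true := Nat.testBit_one_zero
    have h1 : (lane ⟨[], [], [], [], [1]⟩ 0).h 0 = false := h 0 Nat.testBit_one_zero 0
    rw [h0] at h1
    cases h1
  | true =>
    rw [hn, cond_true] at h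
    constructor
    · intro i hi
      have h1 := h i (by simp [hi])
      simpa only [lane, bit_above, eq_zero_of_shr hn hi, if_true] using h1
    · intro c hc
      obtain ⟨r, hr, rfl⟩ := List.getElem_of_mem hc
      have h1 := h (n + r) (by simp [len_eq, hr])
      have h2 : (lane (codeTab l) r).Never := by
        simpa only [lane, bit_above, show ¬ n + r < n by omega, if_false,
          Nat.add_sub_cancel_left] using h1
      have h3 := (lane_codeTab l r).never (lane_small _ _) h2
      rwa [nth_eq, List.getD_eq_getElem?_getD, List.getElem?_eq_getElem hr] at h3

theorem Bag.All.mono {P Q : Tab → Prop} (hPQ : ∀ T, P T → Q T) {b : Bag} (h : b.All P) : b.All Q :=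
  fun i hi => hPQ _ (h i hi)

/-! ### Reading off codes -/

theorem mem_bits_of_mem {f : ℕ → ℕ} {d m i x : ℕ} {acc : List ℕ} (hx : x ∈ acc) :
    x ∈ bits f d m i acc := by
  induction d generalizing m i acc with
  | zero =>
    change x ∈ cond (Nat.beq m 0) acc (f i :: acc)
    cases Nat.beq m 0
    · exact List.mem_cons_of_mem _ hx
    · exact hx
  | succ d ih =>
    change x ∈ cond (Nat.beq m 0) acc (bits f d _ _ (bits f d _ _ acc))
    cases Nat.beq m 0
    · exact ih (ih hx)
    · exact hx

theorem mem_bits {f : ℕ → ℕ} {d m i j : ℕ} {acc : List ℕ} (hj : m.testBit j = true)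
    (hd : j < 2 ^ d) :
    f (i + j) ∈ bits f d m i acc := by
  have hm : Nat.beq m 0 = false := by
    rw [beq_eq]
    refine decide_eq_false fun h => ?_
    rw [h, Nat.zero_testBit] at hj
    cases hj
  induction d generalizing m i j acc with
  | zero =>
    obtain rfl : j = 0 := by simpa using hd
    change f (i + 0) ∈ cond (Nat.beq m 0) acc (f i :: acc)
    rw [hm]
    exact List.mem_cons_self
  | succ d ih =>
    have he : Nat.shiftLeft 1 d = 2 ^ d := Nat.one_shiftLeft d
    change f (i + j) ∈ cond (Nat.beq m 0) acc (bits f d (Nat.land m (full (Nat.shiftLeft 1 d))) i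
      (bits f d (Nat.shiftRight m (Nat.shiftLeft 1 d)) (Nat.add i (Nat.shiftLeft 1 d)) acc))
    rw [hm, cond_false, he]
    have hne : ∀ x : ℕ, x.testBit j = true ∨ x.testBit (j - 2 ^ d) =
        true → Nat.beq x 0 = false := by
      intro x hx
      rw [beq_eq]
      refine decide_eq_false fun h => ?_
      simp [h] at hx
    by_cases h : j < 2 ^ d
    · have h1 : (Nat.land m (full (2 ^ d))).testBit j = true := by simp [hj, h]
      exact ih h1 h (hne _ (Or.inl h1))
    · have h1 : (Nat.shiftRight m (2 ^ d)).testBit (j - 2 ^ d) = true := by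
        rw [testBit_shr, show 2 ^ d + (j - 2 ^ d) = j by omega, hj]
      have h2 := ih (i := Nat.add i (2 ^ d)) (acc := acc) h1 (by rw [pow_succ] at hd; omega)
        (hne _ (Or.inr h1))
      have h3 : Nat.add i (2 ^ d) + (j - 2 ^ d) = i + j := by
        change i + 2 ^ d + (j - 2 ^ d) = i + j
        omega
      rw [h3] at h2
      exact mem_bits_of_mem h2

theorem testBit_codeOf (l : List ℕ) (i p : ℕ) : (codeOf l i).testBit p = bit i l p := by
  induction l generalizing p with
  | nil => simp [codeOf]
  | cons x l ih =>
    have h : codeOf (x :: l) i = (x.testBit i).toNat + 2 * codeOf l i := by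
      have : cell x i = (x.testBit i).toNat := by
        rw [Nat.testBit_eq_decide_div_mod_eq]
        change (x >>> i) &&& 1 = _
        rw [Nat.and_one_is_mod, Nat.shiftRight_eq_div_pow]
        rcases Nat.mod_two_eq_zero_or_one (x / 2 ^ i) with h | h <;> rw [h] <;> rfl
      rw [← this]
      rfl
    rw [h]
    cases p with
    | zero =>
      rw [Nat.testBit_zero]
      change _ = x.testBit i
      cases x.testBit i <;> simp [Nat.add_mod]
    | succ p =>
      rw [Nat.testBit_succ, bit_cons]
      rw [show ((x.testBit i).toNat + 2 * codeOf l i) / 2 = codeOf l i by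
        cases x.testBit i <;> simp only [Bool.toNat_false, Bool.toNat_true] <;> omega, ih]
      rfl

theorem lane_codes (T : Cols) (i : ℕ) :
    (dec (codeOf (interleave (pad T.W) (pad T.D) (pad T.B) (pad T.A) (pad T.H)) i)).Same
      (lane T i) := by
  intro k hk
  have h : ∀ f : List ℕ → ℕ → Bool,
      f = bit i → f (interleave (pad T.W) (pad T.D) (pad T.B) (pad T.A) (pad T.H)) (5 * k) =
        f T.W k ∧
      f (interleave (pad T.W) (pad T.D) (pad T.B) (pad T.A) (pad T.H)) (5 * k + 1) = f T.D k ∧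
      f (interleave (pad T.W) (pad T.D) (pad T.B) (pad T.A) (pad T.H)) (5 * k + 2) = f T.B k ∧
      f (interleave (pad T.W) (pad T.D) (pad T.B) (pad T.A) (pad T.H)) (5 * k + 3) = f T.A k ∧
      f (interleave (pad T.W) (pad T.D) (pad T.B) (pad T.A) (pad T.H)) (5 * k + 4) = f T.H k := by
    rintro f rfl
    interval_cases k <;> exact ⟨rfl, rfl, rfl, rfl, rfl⟩
  obtain ⟨h1, h2, h3, h4, h5⟩ := h _ rfl
  simp [dec, testBit_codeOf, lane, h1, h2, h3, h4, h5]

theorem eq_of_eqList {l l' : List ℕ} (h : eqList l l' = true) : l = l' := by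
  induction l generalizing l' with
  | nil =>
    cases l' with
    | nil => rfl
    | cons y l' => cases h
  | cons x l ih =>
    cases l' with
    | nil => cases h
    | cons y l' =>
      change cond (Nat.beq x y) (eqList l l') false = true at h
      cases hxy : Nat.beq x y
      · rw [hxy] at h
        cases h
      · rw [hxy] at h
        rw [Nat.eq_of_beq_eq_true hxy, ih h]

/-- Exactly one transition halts. -/
def Tab.OneHalt (T : Tab) : Prop := ∃ j < 8, ∀ k < 8, T.h k = decide (k = j)

/-- A partial machine of which only states up to `m` are in use. -/
structure Inv (c m : ℕ) : Prop where
  lt : c < 2 ^ 40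
  undef : ∀ k < 8, (dec c).h k = true → (dec c).w k = false ∧ (dec c).d k = false ∧ (dec c).q k = 0
  q_le : ∀ k < 8, (dec c).q k ≤ m
  unused : ∀ k < 8, m < k / 2 → (dec c).h k = true

/-- All completions of an item obey the bounds. -/
def Item.Okay : Item → Prop
  | .node c m => Inv c m → ∀ T : Tab, T.Small → T.OneHalt → (dec c).Sub T → T.Good
  | .row c x' z' => c < 2 ^ 40 → ∀ x < 8, ∀ z < 8, x ≠ z → x' = 5 * x → z' = 5 * z →
      ∀ T : Tab, T.Small → (dec c).Sub T →
        (∀ k < 8, T.h k = ((dec c).h k && !(decide (k = x) || decide (k = z)))) → T.Good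
  | .nh c => (dec c).Never
  | .bad => False

theorem mem_nhs {l : List Item} {c : ℕ} (h : Item.nh c ∈ l) : c ∈ nhs l := by
  induction l with
  | nil => cases h
  | cons y l ih =>
    rcases List.mem_cons.1 h with rfl | h'
    · exact List.mem_cons_self
    · cases y
      case nh => exact List.mem_cons_of_mem _ (ih h')
      all_goals exact ih h'

theorem noBad_iff {l : List Item} (h : noBad l = true) {x : Item} (hx : x ∈ l) :
    (∃ c y z, x = .row c y z) ∨ ∃ c, x = .nh c := by
  induction l with
  | nil => cases hx
  | cons y l ih =>
    have ht : noBad l = true := by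
      cases y
      case row => exact h
      case nh => exact h
      all_goals cases h
    rcases List.mem_cons.1 hx with rfl | hx'
    · cases x
      case row c y z => exact Or.inl ⟨c, y, z, rfl⟩
      case nh c => exact Or.inr ⟨c, rfl⟩
      all_goals cases h
    · exact ih ht hx'

theorem never_rest_of_leaves {l : List Item} {D : List ℕ} (h : leaves l D = true)
    (hD : ∀ d ∈ D, (dec (Nat.land (full 40) d)).Never) :
    noBad l = true ∧ (rest l).All Tab.Never := by
  unfold leaves at h
  cases hb : noBad l with
  | false => rw [hb] at h; cases h
  | true =>
    rw [hb, cond_true] at h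
    refine ⟨rfl, fun i hi => ?_⟩
    generalize rest l = b at h hi ⊢
    beta_reduce at h
    cases hV : Nat.beq (Nat.shiftRight b.V 1048576) 0 with
    | false => rw [hV] at h; cases h
    | true =>
      rw [hV, cond_true] at h
      have hm := mem_bits (f := codeOf (interleave (pad b.T.W) (pad b.T.D) (pad b.T.B) (pad b.T.A)
        (pad b.T.H))) (d := 20) (i := 0) (acc := []) hi
          ((eq_zero_of_shr hV hi).trans_eq (by norm_num))
      rw [Nat.zero_add] at hm
      have hc : codes b = lmap (Nat.land (full 40)) D := eq_of_eqList h
      have hm' : _ ∈ codes b := hm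
      rw [hc, lmap_eq] at hm'
      obtain ⟨d, hd, he⟩ := List.mem_map.1 hm'
      exact (lane_codes b.T i).never (dec_small _) (he ▸ hD d hd)

theorem okay_of_leaves {l : List Item} {D : List ℕ} (h : leaves l D = true)
    (hD : ∀ d ∈ D, (dec (Nat.land (full 40) d)).Never) {x : Item} (hx : x ∈ l) : x.Okay := by
  obtain ⟨hb, hr⟩ := never_rest_of_leaves h hD
  obtain ⟨hs, hl⟩ := (Bag.All.of_add (Bag.All.of_sift (Bag.All.of_halves (Bag.All.of_sift hr))))
  have hg := Bag.All.of_settle (by norm_num) (Bag.All.of_halves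
    (Bag.All.of_settle (by norm_num) (Bag.All.of_halves (hs.mono fun _ h => h.good))))
  rcases noBad_iff hb hx with ⟨c, x', z', rfl⟩ | ⟨c, rfl⟩
  · rintro hc x hx8 z hz8 hxz rfl rfl T hT hsub hh
    obtain ⟨r, hrl, hrm⟩ := mem_rowCodes hx
    refine good_of_rowTab hrl hrm hc hx8 hz8 hxz (fun i hi => ?_) hT hsub hh
    have := hg i (by
      rw [len_eq]
      exact (testBit_full _ i).trans (decide_eq_true hi))
    rwa [len_eq] at this
  · exact hl c (mem_nhs hx)


/-! ### Running a partial machine -/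

def ones (x : ℕ) : ℕ := ∑ i ∈ Finset.range 110, (x.testBit i).toNat

theorem pop_eq (n k : ℕ) : pop n k = ∑ i ∈ Finset.range k, (n.testBit i).toNat := by
  induction k generalizing n with
  | zero => rfl
  | succ k ih =>
    have e : pop n (k + 1) = Bool.rec (Nat.add (Nat.land n 1) (pop (Nat.shiftRight n 1) k)) 0
      (Nat.beq n 0) := rfl
    rw [e, Finset.sum_range_succ', ih]
    simp only [testBit_shr]
    have h : Nat.land n 1 = (n.testBit 0).toNat := by
      change n &&& 1 = _
      rw [Nat.and_one_is_mod, Nat.testBit_zero]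
      rcases Nat.mod_two_eq_zero_or_one n with h | h <;> rw [h] <;> rfl
    rw [h]
    cases hn : Nat.beq n 0 with
    | false => simp only [Nat.add_comm 1]; exact Nat.add_comm _ _
    | true => simp [Nat.eq_of_beq_eq_true hn]

theorem ones_push {x : ℕ} (hx : x < 2 ^ 109) (b : Bool) :
    ones (2 * x + b.toNat) = ones x + b.toNat := by
  have h : ∀ i, (2 * x + b.toNat).testBit (i + 1) = x.testBit i := fun i => by
    rw [Nat.testBit_succ]
    congr 1
    cases b <;> simp
    omega
  have h0 : (2 * x + b.toNat).testBit 0 = b := by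
    rw [Nat.testBit_zero]
    cases b <;> simp [Nat.add_mod]
  have e : ones (2 * x + b.toNat) = _ := Finset.sum_range_succ' _ 109
  have e' : ones x = _ := Finset.sum_range_succ _ 109
  rw [e, e', h0, Nat.testBit_lt_two_pow hx, Bool.toNat_false, Nat.add_zero]
  simp only [h]

theorem ones_pull {x : ℕ} (hx : x < 2 ^ 110) :
    ones x = ones (Nat.shiftRight x 1) + (x.testBit 0).toNat := by
  have e : ones x = _ := Finset.sum_range_succ' _ 109
  have e' : ones (Nat.shiftRight x 1) = _ := Finset.sum_range_succ _ 109
  rw [e, e']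
  simp only [testBit_shr, Nat.add_comm 1]
  rw [Nat.testBit_lt_two_pow hx, Bool.toNat_false, Nat.add_zero]

theorem testBit_push (x : ℕ) (b : Bool) : (2 * x + b.toNat).testBit = push b x.testBit := by
  funext k
  cases k with
  | zero =>
    rw [Nat.testBit_zero]
    cases b <;> simp [Nat.add_mod]
  | succ k =>
    rw [Nat.testBit_succ]
    change _ = x.testBit k
    congr 1
    cases b <;> simp
    omega

theorem testBit_pull (x : ℕ) : (Nat.shiftRight x 1).testBit = pull x.testBit := by
  funext k
  rw [testBit_shr, Nat.add_comm]
  rfl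

/-- The state of `run` describes a configuration. -/
structure Conf.Rep (C : Conf) (j l r : ℕ) : Prop where
  offset : j = 5 * C.key
  left : C.l = l.testBit
  right : C.r = r.testBit
  count : C.o = ones l + ones r + C.s.toInt

theorem field_eq {v : ℕ} (hv : v < 32) : Nat.ble 16 v = v.testBit 4 ∧
    Nat.beq (Nat.land v 2) 0 = !v.testBit 1 ∧ Nat.land v 1 = (v.testBit 0).toNat ∧
    (v.testBit 4 = false → Nat.shiftRight v 2 = 2 * (v.testBit 3).toNat + (v.testBit 2).toNat) := by
  revert v
  decide

theorem testBit_field (c j : ℕ) {e : ℕ} (he : e < 5) :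
    (Nat.land (Nat.shiftRight c j) 31).testBit e = c.testBit (j + e) := by
  rw [testBit_land, testBit_shr, show 31 = full 5 from rfl, testBit_full, decide_eq_true he,
    Bool.and_true]

theorem run_succ (c n j l r : ℕ) : run c (n + 1) j l r = (fun v =>
    Bool.rec
      (Bool.rec
        (run c n (Nat.add (Nat.mul 10 (Nat.shiftRight v 2)) (Nat.mul 5 (Nat.land r 1)))
          (Nat.add (Nat.mul 2 l) (Nat.land v 1)) (Nat.shiftRight r 1))
        (run c n (Nat.add (Nat.mul 10 (Nat.shiftRight v 2)) (Nat.mul 5 (Nat.land l 1)))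
          (Nat.shiftRight l 1) (Nat.add (Nat.mul 2 r) (Nat.land v 1)))
        (Nat.beq (Nat.land v 2) 0))
      [j, Nat.add (pop l 110) (pop r 110)]
      (Nat.ble 16 v)) (Nat.land (Nat.shiftRight c j) 31) := rfl

theorem land_one (n : ℕ) : Nat.land n 1 = (n.testBit 0).toNat := by
  change n &&& 1 = _
  rw [Nat.and_one_is_mod, Nat.testBit_zero]
  rcases Nat.mod_two_eq_zero_or_one n with h | h <;> rw [h] <;> rfl

theorem run_step {c n l r : ℕ} {C : Conf} (h : (dec c).h C.key = false) :
    run c (n + 1) (5 * C.key) l r = bif (dec c).d C.key then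
      run c n (10 * (dec c).q C.key + 5 * (r.testBit 0).toNat)
        (2 * l + ((dec c).w C.key).toNat) (Nat.shiftRight r 1)
    else run c n (10 * (dec c).q C.key + 5 * (l.testBit 0).toNat) (Nat.shiftRight l 1)
        (2 * r + ((dec c).w C.key).toNat) := by
  have hv : Nat.land (Nat.shiftRight c (5 * C.key)) 31 < 32 :=
    Nat.and_lt_two_pow (n := 5) _ (by norm_num)
  have hb := fun e (he : e < 5) => testBit_field c (5 * C.key) he
  rw [run_succ]
  generalize Nat.land (Nat.shiftRight c (5 * C.key)) 31 = v at hv hb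
  obtain ⟨h1, h2, h3, h4⟩ := field_eq hv
  simp only [hb 0 (by omega), hb 1 (by omega), hb 2 (by omega), hb 3 (by omega),
    hb 4 (by omega)] at h1 h2 h3 h4
  simp only [dec] at h ⊢
  rw [h1, h2, h3, h4 h, h, land_one, land_one]
  cases c.testBit (5 * C.key + 1) <;> rfl

theorem run_halt {c n l r : ℕ} {C : Conf} (h : (dec c).h C.key = true) :
    run c (n + 1) (5 * C.key) l r = [5 * C.key, ones l + ones r] := by
  have hv : Nat.land (Nat.shiftRight c (5 * C.key)) 31 < 32 :=
    Nat.and_lt_two_pow (n := 5) _ (by norm_num)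
  have hb := testBit_field c (5 * C.key) (e := 4) (by omega)
  rw [run_succ]
  generalize Nat.land (Nat.shiftRight c (5 * C.key)) 31 = v at hv hb
  obtain ⟨h1, -⟩ := field_eq hv
  rw [hb] at h1
  simp only [dec] at h
  beta_reduce
  rw [h1, h, pop_eq, pop_eq]
  rfl

theorem run_sound {c n b l r : ℕ} {C : Conf} (h : C.Rep (5 * C.key) l r) (hl : l < 2 ^ b)
    (hr : r < 2 ^ b) (hb : b + n ≤ 110) :
    (run c n (5 * C.key) l r = [] ∧ ∀ i < n, (dec c).h ((dec c).next^[i] C).key = false) ∨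
    ∃ m < n, (∀ i < m, (dec c).h ((dec c).next^[i] C).key = false) ∧
      (dec c).h ((dec c).next^[m] C).key = true ∧ ∃ t : ℕ,
        run c n (5 * C.key) l r = [5 * ((dec c).next^[m] C).key, t] ∧
        ((dec c).next^[m] C).o = t + ((dec c).next^[m] C).s.toInt := by
  induction n generalizing b l r C with
  | zero => exact Or.inl ⟨rfl, fun i hi => absurd hi (by omega)⟩
  | succ n ih =>
    cases hh : (dec c).h C.key with
    | true =>
      refine Or.inr ⟨0, by omega, fun i hi => absurd hi (by omega), hh, _, run_halt hh, ?_⟩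
      rw [Function.iterate_zero_apply, h.count]
      rw [Nat.cast_add]
    | false =>
      have key : ∃ l' r', ((dec c).next C).Rep (5 * ((dec c).next C).key) l' r' ∧ l' < 2 ^ (b + 1) ∧
          r' < 2 ^ (b + 1) ∧
          run c (n + 1) (5 * C.key) l r = run c n (5 * ((dec c).next C).key) l' r' := by
        have hw : ∀ x < 2 ^ b, 2 * x + ((dec c).w C.key).toNat < 2 ^ (b + 1) := fun x hx => by
          have := Bool.toNat_lt ((dec c).w C.key)
          rw [pow_succ]
          omega
        have hs : ∀ x < 2 ^ b, Nat.shiftRight x 1 < 2 ^ (b + 1) := fun x hx =>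
          (Nat.shiftRight_le x 1).trans_lt (hx.trans (Nat.pow_lt_pow_right (by omega) (by omega)))
        have h109 : ∀ x < 2 ^ b, x < 2 ^ 109 := fun x hx =>
          hx.trans_le (Nat.pow_le_pow_right (by omega) (by omega))
        have h110 : ∀ x < 2 ^ b, x < 2 ^ 110 := fun x hx =>
          hx.trans_le (Nat.pow_le_pow_right (by omega) (by omega))
        have hi : ∀ b : Bool, b.toInt = (b.toNat : ℤ) := fun b => by cases b <;> rfl
        rw [run_step hh]
        cases hd : (dec c).d C.key with
        | true =>
          have e : (dec c).next C = ⟨(dec c).q C.key, C.r 0, push ((dec c).w C.key) C.l, pull C.r,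
            C.o + ((dec c).w C.key).toInt - C.s.toInt⟩ := by rw [Tab.next, if_pos hd]
          refine ⟨2 * l + ((dec c).w C.key).toNat, Nat.shiftRight r 1, ⟨rfl, ?_, ?_, ?_⟩, hw l hl,
            hs r hr, ?_⟩
          · rw [e, testBit_push, h.left]
          · rw [e, testBit_pull, h.right]
          · rw [e, ones_push (h109 l hl)]
            have := ones_pull (h110 r hr)
            simp only [h.count, hi, h.right, this]
            push_cast
            ring
          · rw [e, cond_true, Conf.key, h.right]
            change _ = run c n (5 * (2 * _ + _)) _ _
            rw [show ∀ a b : ℕ, 5 * (2 * a + b) = 10 * a + 5 * b from fun a b => by ring]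
        | false =>
          have e : (dec c).next C = ⟨(dec c).q C.key, C.l 0, pull C.l, push ((dec c).w C.key) C.r,
            C.o + ((dec c).w C.key).toInt - C.s.toInt⟩ := by rw [Tab.next, if_neg (by simp [hd])]
          refine ⟨Nat.shiftRight l 1, 2 * r + ((dec c).w C.key).toNat, ⟨rfl, ?_, ?_, ?_⟩, hs l hl,
            hw r hr, ?_⟩
          · rw [e, testBit_pull, h.left]
          · rw [e, testBit_push, h.right]
          · rw [e, ones_push (h109 r hr)]
            have := ones_pull (h110 l hl)
            simp only [h.count, hi, h.left, this]
            push_cast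
            ring
          · rw [e, cond_false, Conf.key, h.left]
            change _ = run c n (5 * (2 * _ + _)) _ _
            rw [show ∀ a b : ℕ, 5 * (2 * a + b) = 10 * a + 5 * b from fun a b => by ring]
      obtain ⟨l', r', hR, hl', hr', e⟩ := key
      rw [e]
      rcases ih hR hl' hr' (by omega) with ⟨h1, h2⟩ | ⟨m, hm, h2, h3⟩
      · refine Or.inl ⟨h1, fun i hi => ?_⟩
        cases i with
        | zero => exact hh
        | succ i => exact h2 i (by omega)
      · refine Or.inr ⟨m + 1, by omega, fun i hi => ?_, h3⟩
        cases i with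
        | zero => exact hh
        | succ i => exact h2 i (by omega)

theorem run_start {c n : ℕ} (hn : n ≤ 110) :
    (run c n 0 0 0 = [] ∧ ∀ i < n, (dec c).h ((dec c).conf i).key = false) ∨
    ∃ m < n, (∀ i < m, (dec c).h ((dec c).conf i).key = false) ∧
      (dec c).h ((dec c).conf m).key = true ∧ ∃ t : ℕ,
        run c n 0 0 0 = [5 * ((dec c).conf m).key, t] ∧
        ((dec c).conf m).o = t + ((dec c).conf m).s.toInt := by
  refine run_sound (b := 0) (C := Conf.start) ⟨rfl, ?_, ?_, ?_⟩ (by norm_num) (by norm_num)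
    (by omega)
  · funext k; exact (Nat.zero_testBit k).symm
  · funext k; exact (Nat.zero_testBit k).symm
  · simp [Conf.start, ones]


/-! ### Enumeration of machines -/

theorem Inv.conf_q_le {c m : ℕ} (h : Inv c m) (n : ℕ) : ((dec c).conf n).q ≤ m := by
  cases n with
  | zero => exact Nat.zero_le m
  | succ n =>
    rw [Tab.conf_succ, Tab.next_q]
    exact h.q_le _ (Tab.key_lt (dec_small c) n)

theorem Conf.key_div (C : Conf) : C.key / 2 = C.q := by
  unfold Conf.key
  cases C.s <;> simp
  omega

/-- A completion of a partial machine obeys the bounds or defines the first undefined transition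
reached. -/
theorem good_or_defines {c m : ℕ} {f : ℕ → List Item} (hc : Inv c m)
    (h : ∀ y ∈ (List.rec [Item.nh c] (fun j t _ => cond (Nat.ble (hd t) 12) (f j) [Item.bad])
      (run c 40 0 0 0) : List Item), y.Okay) {T : Tab} (hs : (dec c).Sub T) :
    T.Good ∨ ∃ k < 8, k / 2 ≤ m ∧ (dec c).h k = true ∧ T.h k = false ∧
      ∀ y ∈ f (5 * k), y.Okay := by
  rcases run_start (c := c) (n := 40) (by omega) with ⟨e, -⟩ | ⟨n, hn, h1, h2, t, e, ho⟩
  · rw [e] at h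
    exact Or.inl (hs.never (dec_small c) (h _ (List.mem_singleton_self _))).good
  · rw [e] at h
    change ∀ y ∈ cond (Nat.ble t 12) (f _) [Item.bad], y.Okay at h
    rw [ble_eq] at h
    by_cases ht : t ≤ 12
    swap
    · rw [decide_eq_false ht] at h
      exact (h _ (List.mem_singleton_self _)).elim
    rw [decide_eq_true ht] at h
    have hC := hs.conf (dec_small c) h1
    cases hh : T.h ((dec c).conf n).key with
    | true =>
      left
      have hH : T.HaltsAt n := ⟨by rwa [hC], fun i hi => by
        rw [hs.conf (dec_small c) fun j hj => h1 j (hj.trans hi)]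
        exact (hs _ (Tab.key_lt (dec_small c) i) (h1 i hi)).1⟩
      intro n' hn'
      obtain rfl := hn'.unique hH
      rw [hC, ho]
      omega
    | false =>
      exact Or.inr ⟨_, Tab.key_lt (dec_small c) n, (Conf.key_div _).trans_le (hc.conf_q_le n),
        h2, hh, h⟩

theorem testBit_fill {k k' v e : ℕ} (c : ℕ) (hv : v < 16) (he : e < 5) :
    (fill c (5 * k) v).testBit (5 * k' + e) =
      (c.testBit (5 * k' + e) ^^ (decide (k' = k) && (Nat.xor 16 v).testBit e)) := by
  have hx : Nat.xor 16 v < 2 ^ 5 := Nat.xor_lt_two_pow (by norm_num) (by omega)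
  rw [fill, testBit_lxor, testBit_shl]
  congr 1
  rcases lt_trichotomy k' k with h | rfl | h
  · rw [decide_eq_false (by omega), decide_eq_false (by omega)]
    rfl
  · rw [decide_eq_true (by omega), decide_eq_true rfl, Nat.add_sub_cancel_left]
  · rw [decide_eq_false (p := k' = k) (by omega), Bool.false_and,
      Nat.testBit_lt_two_pow (hx.trans_le (Nat.pow_le_pow_right (by omega) (by omega))),
      Bool.and_false]

theorem dec_fill_of_ne {k k' v : ℕ} (c : ℕ) (hv : v < 16) (hk : k' ≠ k) :
    (dec (fill c (5 * k) v)).w k' = (dec c).w k' ∧ (dec (fill c (5 * k) v)).d k' = (dec c).d k' ∧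
      (dec (fill c (5 * k) v)).h k' = (dec c).h k' ∧ (dec (fill c (5 * k) v)).q k' =
        (dec c).q k' := by
  have h := fun e (he : e < 5) => testBit_fill (k := k) (k' := k') c hv he
  simp only [decide_eq_false hk, Bool.false_and, Bool.xor_false] at h
  have h0 := h 0 (by omega)
  simp only [Nat.add_zero] at h0
  simp [dec, h0, h 1, h 2, h 3, h 4]

theorem dec_fill_self {c m k v : ℕ} (hc : Inv c m) (hv : v < 16) (hk : k < 8)
    (hh : (dec c).h k = true) :
    (dec (fill c (5 * k) v)).w k = v.testBit 0 ∧ (dec (fill c (5 * k) v)).d k = v.testBit 1 ∧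
      (dec (fill c (5 * k) v)).h k = false ∧ (dec (fill c (5 * k) v)).q k = v / 4 := by
  have h := fun e (he : e < 5) => testBit_fill (k := k) (k' := k) c hv he
  obtain ⟨hw, hd, hq⟩ := hc.undef k hk hh
  simp only [decide_true, Bool.true_and] at h
  have h0 := h 0 (by omega)
  simp only [Nat.add_zero] at h0
  simp only [dec] at hw hd hq hh ⊢
  have h2 : c.testBit (5 * k + 2) = false := by
    cases e : c.testBit (5 * k + 2) with
    | false => rfl
    | true => rw [e] at hq; simp at hq
  have h3 : c.testBit (5 * k + 3) = false := by
    cases e : c.testBit (5 * k + 3) with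
    | false => rfl
    | true => rw [e] at hq; simp at hq
  rw [h0, h 1 (by omega), h 2 (by omega), h 3 (by omega), h 4 (by omega), hw, hd, h2, h3, hh]
  have : ∀ v < 16, (false ^^ (Nat.xor 16 v).testBit 0) = v.testBit 0 ∧
      (false ^^ (Nat.xor 16 v).testBit 1) = v.testBit 1 ∧
      (true ^^ (Nat.xor 16 v).testBit 4) = false ∧
      2 * (false ^^ (Nat.xor 16 v).testBit 3).toNat + (false ^^ (Nat.xor 16 v).testBit 2).toNat = v
        / 4 := by
    decide
  exact this v hv

theorem Inv.fill {c m k v : ℕ} (hc : Inv c m) (hv : v < 16) (hk : k < 8) (hkm : k / 2 ≤ m)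
    (hh : (dec c).h k = true) : Inv (fill c (5 * k) v) (max m (v / 4)) where
  lt := by
    refine Nat.xor_lt_two_pow hc.lt ?_
    have hx : Nat.xor 16 v < 2 ^ 5 := Nat.xor_lt_two_pow (by norm_num) (by omega)
    change Nat.xor 16 v <<< (5 * k) < _
    rw [Nat.shiftLeft_eq]
    calc Nat.xor 16 v * 2 ^ (5 * k) < 2 ^ 5 * 2 ^ (5 * k) :=
          Nat.mul_lt_mul_of_pos_right hx (by positivity)
      _ = 2 ^ (5 + 5 * k) := (pow_add _ _ _).symm
      _ ≤ 2 ^ 40 := Nat.pow_le_pow_right (by omega) (by omega)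
  undef k' hk' h := by
    by_cases hkk : k' = k
    · subst hkk
      rw [(dec_fill_self hc hv hk hh).2.2.1] at h
      cases h
    · obtain ⟨h1, h2, h3, h4⟩ := dec_fill_of_ne c hv hkk
      rw [h1, h2, h4]
      exact hc.undef k' hk' (h3 ▸ h)
  q_le k' hk' := by
    by_cases hkk : k' = k
    · subst hkk
      rw [(dec_fill_self hc hv hk hh).2.2.2]
      exact le_max_right _ _
    · rw [(dec_fill_of_ne c hv hkk).2.2.2]
      exact (hc.q_le k' hk').trans (le_max_left _ _)
  unused k' hk' h := by
    have hkk : k' ≠ k := by rintro rfl; omega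
    rw [(dec_fill_of_ne c hv hkk).2.2.1]
    exact hc.unused k' hk' (by omega)

/-- Up to renaming states, a transition goes to a used or the next unused state. -/
theorem exists_fill {c m k : ℕ} (hc : Inv c m) (hk : k < 8) (hkm : k / 2 ≤ m)
    (hh : (dec c).h k = true) {T : Tab} (hT : T.Small) (h1 : T.OneHalt) (hs : (dec c).Sub T)
    (hTk : T.h k = false) : ∃ v < 16, v < 4 * (m + 2) ∧ v.testBit 1 = T.d k ∧ ∃ T' : Tab,
      T'.Small ∧ T'.OneHalt ∧ (dec (fill c (5 * k) v)).Sub T' ∧ (T'.Good → T.Good) := by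
  obtain ⟨t, ht⟩ : ∃ t, t = T.q k := ⟨_, rfl⟩
  obtain ⟨a, ha⟩ : ∃ a, a = min (m + 1) t := ⟨_, rfl⟩
  obtain ⟨f, hf⟩ : ∃ f : ℕ → ℕ, f = fun q => if q = t then a else if q = a then t else q := ⟨_, rfl⟩
  have ht4 : t < 4 := ht ▸ hT k
  have hft : f t = a := by rw [hf]; exact if_pos rfl
  have hfm : ∀ q ≤ m, f q = q := fun q hq => by
    simp only [hf]
    split_ifs <;> omega
  have hff : ∀ q, f (f q) = q := fun q => by
    simp only [hf]
    split_ifs <;> omega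
  have hf4 : ∀ q < 4, f q < 4 := fun q hq => by
    simp only [hf]
    split_ifs <;> omega
  obtain ⟨v, hv⟩ : ∃ v, v = 4 * a + 2 * (T.d k).toNat + (T.w k).toNat := ⟨_, rfl⟩
  have hw1 := Bool.toNat_lt (T.w k)
  have hd1 := Bool.toNat_lt (T.d k)
  have hv4 : v / 4 = a := by omega
  have hv0 : v.testBit 0 = T.w k := by
    rw [Nat.testBit_zero, hv]
    cases T.w k <;> simp <;> omega
  have hv1 : v.testBit 1 = T.d k := by
    rw [Nat.testBit_succ, Nat.testBit_zero, show v / 2 = 2 * a + (T.d k).toNat by omega]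
    cases T.d k <;> simp [Nat.add_mod]
  have hv16 : v < 16 := by omega
  have hg : ∀ k', k' / 2 ≤ m → 2 * f (k' / 2) + k' % 2 = k' := fun k' hk' => by
    rw [hfm _ hk']
    omega
  refine ⟨v, hv16, by omega, hv1, T.rename f, fun k' => hf4 _ (hT _), ?_, fun k' hk' h => ?_,
    Tab.good_of_rename hff (hfm 0 (Nat.zero_le m))⟩
  · obtain ⟨j, hj, hT1⟩ := h1
    have hj4 := hf4 (j / 2) (by omega)
    refine ⟨2 * f (j / 2) + j % 2, by omega, fun k' hk' => ?_⟩
    have hk4 := hf4 (k' / 2) (by omega)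
    refine (hT1 (2 * f (k' / 2) + k' % 2) (by omega)).trans (decide_eq_decide.2 ⟨?_, ?_⟩)
    · rintro rfl
      rw [show (2 * f (k' / 2) + k' % 2) / 2 = f (k' / 2) by omega, hff]
      omega
    · rintro rfl
      rw [show (2 * f (j / 2) + j % 2) / 2 = f (j / 2) by omega, hff]
      omega
  · by_cases hkk : k' = k
    · subst hkk
      obtain ⟨e1, e2, e3, e4⟩ := dec_fill_self hc hv16 hk' hh
      rw [e1, e2, e4]
      simp only [Tab.rename, hg k' hkm]
      exact ⟨hTk, hv0.symm, hv1.symm, by rw [← ht, hft, hv4]⟩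
    · obtain ⟨e1, e2, e3, e4⟩ := dec_fill_of_ne c hv16 hkk
      rw [e1, e2, e4]
      rw [e3] at h
      obtain ⟨s1, s2, s3, s4⟩ := hs k' hk' h
      have hkm' : k' / 2 ≤ m := by
        by_contra hc'
        rw [hc.unused k' hk' (by omega)] at h
        cases h
      simp only [Tab.rename, hg k' hkm', s1, s2, s3, s4]
      exact ⟨trivial, trivial, trivial, hfm _ (hc.q_le k' hk')⟩

theorem mem_kids {c m j n v : ℕ} (h : v < n) :
    Item.node (fill c j v) (max m (v / 4)) ∈ kids c m j n := by
  induction n with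
  | zero => omega
  | succ n ih =>
    rcases Nat.lt_succ_iff_lt_or_eq.1 h with h | rfl
    · exact List.mem_cons_of_mem _ (ih h)
    · have e : (cond (Nat.ble m (Nat.div v 4)) (Nat.div v 4) m) = max m (v / 4) := by
        change (cond (Nat.ble m (v / 4)) (v / 4) m) = _
        rw [ble_eq]
        by_cases hm : m ≤ v / 4
        · rw [decide_eq_true hm, max_eq_right hm]; rfl
        · rw [decide_eq_false hm, max_eq_left (by omega)]; rfl
      rw [← e]
      exact List.mem_cons_self

theorem okay_of_branch {x : Item} (h : ∀ y ∈ branch x, y.Okay) : x.Okay := by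
  cases x with
  | node c m =>
    intro hc T hT h1 hs
    rcases good_or_defines hc h hs with hg | ⟨k, hk, hkm, hh, hTk, hy⟩
    · exact hg
    · obtain ⟨v, hv, hvm, -, T', hT', h1', hs', hg⟩ := exists_fill hc hk hkm hh hT h1 hs hTk
      refine hg (hy _ (mem_kids ?_) (hc.fill hv hk hkm hh) T' hT' h1' hs')
      change v < cond (Nat.ble 2 m) 16 (4 * (m + 2))
      cases Nat.ble 2 m
      · exact hvm
      · exact hv
  | row => exact h _ (List.mem_singleton_self _)
  | nh => exact h _ (List.mem_singleton_self _)
  | bad => exact h _ (List.mem_singleton_self _)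

theorem defined_eq (c k : ℕ) : defined c (5 * k) = !(dec c).h k := by
  unfold defined
  rw [beq_eq]
  have h : ∀ p, (Nat.land (Nat.shiftRight c (5 * k)) 16).testBit p =
      (decide (p = 4) && c.testBit (5 * k + 4)) := fun p => by
    rw [testBit_land, testBit_shr, show 16 = 2 ^ 4 from rfl, Nat.testBit_two_pow]
    by_cases hp : p = 4
    · subst hp; simp
    · simp [hp, Ne.symm hp]
  simp only [dec]
  cases hc : c.testBit (5 * k + 4) with
  | false =>
    refine decide_eq_true (Nat.eq_of_testBit_eq fun p => ?_)
    rw [h, hc, Nat.zero_testBit, Bool.and_false]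
  | true =>
    refine decide_eq_false fun h0 => ?_
    have := h 4
    rw [h0, hc, Nat.zero_testBit] at this
    cases this

theorem mem_undef {c k n y : ℕ} :
    y ∈ undef c (5 * k) n ↔ ∃ i < n, i ≠ k ∧ (dec c).h i = true ∧ y = 5 * i := by
  induction n with
  | zero => simp [undef]
  | succ n ih =>
    have e : undef c (5 * k) (n + 1) = cond (Nat.beq (5 * n) (5 * k)) (undef c (5 * k) n)
      (cond (defined c (5 * n)) (undef c (5 * k) n) (5 * n :: undef c (5 * k) n)) := rfl
    rw [e, beq_eq, defined_eq]
    constructor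
    · intro h
      by_cases hk : n = k
      · rw [decide_eq_true (by omega), cond_true] at h
        obtain ⟨i, hi, h'⟩ := ih.1 h
        exact ⟨i, by omega, h'⟩
      · rw [decide_eq_false (by omega), cond_false] at h
        cases hh : (dec c).h n with
        | false =>
          rw [hh] at h
          obtain ⟨i, hi, h'⟩ := ih.1 h
          exact ⟨i, by omega, h'⟩
        | true =>
          rw [hh] at h
          rcases List.mem_cons.1 h with rfl | h
          · exact ⟨n, by omega, hk, hh, rfl⟩
          · obtain ⟨i, hi, h'⟩ := ih.1 h
            exact ⟨i, by omega, h'⟩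
    · rintro ⟨i, hi, hik, hh, rfl⟩
      rcases Nat.lt_succ_iff_lt_or_eq.1 hi with hi | rfl
      · have := ih.2 ⟨i, hi, hik, hh, rfl⟩
        cases decide (5 * n = 5 * k)
        · cases (dec c).h n
          · exact this
          · exact List.mem_cons_of_mem _ this
        · exact this
      · rw [decide_eq_false (by omega), hh]
        exact List.mem_cons_self

theorem nodup_undef (c k n : ℕ) : (undef c (5 * k) n).Nodup := by
  induction n with
  | zero => exact List.nodup_nil
  | succ n ih =>
    have e : undef c (5 * k) (n + 1) = cond (Nat.beq (5 * n) (5 * k)) (undef c (5 * k) n)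
      (cond (defined c (5 * n)) (undef c (5 * k) n) (5 * n :: undef c (5 * k) n)) := rfl
    rw [e]
    cases Nat.beq (5 * n) (5 * k)
    · cases defined c (5 * n)
      · refine List.nodup_cons.2 ⟨fun h => ?_, ih⟩
        obtain ⟨i, hi, -, -, h⟩ := mem_undef.1 h
        omega
      · exact ih
    · exact ih

theorem okay_of_leaf {x : Item} (h : ∀ y ∈ leaf x, y.Okay) : x.Okay := by
  cases x with
  | node c m =>
    intro hc T hT h1 hs
    rcases good_or_defines (f := fun j => rows c j (undef c j 8)) hc h hs with
      hg | ⟨k, hk, hkm, hh, hTk, hy⟩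
    · exact hg
    · have hm := fun y => mem_undef (c := c) (k := k) (n := 8) (y := y)
      have hnd := nodup_undef c k 8
      generalize undef c (5 * k) 8 = u at hy hm hnd
      match u, hy, hm, hnd with
      | [], hy, _, _ => exact (hy _ (List.mem_singleton_self _)).elim
      | [y], hy, _, _ => exact (hy _ (List.mem_singleton_self _)).elim
      | y :: z :: w :: u, hy, _, _ => exact (hy _ (List.mem_singleton_self _)).elim
      | [y', z'], hy, hm, hnd =>
        obtain ⟨y, hy8, hyk, hyh, rfl⟩ := (hm y').1 (by simp)
        obtain ⟨z, hz8, hzk, hzh, rfl⟩ := (hm z').1 (by simp)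
        have hu : ∀ i < 8, (dec c).h i = (decide (i = k) ||
            (decide (i = y) || decide (i = z))) := by
          intro i hi
          rw [Bool.eq_iff_iff]
          simp only [Bool.or_eq_true, decide_eq_true_eq]
          constructor
          · intro hi'
            by_cases hik : i = k
            · exact Or.inl hik
            · have := (hm _).2 ⟨i, hi, hik, hi', rfl⟩
              simp at this
              omega
          · rintro (rfl | rfl | rfl) <;> assumption
        obtain ⟨j, hj, hTj⟩ := h1
        have hjk : j ≠ k := by
          rintro rfl
          rw [hTj j hj] at hTk
          simp at hTk
        have hjh : (dec c).h j = true := by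
          cases e : (dec c).h j with
          | true => rfl
          | false =>
            have := (hs j hj e).1
            rw [hTj j hj] at this
            simp at this
        have hjyz : j = y ∨ j = z := by
          rw [hu j hj] at hjh
          simpa [hjk] using hjh
        have hyz : y ≠ z := by
          rintro rfl
          simp at hnd
        rcases hjyz with rfl | rfl
        · refine hy (.row c (5 * k) (5 * z)) (List.mem_cons_of_mem _ List.mem_cons_self)
            hc.lt k hk z
            hz8 (Ne.symm hzk) rfl rfl T hT hs fun i hi => ?_
          rw [hu i hi, hTj i hi]
          by_cases h1 : i = k <;> by_cases h2 : i = z <;> simp [h1, h2] <;> omega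
        · refine hy (.row c (5 * k) (5 * y)) List.mem_cons_self hc.lt k hk y
            hy8 (Ne.symm hyk) rfl rfl T hT hs fun i hi => ?_
          rw [hu i hi, hTj i hi]
          by_cases h1 : i = k <;> by_cases h2 : i = y <;> simp [h1, h2] <;> omega
  | row => exact h _ (List.mem_singleton_self _)
  | nh => exact h _ (List.mem_singleton_self _)
  | bad => exact h _ (List.mem_singleton_self _)

theorem okay_of_flat {f : Item → List Item} (hf : ∀ x : Item, (∀ y ∈ f x, y.Okay) → x.Okay)
    {l : List Item} (h : ∀ y ∈ flat f l, y.Okay) : ∀ x ∈ l, x.Okay := by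
  induction l with
  | nil => intro x hx; cases hx
  | cons a l ih =>
    intro x hx
    rcases List.mem_cons.1 hx with rfl | hx
    · exact hf x fun y hy => h y (List.mem_append_left _ hy)
    · exact ih (fun y hy => h y (List.mem_append_right _ hy)) x hx

theorem inv_blank : Inv blank 0 := by
  constructor <;> decide

theorem good_of_root (h : ∀ x ∈ root, x.Okay) {T : Tab} (hT : T.Small) (h1 : T.OneHalt) :
    T.Good := by
  have key : ∀ T : Tab, T.Small → T.OneHalt → T.d 0 = true → T.Good := by
    intro T hT h1 hd
    have hs : (dec blank).Sub T := by
      intro k hk hh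
      have : ∀ k < 8, (dec blank).h k = true := by decide
      rw [this k hk] at hh
      cases hh
    cases hh : T.h 0 with
    | true =>
      intro n hn
      obtain rfl := hn.unique (n := 0) ⟨hh, fun m hm => absurd hm (by omega)⟩
      simp [Tab.conf, Conf.start]
    | false =>
      obtain ⟨v, hv, hvm, hvd, T', hT', h1', hs', hg⟩ := exists_fill inv_blank (k := 0) (by omega)
        (by omega) (by decide) hT h1 hs hh
      have hi := inv_blank.fill hv (k := 0) (by omega) (by omega) (by decide)
      rw [hd] at hvd
      refine hg (h (.node (fill blank 0 v) (max 0 (v / 4))) ?_ hi T' hT' h1' hs')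
      have : ∀ v < 8, v.testBit 1 = true → v = 2 ∨ v = 3 ∨ v = 6 ∨ v = 7 := by decide
      rcases this v (by omega) hvd with rfl | rfl | rfl | rfl <;> simp [root]
  cases hd : T.d 0 with
  | true => exact key T hT h1 hd
  | false => exact Tab.good_of_flip (key T.flip hT h1 (by simp [Tab.flip, hd]))


/-! ### Turing machines -/

theorem Tab.good_of_oneHalt (h : ∀ T : Tab, T.Small → T.OneHalt → T.Good) {T : Tab}
    (hT : T.Small) : T.Good := by
  intro n hn
  obtain ⟨T', hT'⟩ : ∃ T' : Tab, T' = { T with h := fun k => decide (k = (T.conf n).key) }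
      := ⟨_, rfl⟩
  have hs : T.Sub T' := by
    subst hT'
    refine fun k hk hh => ⟨decide_eq_false ?_, rfl, rfl, rfl⟩
    rintro rfl
    rw [hn.1] at hh
    cases hh
  have hg := h T' (by subst hT'; exact hT) (by
    subst hT'; exact ⟨_, Tab.key_lt hT n, fun k _ => rfl⟩) n ⟨by
      rw [hs.conf hT hn.2]
      subst hT'
      exact decide_eq_true rfl, fun m hm => by
      rw [hs.conf hT fun j hj => hn.2 j (hj.trans hm)]
      exact (hs _ (Tab.key_lt hT m) (hn.2 m hm)).1⟩
  rwa [hs.conf hT hn.2] at hg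

/-- The transition with a given index. -/
def entry (M : Machine 4 2) (k : ℕ) : Fin 2 × Dir × Option (Fin 4) :=
  M (Fin.ofNat 4 (k / 2)) (Fin.ofNat 2 k)

def tabOf (M : Machine 4 2) : Tab where
  w k := decide ((entry M k).1 = 1)
  d k := match (entry M k).2.1 with
    | .L => false
    | .R => true
  h k := (entry M k).2.2.isNone
  q k := (entry M k).2.2.elim 0 Fin.val

theorem tabOf_small (M : Machine 4 2) : (tabOf M).Small := fun k => by
  simp only [tabOf]
  cases (entry M k).2.2 with
  | none => simp
  | some q => exact q.isLt

/-- `C` describes a configuration of a Turing machine. -/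
structure Conf.Of (C : Conf) (c : Cfg 4 2) : Prop where
  state : ∃ q, c.state = some q ∧ q.val = C.q
  symbol : C.s = decide (c.tape c.pos = 1)
  left : ∀ k : ℕ, C.l k = decide (c.tape (c.pos - 1 - k) = 1)
  right : ∀ k : ℕ, C.r k = decide (c.tape (c.pos + 1 + k) = 1)
  finite : {i | c.tape i ≠ 0}.Finite
  count : C.o = sigmaCount c

theorem Conf.Of.entry_key {C : Conf} {c : Cfg 4 2} (h : C.Of c) {M : Machine 4 2} {q : Fin 4}
    (hq : c.state = some q) : entry M C.key = M q (c.tape c.pos) := by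
  obtain ⟨q', hq', hv⟩ := h.state
  obtain rfl : q' = q := Option.some.inj (hq'.symm.trans hq)
  have e : C.s.toNat = (c.tape c.pos).val := by
    rw [h.symbol]
    generalize c.tape c.pos = a
    revert a
    decide
  have hlt := (c.tape c.pos).isLt
  have hq4 := q'.isLt
  unfold entry
  congr 1
  · apply Fin.ext
    simp only [Fin.ofNat, Conf.key]
    omega
  · apply Fin.ext
    simp only [Fin.ofNat, Conf.key]
    omega

theorem ncard_support {f g : ℤ → Fin 2} {p : ℤ} (hf : {i | f i ≠ 0}.Finite)
    (h : ∀ i ≠ p, g i = f i) : {i | g i ≠ 0}.Finite ∧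
      ({i | g i ≠ 0}.ncard : ℤ) = ({i | f i ≠ 0} \ {p}).ncard + (decide (g p = 1)).toInt := by
  have hD : ({i | f i ≠ 0} \ {p}).Finite := hf.subset Set.sdiff_subset
  have hp : p ∉ {i | f i ≠ 0} \ {p} := fun h => h.2 rfl
  by_cases hg : g p = 0
  · have e : {i | g i ≠ 0} = {i | f i ≠ 0} \ {p} := by
      ext i
      by_cases hi : i = p
      · simp [hi, hg]
      · simp [hi, h i hi]
    rw [e, hg]
    exact ⟨hD, by simp⟩
  · have e : {i | g i ≠ 0} = insert p ({i | f i ≠ 0} \ {p}) := by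
      ext i
      by_cases hi : i = p
      · simp [hi, hg]
      · simp [hi, h i hi]
    have h1 : g p = 1 := by omega
    rw [e, h1, Set.ncard_insert_of_notMem hp hD]
    exact ⟨hD.insert p, by simp⟩

theorem Conf.Of.update {C : Conf} {c : Cfg 4 2} (h : C.Of c) (a : Fin 2) :
    {i | Function.update c.tape c.pos a i ≠ 0}.Finite ∧
      C.o + (decide (a = 1)).toInt - C.s.toInt =
        ({i | Function.update c.tape c.pos a i ≠ 0}.ncard : ℤ) := by
  obtain ⟨-, h1⟩ := ncard_support (g := c.tape) h.finite (p := c.pos) fun _ _ => rfl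
  obtain ⟨h2, h3⟩ := ncard_support (g := Function.update c.tape c.pos a) h.finite (p := c.pos)
    fun i hi => Function.update_of_ne hi _ _
  refine ⟨h2, ?_⟩
  rw [h3, h.count, h.symbol, sigmaCount, h1, Function.update_self]
  ring

theorem Conf.Of.advance {C : Conf} {c : Cfg 4 2} (h : C.Of c) {M : Machine 4 2} (hM : Valid M) :
    ((tabOf M).h C.key = true → (step M c).state = none ∧
      C.o + 1 - C.s.toInt = sigmaCount (step M c)) ∧
    ((tabOf M).h C.key = false → ((tabOf M).next C).Of (step M c)) := by
  obtain ⟨q, hq, -⟩ := h.state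
  have he := h.entry_key (M := M) hq
  have hs : step M c = ⟨(M q (c.tape c.pos)).2.2, c.pos + (M q (c.tape c.pos)).2.1.move,
      Function.update c.tape c.pos (M q (c.tape c.pos)).1⟩ := by
    simp only [step, hq]
  have hv := hM q (c.tape c.pos)
  rw [hs]
  simp only [tabOf, Tab.next, he]
  generalize M q (c.tape c.pos) = e at hv
  obtain ⟨a, d, q'⟩ := e
  obtain ⟨hf, ho⟩ := h.update a
  constructor
  · intro hh
    obtain rfl : q' = none := by simpa using hh
    obtain ⟨rfl, -⟩ := hv rfl
    exact ⟨rfl, ho⟩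
  · intro hh
    obtain ⟨q', rfl⟩ : ∃ q, q' = some q := by
      cases q' with
      | none => cases hh
      | some q => exact ⟨q, rfl⟩
    have hu : ∀ i j, j = i → i ≠ c.pos →
        decide (c.tape i = 1) = decide (Function.update c.tape c.pos a j = 1) := by
      rintro i j rfl hi
      rw [Function.update_of_ne hi]
    cases d with
    | L =>
      refine ⟨⟨q', rfl, rfl⟩, ?_, fun k => ?_, fun k => ?_, hf, ho⟩
      · exact (h.left 0).trans (hu _ _ (by simp [Dir.move, sub_eq_add_neg]) (by simp))
      · refine (h.left (k + 1)).trans (hu _ _ ?_ (by omega))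
        simp only [Dir.move]
        omega
      · cases k with
        | zero => simp [Dir.move]
        | succ k =>
          refine (h.right k).trans (hu _ _ ?_ (by omega))
          simp only [Dir.move]
          omega
    | R =>
      refine ⟨⟨q', rfl, rfl⟩, ?_, fun k => ?_, fun k => ?_, hf, ho⟩
      · exact (h.right 0).trans (hu _ _ (by simp [Dir.move]) (by simp))
      · cases k with
        | zero => simp [Dir.move]
        | succ k =>
          refine (h.left k).trans (hu _ _ ?_ (by omega))
          simp only [Dir.move]
          omega
      · refine (h.right (k + 1)).trans (hu _ _ ?_ (by omega))
        simp only [Dir.move]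
        omega

theorem start_of : Conf.start.Of (init 4 2) where
  state := ⟨0, rfl, rfl⟩
  symbol := rfl
  left _ := rfl
  right _ := rfl
  finite := by simp [init]
  count := by simp [init, sigmaCount, Conf.start]

theorem conf_of {M : Machine 4 2} (hM : Valid M) {n : ℕ}
    (h : ∀ m < n, (tabOf M).h ((tabOf M).conf m).key = false) :
    ((tabOf M).conf n).Of ((step M)^[n] (init 4 2)) := by
  induction n with
  | zero => exact start_of
  | succ n ih =>
    rw [Tab.conf_succ, Function.iterate_succ_apply']
    exact ((ih fun m hm => h m (by omega)).advance hM).2 (h n (by omega))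

theorem haltsIn_iff {M : Machine 4 2} (hM : Valid M) {t : ℕ} : HaltsIn M (init 4 2) t ↔
    ∃ n, t = n + 1 ∧ (tabOf M).HaltsAt n := by
  have key : ∀ n, (∀ m < n, (tabOf M).h ((tabOf M).conf m).key = false) →
      ((tabOf M).h ((tabOf M).conf n).key = true ↔ ((step M)^[n + 1] (init 4 2)).state = none) := by
    intro n hn
    have h := (conf_of hM hn).advance hM
    rw [Function.iterate_succ_apply']
    cases hh : (tabOf M).h ((tabOf M).conf n).key with
    | true => simp [(h.1 hh).1]
    | false =>
      obtain ⟨q, hq, -⟩ := (h.2 hh).state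
      simp [hq]
  constructor
  · rintro ⟨h1, h2⟩
    cases t with
    | zero => cases h1
    | succ n =>
      have hn : ∀ m ≤ n, ∀ j < m, (tabOf M).h ((tabOf M).conf j).key = false := by
        intro m
        induction m with
        | zero => intro _ j hj; omega
        | succ m ih =>
          intro hm j hj
          have := key j fun i hi => ih (by omega) i (by omega)
          have h3 := h2 (j + 1) (by omega)
          exact Bool.eq_false_iff.2 fun hh => h3 (this.1 hh)
      exact ⟨n, rfl, (key n (hn n le_rfl)).2 h1, hn n le_rfl⟩
  · rintro ⟨n, rfl, h1, h2⟩
    refine ⟨(key n h2).1 h1, fun i hi => ?_⟩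
    obtain ⟨q, hq, -⟩ := (conf_of hM (n := i) fun m hm => h2 m (by omega)).state
    simp [hq]

theorem sigmaCount_of_haltsAt {M : Machine 4 2} (hM : Valid M) {n : ℕ} (h : (tabOf M).HaltsAt n) :
    (sigmaCount ((step M)^[n + 1] (init 4 2)) : ℤ) =
      ((tabOf M).conf n).o + 1 - ((tabOf M).conf n).s.toInt := by
  rw [Function.iterate_succ_apply']
  exact (((conf_of hM h.2).advance hM).1 h.1).2.symm

def champion : Machine 4 2 := fun q s =>
  ![![(1, .R, some 1), (1, .L, some 1)], ![(1, .L, some 0), (0, .L, some 2)],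
    ![(1, .R, none), (1, .L, some 3)], ![(1, .R, some 3), (0, .R, some 0)]] q s

theorem champion_valid : Valid champion := by
  intro q a
  fin_cases q <;> fin_cases a <;> simp [champion]

/-- The code of the champion, with its halting transition undefined. -/
def championCode : ℕ := 0x13db0404a7

theorem champion_same : (dec championCode).Same (tabOf champion) := by
  intro k hk
  interval_cases k <;> decide

theorem champion_haltsAt : (tabOf champion).HaltsAt 106 ∧
    ((tabOf champion).conf 106).o + 1 - ((tabOf champion).conf 106).s.toInt = 13 := by
  have e1 : run championCode 106 0 0 0 = [] := by decide +kernel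
  have e2 : run championCode 107 0 0 0 = [20, 12] := by decide +kernel
  have hT := dec_small championCode
  have hs := champion_same.sub
  rcases run_start (c := championCode) (n := 106) (by omega) with ⟨-, h⟩ | ⟨m, -, -, -, t, e, -⟩
  · rcases run_start (c := championCode) (n := 107) (by omega) with ⟨e, -⟩ |
      ⟨m, hm, h1, h2, t, e, ho⟩
    · rw [e2] at e
      cases e
    · obtain rfl : m = 106 := by
        by_contra hne
        rw [h m (by omega)] at h2
        cases h2
      rw [e2] at e
      simp only [List.cons.injEq, and_true] at e
      refine ⟨⟨?_, fun i hi => ?_⟩, ?_⟩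
      · rw [hs.conf hT h]
        exact (champion_same _ (Tab.key_lt hT _)).1.symm.trans h2
      · rw [hs.conf hT fun j hj => h j (hj.trans hi)]
        exact (hs _ (Tab.key_lt hT i) (h i hi)).1
      · rw [hs.conf hT h, ho, ← e.2]
        norm_num
        ring
  · rw [e1] at e
    cases e

theorem good_of_valid (h : ∀ T : Tab, T.Small → T.OneHalt → T.Good) {M : Machine 4 2}
    (hM : Valid M) {t : ℕ} (ht : HaltsIn M (init 4 2) t) :
    t ≤ 107 ∧ sigmaCount ((step M)^[t] (init 4 2)) ≤ 13 := by
  obtain ⟨n, rfl, hn⟩ := (haltsIn_iff hM).1 ht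
  obtain ⟨h1, h2⟩ := Tab.good_of_oneHalt h (tabOf_small M) n hn
  have := sigmaCount_of_haltsAt hM hn
  exact ⟨h1, by omega⟩

theorem values_of_good (h : ∀ T : Tab, T.Small → T.OneHalt → T.Good) :
    (∀ M : Machine 4 2, Valid M → ∀ t : ℕ, HaltsIn M (init 4 2) t →
        t ≤ 107 ∧ sigmaCount ((step M)^[t] (init 4 2)) ≤ 13) ∧
    (∃ M : Machine 4 2, Valid M ∧ HaltsIn M (init 4 2) 107) ∧
    (∃ M : Machine 4 2, Valid M ∧ ∃ t : ℕ, HaltsIn M (init 4 2) t ∧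
        sigmaCount ((step M)^[t] (init 4 2)) = 13) ∧
    bbS 4 2 = 107 ∧ bbSigma 4 2 = 13 := by
  have hb := fun M (hM : Valid M) t ht => good_of_valid h hM (t := t) ht
  have ht : HaltsIn champion (init 4 2) 107 :=
    (haltsIn_iff champion_valid).2 ⟨106, rfl, champion_haltsAt.1⟩
  have hs : sigmaCount ((step champion)^[107] (init 4 2)) = 13 := by
    have := sigmaCount_of_haltsAt champion_valid champion_haltsAt.1
    rw [champion_haltsAt.2] at this
    exact_mod_cast this
  refine ⟨hb, ⟨champion, champion_valid, ht⟩, ⟨champion, champion_valid, 107, ht, hs⟩, ?_, ?_⟩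
  · refine IsGreatest.csSup_eq ⟨⟨champion, champion_valid, ht⟩, ?_⟩
    rintro t ⟨M, hM, ht⟩
    exact (hb M hM t ht).1
  · refine IsGreatest.csSup_eq ⟨⟨champion, champion_valid, 107, ht, hs⟩, ?_⟩
    rintro _ ⟨M, hM, t, ht, rfl⟩
    exact (hb M hM t ht).2


def leftover0 : List Nat := [
  0x81de13ac06, 0x16806982d86, 0x1019e082d26, 0x80dc17ad06, 0x804ef029a6, 0x80dc162d06,
  0x4804d82c06, 0x12860f3ac06, 0x385ef82c06, 0x81de132c06, 0x16860f3a926, 0x1e057ac26,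
  0x81de17ac06, 0x804ef02c26, 0x1de182c06, 0x2c0e962d06, 0x49de182c06, 0x5c1e512d26, 0x800c11ada6,
  0x79de182c06, 0x800ed72926, 0x59de182c06, 0x81de152c06, 0x81de102c06, 0x13a5e182c06,
  0x81de142c06, 0x31de182c06, 0x2341217aca6, 0x14146562e06, 0xc1a13ad26, 0x24944c62e06,
  0x606051ad86, 0x3385e882c06, 0x800ed32926, 0x2804452ad86, 0x43c6d72e06, 0x18142f1ad06,
  0x27946c42e06, 0x8250f82e06, 0x80dc16ad06, 0x385cf82c06, 0x109de982c06, 0x60d2d3ae06,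
  0x29de182c06, 0x81de15ac06, 0x7860d1ad86, 0x13860e62c86, 0x3840f82c06, 0x7860d1a986,
  0x81de162c06, 0x2c0e962d26, 0x180c817ad06, 0x2c0e962dc6, 0xdc182da6, 0x81de11ac06, 0x10946d62e06,
  0x6060d1a986, 0x560dcd22e06, 0x40e0d1ac46, 0x385af82c06, 0x1828042ade6, 0x3848f82c06,
  0x69de182c06, 0x2c0e962c86, 0x3a40f82c06, 0x26146f4aa06, 0x2c0e962cc6, 0xc0cd3ad06, 0x8146102d86,
  0x954c6ae06, 0x3860d1a986, 0x48e0c72dc6, 0x3860f62c06, 0x41de182c06, 0x10c1a03ad26, 0x3860f42c06,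
  0x241c0d72e06, 0x2c0e962c26, 0x1404cd2ae06, 0x195cf62e06, 0x16146d62e06, 0x80dc12ad06,
  0x5801416aca6, 0x2c0e962c66, 0xc0ed7ac06, 0x1e017ac26, 0x2385e182c06, 0x3c1217ad46, 0x3c02972c86,
  0x81de14ac06, 0x2c0e962d46, 0x3860f3ac06, 0x6804d82c06, 0x19de182c06, 0x2c0e962d86, 0x384cf82c06,
  0x2815e13ac06, 0x14986c82d86, 0x1440e17ac26, 0x81de112c06, 0x2c0e962c46, 0x3860f02c06,
  0x3860f6ac06, 0xc0ad3ad86, 0x3860f52c06, 0x180d017ad06, 0x16146d72e06, 0x11c02542de6,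
  0xc08d3ad06, 0xc0ed52c86, 0x180d2162ca6, 0x2c00d6ace6, 0x560c6d22e06, 0x7860f1ad86, 0x316017ad06,
  0x16814c82ce6, 0x3850f82c06, 0x56146d3ae06, 0x6806c82d46, 0x3860f4ac06, 0x8404082d26,
  0x8160f22e06, 0x81de122c06, 0x180d017ac06, 0x824ef02c26, 0x9de182c06, 0x3846f82c06,
  0x10c1ac3ac06, 0x18242f1ad06, 0x8406542e06, 0xc0ed3ad86, 0x128d2d82c66, 0x384ef82c06,
  0x179da182c06, 0x10b60e22ca6, 0x81de502c06, 0x16146562e06, 0x800452ada6, 0x48a0d1ad86,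
  0x1c0254adc6, 0x141a13ad26, 0x2c0e962c06, 0x1804cd3a906, 0x3860f0ac06, 0x2c0e962da6,
  0x21de182c06, 0x8040c3a926, 0x3195c562e06, 0x20b60e3ac06, 0x2c00d42ce6, 0x81de16ac06,
  0x1800417ada6, 0x12892d82c66, 0x7020f62c26, 0x35c082ca6, 0x1540242ade6, 0x20b60e22c06,
  0x181c182da6, 0x1ded82c06, 0x3c1c142ca6, 0x3842f82c06, 0x35cf82ca6, 0x3852f82c06, 0x2c0e962de6,
  0x2c0e962ca6, 0x2c0016ace6, 0x21920f6ac86, 0x194cf62e06, 0x1805ac3a806, 0x2c0e962ce6,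
  0x3860f2ac06, 0x2c0e962d66, 0x804ef02ca6, 0x3860f1ac06, 0x3860f22c06, 0x5c0e17ac26, 0x946f62e06,
  0x10946562e06, 0x1dcd82d06, 0x380d0172ca6, 0x1825811ad46, 0x3860f5ac06, 0x804091ad86,
  0x81de10ac06, 0x2c0e162ce6, 0x16060d1ad06, 0x384af82c06, 0x3856f82c06, 0x3860f12c06,
  0x23860d7ac06, 0x1804ee62c06, 0x3860f7ac06, 0x2809017aca6, 0x143c6d52e06, 0x71de182c06,
  0x12360e12d86, 0x2820412ada6, 0x81de12ac06, 0x2c04d42ce6, 0x61de182c06, 0x51de182c06,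
  0x3860f32c06, 0x3844f82c06, 0x8406082d26, 0x14144f62e06, 0x3860f72c06, 0x800811ada6,
  0x1958f62e06, 0x13b60f0ac06, 0x619e082d26, 0x16ac0c828e6, 0x12346f42e06, 0x81de172c06,
  0x560ded22e06, 0x8240f3ac26, 0x240293ada6, 0x3854f82c06, 0x824ef02ca6, 0x18404542e06,
  0x4986c82c06, 0x1015c562e06, 0x11de182c06, 0x40d8d82d46, 0x39de182c06, 0x3858f82c06,
  0x17246082d86, 0x3960f02c06, 0x200de082d26]

def leftover1 : List Nat := [
  0x2c1811a4e6, 0x53b50f1a606, 0x19e0172506, 0x581d03525e6, 0xc1ab3a526, 0x538d0f52606,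
  0xc1a13a486, 0x1842011a486, 0x384ac72606, 0xc1e3425a6, 0x38c0c72606, 0x28a0c1a446, 0x120e0c6a546,
  0xae03425a6, 0x2540037a4e6, 0x141c6c82546, 0x3c0037a4e6, 0x40d4d825c6, 0x40e0d525c6,
  0x20c8c1a606, 0x3c0ab725c6, 0x28a0c1a546, 0x3c0ab725a6, 0x3c00f524e6, 0x82dc11a506, 0x4c003724e6,
  0x20e0d12466, 0x400e0c7a546, 0x3bd0172606, 0x3c00f524a6, 0x3c0ab725e6, 0x120a0d12466,
  0x40cad825c6, 0x40e0d3a5c6, 0x41e0d12406, 0x829e11a506, 0x3c0ab72426, 0x11bd0c3a606,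
  0x40e0d725c6, 0x3c0ab72586, 0x21c0037a4e6, 0x40d2d825c6, 0xc003425a6, 0xc0e3425a6, 0xc023425a6,
  0x3c0417a4a6, 0xaa03425a6, 0x40d0d825c6, 0x4c1a702566, 0x17020f4a026, 0x180de15a406,
  0x40c2d825c6, 0x526011a586, 0x720af02606, 0x40daf825e6, 0x15140f62606, 0x68e0172486,
  0x181d027a5a6, 0x1bd0c22606, 0x3c0a372426, 0xc063425a6, 0x2312011a5a6, 0xc1a73a526,
  0x209c8d72606, 0x805ea1a586, 0x4096d825e6, 0x3c0ab724e6, 0x3c0437a4a6, 0xc0a3425a6, 0x541e11a526,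
  0x40e0d225c6, 0x40ced825c6, 0x11b88d82546, 0x1c1237a4e6, 0x3c0a3724a6, 0x55b503825c6,
  0x5c02762526, 0x3c0ab72526, 0x141a13a526, 0x3c16172406, 0x2c183524e6, 0x11b92c3a606,
  0x4086d825e6, 0xc1a3425a6, 0x41a0d1a546, 0x40e0d5a5c6, 0x140d8d825c6, 0x3c02342586,
  0x582d03724e6, 0x62e037a426, 0x10c1ee3a406, 0x3c0ab72566, 0x40e0d625c6, 0x2c18f1a4e6,
  0xa60352586, 0x428c0c52606, 0x182c817a906, 0x12286d825c6, 0x40ded825c6, 0xc143425a6,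
  0x12048c1a606, 0x541237a4e6, 0x40c8d825c6, 0x399817a606, 0x79c8172606, 0x3c0017a4e6,
  0x821a31a526, 0x8290372526, 0x40e0d325c6, 0x182de16a806, 0x2c1831a4e6, 0x11b90c3a606,
  0x3c0ab72446, 0xc103425a6, 0x3c00f7a4e6, 0x4090d825e6, 0x3c04f7a4a6, 0x10c163425a6,
  0x140ccd825c6, 0xc183425a6, 0x4858f1a606, 0x3c0ab72546, 0x3c0ab724a6, 0x1341813a486,
  0x17200f824e6, 0x41e0d12526, 0x82de152406, 0x51a017a506, 0xc1c3425a6, 0x11c1c13a406,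
  0x538d0f1a606, 0x3c0ab72506, 0xc043425a6, 0x562e03725a6, 0x17a40e820e6, 0x8180d1a4e6,
  0xc1a13a526, 0x3c0ab72486, 0x40c0d825c6, 0x821a312526, 0x40dad825c6, 0x3c0ab72406, 0x3c0ab724c6,
  0xc123425a6, 0xc1a73a486, 0x5115a3825c6, 0x40e0d2a5c6, 0x2540837a426, 0x4402372526, 0xc1ab3a486,
  0x3c0ab72466, 0x9e03425a6, 0x40d6d825c6, 0x40dad825e6, 0x9d8d72606, 0xc083425a6, 0x40e0d6a5c6,
  0x4003724e6, 0x40c4d825c6, 0x1805ee3a006, 0x40c6d825c6, 0x1341813a526, 0x11bd2c3a606,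
  0xc0c3425a6, 0x40e0d7a5c6, 0x582903724e6, 0x40dcd825c6, 0x5829037a4e6, 0x578e0172486,
  0x5948e1a606, 0x48e0c725c6, 0x1440031a5a6, 0x5c0e37a426]

def leftover2 : List Nat := [
  0x1060d12d87, 0x48c0c7a206, 0x41cd02d67, 0x41cd72d67, 0x3040ed72ca7, 0x49e0f58406, 0x91a932e07,
  0x860d1ad87, 0x28a0d62066, 0x41cd42d67, 0x12be0d12066, 0x41cd52d67, 0x400cd6ae07, 0x143c4d22e07,
  0x241a038526, 0x26286d5ae07, 0x6086d82ce7, 0x1041a438566, 0x3c1e758426, 0xb5a932e07,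
  0x16804d82d87, 0x541271a1e6, 0x68a0d1ad87, 0x400cd82c07, 0x59e0f58406, 0x41cd12d67,
  0x26186d82cc7, 0x6086d82d27, 0x406c62ca7, 0xc0cc4ac07, 0x209e0d72d07, 0x81d8f58406,
  0x11a92762206, 0x81c6f58406, 0x48d0c7a206, 0x41cd7ad67, 0xdcd82d27, 0x16082d82c67, 0xc1ab38526,
  0x824ef02ca7, 0xc1a738526, 0x400cd82d07, 0x13c1ac58406, 0xc1a538526, 0x6086d82da7, 0xc1a138526,
  0x400cd72e07, 0x41e0f58406, 0x81d0f58406, 0x6086d82c87, 0x8042912d87, 0x12142e82d27,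
  0x400cd5ae07, 0x6086d02e07, 0x400cd4ae07, 0x400cd82d27, 0x6086d4ae07, 0x12b9b038546,
  0x4c00c32c67, 0x22d6d1a206, 0x400cd0ae07, 0x400cd82c27, 0x414cd1ae07, 0x6086d62e07, 0x81d4f58406,
  0x6086d82de7, 0x6086d82d07, 0x26186d82d87, 0x480cc6ae07, 0x69a0c1ad87, 0x26286d62e07,
  0x1414cd02e07, 0x618ed1ae07, 0x4182d7ae07, 0x480cd5ae07, 0x4c02d3adc7, 0xc1a038526, 0x4096d82de7,
  0x40696ac87, 0x3c1271a1e6, 0x241a738526, 0x40ed42c87, 0x141a138526, 0x53240f82d87, 0x400cd7ae07,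
  0x52bc4d62e07, 0x561c6d5a206, 0x41cd32d67, 0x13c1c958486, 0x4c0cc0ac07, 0x7242d32e07,
  0x51cad1a206, 0x60f72d87, 0x1404cd2ae07, 0x400cd52e07, 0x400cd82d47, 0x1322011a1a6,
  0x13c02972c87, 0x16086982da7, 0x33b20f58406, 0x1160f0ac87, 0x10812772206, 0xb20f12da7,
  0x6860d12d87, 0x2814ef58406, 0x6086d2ae07, 0x480cc2ae07, 0x1e0f58406, 0x81c0f58406, 0x61e0f58406,
  0x480cc32e07, 0x4c0ed1acc7, 0x51b60e22ca7, 0x18298538546, 0x13c1ee48406, 0x800ef505a6,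
  0x8160f22e07, 0x7242d7ae07, 0x50106d82d87, 0x140d6d82dc7, 0x79e0f58406, 0x960f1ad87,
  0x8060f82c07, 0x23860f58406, 0x41cd0ad67, 0x860d12d87, 0x16804c82d87, 0x5418538526, 0x41a538526,
  0x81dcf58406, 0x33e015a186, 0x3242d72e07, 0x28044932d87, 0x12c06902d87, 0x484cd5ae07,
  0x7242d72e07, 0x16182d82c67, 0x1060f6ac87, 0x41cd1ad67, 0x6086d7ae07, 0x40ccd82c07,
  0x26286d72e07, 0x9e0f58406, 0x81c2f58406, 0x1e0d1a0a6, 0x12944f62e07, 0x6186d82c67,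
  0x50114d82d27, 0x12058912e07, 0x400cd2ae07, 0x400cd82ca7, 0x1505b038566, 0x20354e82ca7,
  0x8a0d1ad87, 0x400cd3ae07, 0x181dac50406, 0x121c2d1a206, 0x6060c32da7, 0x400cd22e07,
  0x400cd82c87, 0x21e0f58406, 0x2316011a1a6, 0x400cd62e07, 0x6086d82c07, 0x1801ac38546,
  0x400cd82c67, 0x400cd12e07, 0x281de158406, 0x69e0f58406, 0x81daf58406, 0x41cd22d67, 0x8142f1ad07,
  0x8044912d87, 0x6086d82d47, 0x81c8f58406, 0x11e0f58406, 0x8044d3a006, 0x6086d82cc7,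
  0x14054c2ae07, 0x20e0d321e6, 0x49c4c82c87, 0x23860f50586, 0x400cd32e07, 0xc0ed42c87,
  0x160a0d4a066, 0x20e0d32066, 0x2c0cd02d27, 0x5060f22d87, 0x81def58406, 0x81cef58406,
  0x1241e758426, 0x18150e38546, 0x17860c12d87, 0x6286d1ae07, 0x12c12e38546, 0x400cd1ae07,
  0xba0d1ad87, 0x41cd2ad67, 0x41cd5ad67, 0x6086d32e07, 0x484cc2ae07, 0x241a538526, 0x26186d82dc7,
  0x804ef02ca7, 0x4c02d3ada7, 0x6086d72e07, 0x69a0d1ad87, 0x10c0ed52c87, 0x41cd4ad67, 0x6086d82d67,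
  0x41cd3ad67, 0x52c04d1ad87, 0x6086d82dc7, 0x29e0f58406, 0x81caf58406, 0x842011a0a6,
  0x13be0d50406, 0x60c32da7, 0x8e0d1ad87, 0x6086d82c47, 0x241a138526, 0x160e01720a6, 0x14148d12e07,
  0x26286d7ae07, 0x4980c82de7, 0x8240f3ac27, 0x6086d22e07, 0x5c00f38526, 0x40e0d585c6,
  0x22144d62e07, 0x18144e58586, 0x404cd5ae07, 0x41cd6ad67, 0x898952e07, 0x30404d4ac87,
  0x41cad1a206, 0x41d0d12e07, 0x804ee02ca7, 0x240d4d82dc7, 0x43c4d32e07, 0x31e0f58406,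
  0x81ccf58406, 0x406d6ac87, 0x6086d82c67, 0x41a932c27, 0x2c06c02d87, 0x400cd82d67, 0x1b60e02c87,
  0x6086d5ae07, 0x484cc32e07, 0x6086d82d87, 0x13c1e958406, 0x40e902da7, 0x27060f12d87,
  0x6086d82ca7, 0x26186d82ce7, 0x1808097ac87, 0x400cd82c47, 0x6894c82d07, 0x722011a1a6,
  0x17159038566, 0x182de158406, 0x181dc550506, 0x6854c2ae07, 0x81d2f58406, 0x6054c2ae07,
  0x6086d42e07, 0x30404d6ac87, 0x14948c12e07, 0x15418538566, 0x6060d72c67, 0x6086d6ae07,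
  0x13c1211a1e6, 0x6086d82c27, 0x39e0f58406, 0x6086d52e07, 0x5cd82d67, 0x1801a438546, 0xc1a93ad27,
  0x4167585a6, 0x11892762206, 0x485871a206, 0x26186d82d07, 0x400cd42e07, 0x26186d82de7,
  0x3c1e958426, 0x404cd3ae07, 0x2052d32e07, 0x51e0f58406, 0x41cd62d67, 0x26188d1ae07, 0x81c4f58406,
  0x279e0d58406, 0x13ba0d50486, 0x17860f12d87, 0x181de558406, 0x842011a086, 0x6086d0ae07,
  0x404cd42e07, 0x400cd02e07, 0x81d6f58406, 0x6086d3ae07, 0x19e0f58406, 0x6086d12e07, 0x6086d1ae07,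
  0xbe0d1ad87, 0x14902d32e07, 0x1041ac38566, 0x27860d12d87, 0x71e0f58406, 0x1952e82c07,
  0x26286d52e07]

def leftover3 : List Nat := [
  0x8004f129a7, 0x3c0097a987, 0x41c14acc7, 0x8042512d87, 0xc0a81ad87, 0x8a051ad87, 0x68a051ad87,
  0x8044d12987, 0x6060512d87, 0x2009e082d27, 0x48006d72887, 0x1060512d87, 0x1040613ada7,
  0x4c0293a9a7, 0x805cd12987, 0x10060d12987, 0x1440e07ac27, 0x2006c829a7, 0xb5c832e07,
  0x5058932a07, 0x3c1e15ac27, 0x8e051ad87, 0x8240d32867, 0x15060d12987, 0x23406142da7,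
  0x22c06102d87, 0x12202d32a07, 0x200c082da7, 0x8046d12987, 0x1201a812e07, 0x8240c32827,
  0x1400446ae07, 0x68a0562c67, 0x1142f62a07, 0x5c0e07ac27, 0x8146c02987, 0x3060512d87,
  0x384c182d87, 0x809a17ad07, 0x18144c4a807, 0x54009029a7, 0x6086562e07, 0x8056512d87, 0x860d12987,
  0x2440e152d87, 0x10404072c27, 0xdc182da7, 0x7060d12987, 0x805a512d87, 0x6060d12987, 0x9d8982947,
  0x400ed82907, 0x86051ad87, 0x540091a9a7, 0x7860d12987, 0x805ed12987, 0x1152f62a07, 0x24342f32a07,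
  0x80da812827, 0x6940f4aa07, 0x5860d12987, 0x540096a9a7, 0x18258112d47, 0x51c1e122ca7,
  0x30b60e02807, 0x3c0096a987, 0x809e142d07, 0x1240293a987, 0xc06042da7, 0x14410152d87,
  0x2c0281a987, 0xc02052da7, 0x36146f62a07, 0x54c18132ca7, 0x51809829a7, 0x4c1c13ada7,
  0x8402812a07, 0x441a11ade7, 0x560dc96aa07, 0x68e0562c67, 0x34029129c7, 0x810c06ad27,
  0x10060512d87, 0x1b60e228a7, 0x1040e072c27, 0x8054c3a907, 0x4060d12987, 0x8050d12987,
  0x3b20132da7, 0x5805af32907, 0x34009029a7, 0xb60032d87, 0x3c00932987, 0x4b60132da7,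
  0x4201cd82927, 0x3c0090a987, 0x24400152d87, 0x540092a9a7, 0x20c0091a987, 0x4860d12987,
  0x8052d12987, 0x6956c02a07, 0x3858f82807, 0x143a0112da7, 0x801a932827, 0x7860512d87,
  0x805c512d87, 0xb20e1a987, 0x6860512d87, 0x340092a9a7, 0x809e112d07, 0x16146f22a07, 0x8058512d87,
  0x58144d42867, 0x3bc0982987, 0x22c02952987, 0x4920132da7, 0x484c082d87, 0x40646ac87,
  0x824cd0a807, 0x3c00922987, 0xb58832e07, 0x15944f62a07, 0x805e512d87, 0x1060d12987, 0x1860512d87,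
  0x1825406aca7, 0x240e06ad27, 0x41c502d67, 0x860d1a987, 0x5c1e502d67, 0x14029728c7, 0x6a80182de7,
  0x8004d129a7, 0x8058912947, 0x60f72987, 0x51c09829a7, 0x6856d82807, 0x860512d87, 0x5c0407ac27,
  0x346c82987, 0x5c02952987, 0x5c0e17ac27, 0x809e152d07, 0x540093a9a7, 0x180c2172d07,
  0x15860112d87, 0x1860d12987, 0x5060512d87, 0x801e152d07, 0x4c0293a987, 0x805e512987,
  0x8002f1a907, 0x120a016ade7, 0x81d0172d07, 0x1c1e42ad67, 0x3c009529a7, 0x700c182d87,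
  0x801a932847, 0x2c0056ace7, 0x3c0095a987, 0x1805c112d07, 0x340e17ad27, 0x140297a807,
  0x10c0613ad87, 0xde982987, 0x120de962a07, 0x18144402d87, 0x5141e122ca7, 0x440e17ac27,
  0x54009329a7, 0x804c512d87, 0xb5c532a07, 0x6856f82807, 0x4a42c32a07, 0x7058932a07, 0x8042d12987,
  0xba051ad87, 0x8050c32907, 0x2856e6aa07, 0x561809829a7, 0x6860d12987, 0x825c112d07, 0x3840982987,
  0x960c1a987, 0x34ed32a07, 0x560dcd829a7, 0x3b80982987, 0x2609a982867, 0x820072da7, 0x341e122ca7,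
  0xb20112da7, 0xc0093a9a7, 0x814c062d27, 0x54009129a7, 0x1c0c162d07, 0x208d8932a07, 0x4c0213ada7,
  0x15860512d87, 0x3060d12987, 0x3c00972987, 0x560dcd82967, 0x585ee2aa07, 0x3c00952987,
  0x54009629a7, 0x2060512d87, 0x8040d12987, 0x6086182d87, 0x203c6d829a7, 0x4060512d87,
  0x1c1e52ad67, 0x805e112d07, 0x3c00962987, 0x1160f0a887, 0x3c00942987, 0x18088172d07,
  0x4ac2c32a07, 0x40809829c7, 0x18144502d87, 0x3c0091a987, 0x8056d12987, 0x20406142da7,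
  0x41a832c27, 0x6860012d87, 0x5c1e14acc7, 0x540097a9a7, 0x80da912827, 0xc1402ad87, 0x54009729a7,
  0xb60f1a987, 0x804ef32987, 0xb5a832e07, 0x56a44082d87, 0x540090a9a7, 0x54009529a7, 0x8144d42827,
  0x10086d82907, 0x10c46ae07, 0x346c82887, 0x15c10152da7, 0x2060d12987, 0x580cc17ad07,
  0x140c162d07, 0x26186182d87, 0x8052512d87, 0x1811c112d07, 0x582029129a7, 0x804cc4a807,
  0x3920132da7, 0x540095a9a7, 0x2609a982807, 0x3c1e162c27, 0x8002d72907, 0x18054512d87,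
  0x11258f7aa07, 0x3c00902987, 0x169a051ad87, 0x50409829a7, 0x28198112d07, 0x341217ad67,
  0x25c182da7, 0x8046512d87, 0xbe051ad87, 0x341217ad27, 0x6856c82807, 0xc029529a7, 0x1c02072d27,
  0x2801e112d07, 0x2860d12987, 0x815406ac87, 0x3860512d87, 0x54009229a7, 0x8142912987,
  0x21c1e502d67, 0x3c0093a987, 0x7060512d87, 0x3400972867, 0x8e0d1a987, 0x3c0092a987, 0x2004d82967,
  0x1440293a9a7, 0x5242c32a07, 0x4860512d87, 0x40e57ada7, 0x1815440ada7, 0x8050512d87, 0x40c162d07,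
  0x15060112d87, 0x805a912827, 0x805a812827, 0xc1051a987, 0x10ae051ad87, 0x51840f82907,
  0x8040512d87, 0x2c0096a867, 0x105af82807, 0x3c00912987, 0x3860d12987, 0x17860112d87, 0x40c16ad07,
  0x17060112d87, 0x804cd3a907, 0x33e0162c87, 0x18118152d27, 0x4c0415ad87, 0x6956d02a07,
  0x21dc082d27, 0x50b60d72807, 0x50b60e72807, 0x804e512d87, 0x10c56ae07, 0x120a056ade7,
  0x10346d82907, 0x801a83a827, 0x36144f4aa07, 0x18242f1a907, 0x21920f6a887, 0x50b60472c07,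
  0x6142972a07, 0x3c009629a7, 0x540094a9a7, 0x40e172c27, 0x7a44082d87, 0x8040832da7, 0x1540293a987,
  0x16a02d32a07, 0x89a982807, 0x8054c1a907, 0x160a0d1a907, 0x801a832827, 0x18404082d27,
  0x2860512d87, 0x6006c829a7, 0x3c0094a987, 0x120e016ade7, 0x8058812827, 0x34ee32a07, 0x801a93a827,
  0x40e11ada7, 0x8044512d87, 0x40811ada7, 0x10c1413ad87, 0x20c06142d87, 0x8250f82a07, 0x3c0097a827,
  0x1858932a07, 0x241e0112da7, 0x182c2812d87, 0x1c1e52acc7, 0x380c182d87, 0x1c009728a7,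
  0x6860f3a927, 0x1c1e42acc7, 0x4c10112de7, 0x54009429a7, 0x8054d12987]

def leftover4 : List Nat := [
  0xadb03a527, 0x28d8f52607, 0x80d027a467, 0x30d027a607, 0x5c1e0724c7, 0x50d027a607, 0x80d0e3a5e7,
  0x52bd8032607, 0x80d0e7a5c7, 0x280d0e7a547, 0x82d061a5e7, 0x18058f12487, 0x42da272607,
  0x5c1e06a4c7, 0x12090d825e7, 0x1c12f524e7, 0x182d02225e7, 0x1241221a5e7, 0x218d067a607,
  0x18058e12487, 0x3c12f1a5e7, 0x78d0d82547, 0xc1c05a4c7, 0x209b012467, 0x819061a5e7, 0x8412132607,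
  0x1c12f5a4c7, 0x100db01a4c7, 0x11bd8832607, 0x1bd0672607, 0x11bd8532607, 0x1c1277a547,
  0x1200c16aa07, 0x800ef525a7, 0x280d0e7a507, 0x280d0e025e7, 0x1c121525e7, 0x341e112507,
  0x829061a5e7, 0x1811a7125e7, 0x811a1125e7, 0x28db072467, 0x1158e82567, 0x14859012487,
  0x1950e82567, 0x819061a5c7, 0x205b012467, 0x8258112447, 0x409b00a467, 0xd027a607, 0x5c1e0024c7,
  0x40daa825e7, 0x220d067a607, 0x801061a5c7, 0x13258382547, 0x405b00a467, 0x280d0e1a547,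
  0x140d2c72607, 0x182c817a907, 0x505b03a487, 0x58090f7a407, 0x78d067a607, 0x21a5067a607,
  0x40d027a607, 0x5c1e03a4c7, 0x595e0824c7, 0x80d027a567, 0x28d027a607, 0x2098352607,
  0x11c12f52587, 0x71560825a7, 0x80d027a4a7, 0x17258382547, 0x80d0e3a5c7, 0x99b03a487,
  0x40dcd825c7, 0x80d027a4c7, 0x1111af72607, 0x340e05a587, 0x16059072507, 0x41c10a8a7,
  0x80d027a547, 0xadb03a487, 0x21950f32607, 0x3c12e1a5e7, 0x12859012487, 0x810e032587,
  0x5819e15a907, 0x41c16a927, 0x80d027a427, 0x505b03a527, 0x280d0e7a4e7, 0x5c1e00a4c7,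
  0x1c1277a4e7, 0x13859012487, 0x6092c72607, 0x13059012487, 0x68d903a4c7, 0x11059012487,
  0x230d067a607, 0x3c1e15a827, 0x2c1c152467, 0x80d027a407, 0x605d01a527, 0x238d901a547,
  0x48d027a607, 0x280d0e1a567, 0x18058b12487, 0x485907a467, 0x5a1a272607, 0x821061a5c7,
  0x1811a312447, 0x5c1e05a4c7, 0x5c1e07a4c7, 0x2141e15a887, 0x485b052467, 0x258d067a607,
  0x5c1e0524c7, 0x34f072527, 0x3c12f1a547, 0x5c1e0324c7, 0x20d027a607, 0x13d0c82587, 0x419b01a467,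
  0x1c12f7a4e7, 0x4850c12607, 0x240d067a607, 0x1811a3125e7, 0x17059012487, 0x80d061a5c7,
  0x34f0724a7, 0x80d061a5e7, 0x341c112507, 0xc1611a587, 0x42da372607, 0x1809a17a507, 0x48d907a467,
  0x8090f2a467, 0x485ab32607, 0x5c1c14a927, 0x560d2c72607, 0x540d807a607, 0xd907a527, 0x8d027a607,
  0x241211a5e7, 0x8056512587, 0x1b1067a607, 0x18118112547, 0x280d0e1a5c7, 0x51990f52607,
  0x2805027a467, 0x1814c262567, 0x80d0e3a547, 0x13859072527, 0x58090f52407, 0x12412f1a5e7,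
  0x60d027a607, 0x1810c36a547, 0x49db0025e7, 0x1bd0662607, 0x821a212567, 0x78d027a607,
  0x10c1061a587, 0x811061a5e7, 0x1239a382547, 0x609b01a567, 0x1811a712547, 0x5c1e502567,
  0x609835a607, 0x1014ed32607, 0x40d2d825c7, 0x8054d12587, 0x121d0d12607, 0x513d0c82467,
  0x181581124e7, 0x12059012487, 0x178d026a607, 0x1809017a547, 0x14059012487, 0x5809017a467,
  0x85b03a487, 0x20059012567, 0x281583124c7, 0x2141e12a907, 0x268d901a547, 0x825061a5e7,
  0x799c182407, 0x4096d825e7, 0x80d027a5c7, 0x280d0e7a567, 0x23c1e15a887, 0x49db002467,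
  0x1842015a807, 0x250d067a607, 0x40dab825e7, 0x82d061a5c7, 0x5c1e0624c7, 0x21db0125e7,
  0x5811a112507, 0x80d0e3a567, 0x16059012487, 0x818e07a527, 0x80d027a5e7, 0x1095cd32607,
  0x11158772607, 0x11158672607, 0x38d027a607, 0x405b01a467, 0x13d0c824a7, 0x22de36a607,
  0x5c1e02a4c7, 0x841035a607, 0x8410352607, 0x28db04a467, 0x11a18b12607, 0x825061a5c7,
  0x220da382547, 0x308d907a547, 0x241c112507, 0x21a5027a607, 0x2de3825a7, 0x40d8b7a607,
  0x80d027a4e7, 0x141e15a827, 0x40dad825e7, 0x60db0724c7, 0x1195027a607, 0x13c12f1a5c7,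
  0x80d027a507, 0x58090f5a407, 0x2844162a07, 0xdb01a487, 0x1c0c22a5e7, 0x484cd5a607, 0x821a202567,
  0x480cd5a607, 0x80d0e7a5e7, 0x5c1e14a4c7, 0x23a58382547, 0x20db012467, 0x5c1e04a4c7,
  0x1814c362547, 0x5c1e0124c7, 0x12412f1a547, 0x2195067a607, 0x5c1c14a527, 0x40d2e825e7,
  0x70d027a607, 0x19b03a4a7, 0x1c1217a587, 0x40d22825e7, 0x532601729a7, 0x18d027a607, 0x10d027a607,
  0x805061a5c7, 0x1821a2525e7, 0xc1601a587, 0x829061a5c7, 0x5715e082587, 0x3c1221a5e7,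
  0x1515e16a607, 0x1bd067a607, 0x34f072507, 0x102de7825a7, 0x14410152587, 0x80d027a527,
  0x19d067a607, 0x99b03a527, 0x841031a607, 0x1c1277a587, 0x40dae825e7, 0x1809017a507,
  0x12c1e322547, 0x54c0015a9a7, 0x11b98932607, 0x59dc082487, 0x1950e825c7, 0x4c1c13a5a7,
  0x80d027a447, 0x1029e3825a7, 0x1811a712447, 0x5c1e01a4c7, 0x805825a507, 0x15c101525a7,
  0x11c12f7a587, 0x409b01a467, 0x19b01a487, 0x1b50f825e7, 0x5b03a4a7, 0x821061a5e7, 0x1040e16a887,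
  0x8058312487, 0x17859012487, 0x541217a467, 0x80d027a5a7, 0x85b03a527, 0x4c0e15a987,
  0x1341e052527, 0x81d061a5e7, 0x80d027a587, 0x209b002467, 0x58d027a607, 0x50c12352587,
  0x68d027a607, 0x40daf825e7, 0x818e07a507, 0x15859012487, 0x584f07a427, 0x148d907a487,
  0x51850c72607, 0x585cf82407, 0x8052c7a467, 0x20059012487, 0x40d8a7a607, 0x11b98832607,
  0x1c0ef2a5c7, 0x21db012467, 0x224160125a7, 0x27a58382547, 0x1c1217a4e7, 0x280d0e1a5e7,
  0x2811a252427, 0x4c0615a987, 0x5c1e0424c7, 0x3c1211a5e7, 0x5c1e0224c7, 0x10859012487,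
  0x2805a332407, 0x140d6d825c7, 0xd901a487, 0x5805a032487, 0x715e402607, 0x16859012487, 0x9b01a4c7,
  0x15059012487, 0x1511e16a607, 0x2c1600a5a7, 0x11859012487, 0x28d906a467, 0x40dad825c7,
  0x560dc16aa07, 0x282d417a407, 0xb5ca32607, 0x591e0824c7, 0x160db072567, 0x341e5025a7,
  0x181d0172487, 0x13d0c82407, 0x3a50e1a607, 0x11bd8932607, 0x80d027a487, 0x585e0824c7]

def leftover5 : List Nat := [
  0x240d6d821c7, 0x18054d32127, 0x60c8f12607, 0x3c0ab72527, 0x94701a587, 0x3c0ab725e7,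
  0x3c02052587, 0x90701a587, 0x60c8c12607, 0x1c02072527, 0x82c4172507, 0x1388c3a607, 0x21a312207,
  0x38c8c12607, 0x80c8c124e7, 0xc06e425a7, 0x3402b72527, 0x1bc3072487, 0x1883072487, 0x3c0ab72507,
  0x1b03062527, 0xc0611a587, 0xac8c12607, 0x3c12f1a147, 0x3c0ab724a7, 0x824837a547, 0x224020525a7,
  0x815c15a067, 0x815e112187, 0x3a8307a507, 0x58002d32487, 0x582022325a7, 0x1805e0321a7,
  0x38db02a1c7, 0x82c8d12447, 0x181c8112587, 0x58288372447, 0x1805ad32127, 0x1b43062527,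
  0xc06f1a587, 0x70c8c12607, 0x1105b07a0a7, 0x1c02e72487, 0x8052c7a067, 0x10c06b425a7,
  0x1c0af2a5c7, 0x80c8c12527, 0x3406142587, 0x285b012067, 0x811e132127, 0x3402b724a7,
  0x1805ae12107, 0x1c02f72487, 0x505f06a1a7, 0x1ac8d12607, 0x285a332207, 0x82c8d124a7,
  0x48dac82147, 0x18088b7a4c7, 0x2809617a087, 0x1ac3072487, 0x150c8f3a607, 0x2820837a547,
  0x408ae825e7, 0x3c0a3724a7, 0x819a132127, 0x11bc3062527, 0x3c0ab72487, 0x148db07a087,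
  0x1701f04a027, 0x1a43062527, 0x21da352207, 0x2124817a607, 0x1c02272487, 0x1a43072487,
  0x48d83821e7, 0x1a83072487, 0x168c3072487, 0x11892c32207, 0x8052d32027, 0x80c8c12587,
  0x8046d52487, 0x80c8c12447, 0x120d2e72207, 0x8188d12467, 0x17882e2a607, 0x240a36a567,
  0x80c83225c7, 0x18c3072487, 0x1883062527, 0x382c22225c7, 0x56958352207, 0x840a132607,
  0x821a132127, 0x82c82725e7, 0x1983072487, 0x3088f42607, 0x1c121721e7, 0x10482825e7, 0xa070425a7,
  0x341217a167, 0x9c8d72607, 0x8088b7a547, 0x540a1125c7, 0x811a132127, 0xc0681a587, 0x4a18382167,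
  0x4c02f3a5a7, 0xac8d12607, 0x3c0477a4a7, 0x2843012587, 0x30c8c12607, 0x95f01a187, 0x1b43072487,
  0x182561321a7, 0x1828837a4c7, 0x1bc8c3a607, 0x1130817a607, 0x82c8d12427, 0x23c8d12607,
  0x1715825a207, 0x82cad124e7, 0x1828837a547, 0x2858352207, 0x8c8c12607, 0x80c8c12427,
  0x21248e7a607, 0x58102032587, 0x82c8d12547, 0x1c02672487, 0x98701a587, 0xc06d1a587, 0xc020525a7,
  0x19c3062527, 0x340a17a527, 0x3c0ab724c7, 0x80c8c12547, 0x58c8e3a607, 0x1ac3062527,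
  0x180c8d12427, 0x80cad124e7, 0xc069425a7, 0x325a13a207, 0xc0601a587, 0x3c0ab724e7, 0x12412f1a1e7,
  0x17882f2a607, 0x20c8c12607, 0x406d024c7, 0x4c0213a5a7, 0x42c8d12607, 0x181c8d12427,
  0x11c02f5a507, 0xc06e1a587, 0x7958352207, 0xc06c425a7, 0x3c0ab72587, 0x8298132127, 0x113c8d82547,
  0xc0641a587, 0x20d2e32207, 0xc06a425a7, 0x8258132027, 0x815a132047, 0x80c8c125c7, 0x809a132127,
  0x8148372547, 0x12412f1a147, 0x80d2d32027, 0x80c8d12487, 0x81041125a7, 0x1825a132147,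
  0x28048d12407, 0x278d2c32207, 0x26086d82567, 0x8052d32127, 0x80c8c12487, 0x1803062527,
  0x4c0203a5a7, 0x3c0af02547, 0x80c8c124c7, 0x180c81025c7, 0x3c0ab725a7, 0x182c8d125a7,
  0xc06f425a7, 0x181881125a7, 0x282822225e7, 0x1c02972507, 0xc0675a587, 0x19b01a087, 0x82d8132127,
  0x1a03062527, 0x570c30624a7, 0x11c02e5a487, 0x1828837a487, 0x31470025e7, 0xa8701a587,
  0x8d907a107, 0x1903062527, 0x3c0ab725c7, 0x82c8d12467, 0x101c8d72607, 0x3c0a372427, 0xc0631a587,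
  0x2828836a5e7, 0x794702a5c7, 0x8242b325a7, 0x9870425a7, 0xc066425a7, 0x1903072487, 0x829c132127,
  0x1105b07a147, 0x1c02c72487, 0x1041261a1a7, 0x9470425a7, 0xc065425a7, 0x1609b04a067,
  0x3c1271a1e7, 0xc0661a587, 0x22c8d12607, 0x162c8d12607, 0xc068425a7, 0x82c8d125c7, 0x805a132127,
  0x815a132027, 0xac701a587, 0x240263a5a7, 0x1b03072487, 0x82c8d12487, 0xc067425a7, 0x1c02662527,
  0x11c0ae02567, 0xc060425a7, 0x182c8d124c7, 0x540a26a467, 0x1c02572487, 0xc0621a587,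
  0x128d8e82167, 0x79c3072487, 0x82c8d12507, 0x182c222a587, 0x209c8172607, 0x408362567,
  0x250c8f32607, 0x1285b01a1c7, 0x6ac8d12607, 0x1c08f2a547, 0x5c0af0a487, 0x81c81125a7,
  0x1c02172487, 0x2805a732127, 0x1c02072487, 0x840301a487, 0x240203a5a7, 0x340a17a547,
  0x241271a1e7, 0xc1651a187, 0x3c0ab72547, 0x1815a112047, 0x1720af02607, 0x24c020525a7,
  0xc062425a7, 0x5402052587, 0x122d6d12207, 0x4ac8d12607, 0x1c02b72487, 0x5805eb12087, 0xc0685a587,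
  0x485b002067, 0x82c8d12527, 0x1983062527, 0x79c3062527, 0x6a58382147, 0x44083125a7, 0xc0691a587,
  0x20388f82507, 0x28058712127, 0x1a03072487, 0x18c3062527, 0x40af7a447, 0x1c1217a187,
  0x821c132127, 0x840303a4a7, 0x80c8c12567, 0x341217a127, 0x82c8d12407, 0x21c4c82567, 0x12c8d12607,
  0x3c0ab72427, 0x80c8c12467, 0xa4701a587, 0x28088362547, 0x5c02772487, 0x1204301a5c7, 0xc061425a7,
  0xc06c1a587, 0x62c4f824a7, 0x282081125c7, 0x3bc8d12607, 0x3c0ab72407, 0x16854c5a207,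
  0x182883025c7, 0x1c02972487, 0x40ab7a447, 0x1c02a72487, 0x20db0721c7, 0x8218132127, 0x140a16a5e7,
  0x82c2d32527, 0x7088f825e7, 0x80c8b72447, 0x803072527, 0x13c8c62607, 0x80c8c124a7, 0x58002d325a7,
  0x1b88c3a607, 0x40d2e821e7, 0x1c02d72487, 0x82541321a7, 0x5b48f12607, 0x825a1321a7, 0x48d8382167,
  0x4c0263a5a7, 0xc8c12607, 0x1c1217a0e7, 0x2811a15a047, 0x4c0a26a467, 0x1803072487, 0x148d8d82047,
  0x8070525a7, 0x81081125a7, 0x1b83072487, 0x2ac8d12607, 0x608ac72607, 0x182c82225e7, 0x8118132127,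
  0x52c02362447, 0x182c834a5c7, 0x18288112587, 0x4c02d1a4c7, 0x82c8d12587, 0x398307a487,
  0x18008372547, 0x5408312587, 0x82dc132127, 0x1725e502207, 0x1c02372487, 0x80c8d124e7,
  0x1843072487, 0x3c0ab72567, 0x5948e12607, 0x2c023325a7, 0xc06d425a7, 0x82c8d124e7, 0x8218132027,
  0x541271a1e7, 0x8054c521a7, 0x82c82725a7, 0x1141217a0a7, 0x181c8d12407, 0x79470225c7,
  0x3c0ab72447, 0x6a42f32607, 0x18052d32167, 0x28da382147, 0x4408312587, 0xc0651a587, 0x9070425a7,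
  0x181c8d12587, 0x6ac8f12607, 0xc06a1a587, 0x182c82025e7, 0x80c8d12467, 0x181c8d125a7,
  0x1c02d62527, 0x1a83062527, 0x3815815a047, 0x101c8172607, 0xc0671a587, 0x81da132127,
  0x1843062527, 0x21408f6a4c7, 0x32c8d12607, 0x42da112207, 0x1943062527, 0x80c8c12407,
  0x80c8c125e7, 0x82c8d12567, 0x8118132027, 0x1c02c62527, 0x8156112187, 0x1c02872487, 0x803072487,
  0xc06b1a587, 0x405a332207, 0x3ac8d12607, 0x8054d321a7, 0x1943072487, 0x161c8172607, 0x1b83062527,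
  0x18408132607, 0x80c8112587, 0x3c12f1a1e7, 0xc064425a7, 0xa0707a587, 0x825a132127, 0x80c8c12507,
  0x821a132027, 0x3c12f12167, 0x80cac124e7, 0x7ac8d12607, 0x3092c7a207, 0x1c0816a447, 0x1a43072587,
  0x30c8f42607, 0x28248372547, 0x825a132027, 0x4c023325a7, 0x30d2c72207, 0x80c8c125a7,
  0x1819a17a087, 0x259470025e7, 0xc063425a7, 0x1c02472487, 0x811a132027, 0x815a132127,
  0x4918382167, 0x180c8b72407, 0x804ab12587, 0x68c8c12607, 0x82c8d125e7, 0x2140222a5e7,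
  0xa0701a587, 0x141217a147, 0x58002b325a7, 0x2c8d12607, 0x27102f2a607, 0x5c0ae0a487, 0x3c0ab72467,
  0x5315cb1a207, 0x4998382167, 0x8158132027, 0xa470425a7, 0x82c8272587, 0x1883062487,
  0x269c8172607, 0x18158112127, 0x28c8c12607, 0x18048d12427, 0x78c8c12607, 0x82c8272427,
  0x1c02772487, 0x140d2c72207, 0x40d2d821c7, 0x18088d12427, 0x19c3072487, 0x72c8d12607,
  0x182883225e7]

def leftover6 : List Nat := [
  0x70c3072087, 0x180427321a7, 0x82cad12047, 0x18c3072087, 0x18258349547, 0xb1f019507,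
  0x14c0a26a067, 0x82481321a7, 0x1804ad32027, 0x17200f49607, 0x313e0c414c7, 0x80cac12027,
  0x11c003495c7, 0x18048d32027, 0x17060d11507, 0x1804cd32127, 0x108c30720a7, 0x1c002495c7,
  0x58c3072087, 0x180c0c491c7, 0x8050d32127, 0x4182d7a207, 0x50c3072087, 0x4c187595a7, 0xc029515a7,
  0x124ae821e7, 0x8050d321a7, 0x824a1321a7, 0x4c18759587, 0x16a18259607, 0x13e0c415c7, 0x41cd19567,
  0xc18759587, 0x1840a352207, 0x68c3072087, 0x4c18759427, 0x60c3072087, 0x35d059527, 0x7142e52207,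
  0x441a159467, 0x484cd59207, 0x82de151407, 0x82cc1720a7, 0x160c30720a7, 0x4c187595e7,
  0x80c2572087, 0xb43072127, 0x441a359467, 0x10060c11527, 0x80dae414c7, 0x484cc1a207, 0x4c187594a7,
  0x13e0c415a7, 0x4bc303a1a7, 0x182421321a7, 0x4342272207, 0x608a27a207, 0x484cd5a207,
  0x2c1a349467, 0x484cd3a207, 0x80c2972087, 0x80cad12027, 0x5c02952187, 0x78c3072087,
  0x181d8349147, 0x36086d59207, 0x5c1c149527, 0x5339e141607, 0x4c18309567, 0x2808a172107,
  0x5341e159127, 0x340251a1c7, 0x4c187595c7, 0x282501321a7, 0xc16c19507, 0x8050d32027,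
  0x14a82d32207, 0x10c3072087, 0x18258349147, 0x4c18759527, 0x2402b6a047, 0x30c3072087,
  0x10c18359507, 0x41a349467, 0x508af82147, 0x605d019527, 0x180cad32027, 0x48c3072087,
  0x101f059427, 0x1804ad32127, 0x5c1e149427, 0x804c1321a7, 0x82dc119507, 0x805a751587,
  0x242ca27a207, 0x80c2d72087, 0x580c0b415c7, 0x4c18759467, 0x13400f495a7, 0x440235a187,
  0x5c0a34a1c7, 0x5c02951587, 0x40a31a1a7, 0x800a3121a7, 0x804a1321a7, 0x804ad12027, 0x80cac12127,
  0x381f059427, 0x818a17a107, 0x41a249467, 0x151c0f49207, 0x805a651587, 0x40c3072087, 0x484cd59607,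
  0x804a312187, 0xb0af12207, 0x20c3072087, 0x80481321a7, 0x49c2d32207, 0x4c18759447, 0x804ec511a7,
  0x18258351547, 0x41db019507, 0xc029521a7, 0x13e0c415e7, 0x4c187594e7, 0x8054c511a7, 0x4c187594c7,
  0x385f059427, 0x8202352187, 0x33cad12207, 0x80cac12047, 0x404cd59607, 0x1609a359607,
  0x180ca172047, 0x180c8d32027, 0x15200f49207, 0xca372207, 0x484303a1a7, 0x38c3072087,
  0x180ca1021c7, 0x80c2c72087, 0x18048d32127, 0x1824c1321a7, 0x8258241567, 0x818a17a147,
  0x1441a359487, 0x15240f49207, 0x80d0d32027, 0x41e0d11527, 0x8c3072087, 0x4c18759507, 0xc3072087,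
  0x4c18759487, 0x80421321a7, 0x3418349467, 0x4c18759567, 0x182803415e7, 0x104af821e7,
  0x28c3072087, 0x840a25a207, 0x840a252207, 0x4c18759407, 0x2428a37a207, 0x804cc511a7,
  0x614301a1c7, 0x40c307a187, 0x804ef511a7, 0x13e0c41587, 0x8054f590a7, 0x6060d11507,
  0x1408a27a207, 0x840301a087, 0x3104ac72207, 0x4c18759547, 0x81c2f52087, 0x21418b09507,
  0x5020f491a7, 0x180c0d415c7, 0x15c1e1494c7, 0x8403019507, 0x282427321a7]

def leftover7 : List Nat := [
  0x1341e248027, 0x1c08770527, 0x380b078547, 0x182dc438507, 0x6860d30127, 0x4c18418567,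
  0x11400f50487, 0x10df058427, 0x18258378547, 0x1825a730127, 0x821a250427, 0x182dc5404c7,
  0x16258380547, 0x11410f50487, 0x11418f50487, 0x5c1c2484a7, 0x441c358027, 0x3c16e48487,
  0x18258310547, 0x7060d30127, 0x2805a730127, 0x381f058427, 0x3c0a878547, 0x10a58380547,
  0x805ad30127, 0x8420410507, 0x3c0a578547, 0x4b98380567, 0x39df058427, 0x5c1c1484a7, 0x4c1a3484c7,
  0x111e0470527, 0x209e0d30127, 0x5400178527, 0xc1a138527, 0x11402f50487, 0x7860d30127,
  0x11260f50487, 0x11412f50487, 0x11406f50487, 0x18258360547, 0x241a138527, 0x3c1e158027,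
  0x159e0470527, 0x13ba0d50487, 0x78d2f80507, 0x5060d30127, 0x11408f50487, 0x1805ee30107,
  0x18258368547, 0x180c8c70127, 0x3c0a478547, 0x41df058427, 0x11414f50487, 0x440a370547,
  0x171e0470527, 0x141e358027, 0x2a58380547, 0x18258328547, 0x1140cf50487, 0x18058350507,
  0x5c08770527, 0x13a58380547, 0x140eb78507, 0x8044d30127, 0x11258380547, 0x10b20f10107,
  0x3c1e758027, 0x41a3484c7, 0x41a138527, 0x3c0af78547, 0x2860d30127, 0x1819ee40027, 0x11df058427,
  0x18420250487, 0x10c18b10527, 0x4c0eb70507, 0x3860d30127, 0x4ad8380567, 0x1805a330127,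
  0x4c0cd58027, 0x10c18b10127, 0x1825a341047, 0x8182d78107, 0x341e358027, 0x4a58380547,
  0x10b20f10507, 0x7120570527, 0x28258250427, 0x80d0278507, 0x5c1c148527, 0x26860f30127,
  0x38df058427, 0x4c18718567, 0x141e158027, 0x30ba0d30127, 0x158c0e80527, 0x141a138127,
  0xc1ab38127, 0x3a8b078547, 0x3c0a778547, 0x27220570527, 0x13258380547, 0x78d2e80507,
  0x10c1ac30167, 0x2060d30127, 0x16920d10507, 0x8040d30127, 0x14258380547, 0x280d0e78507,
  0x8052d30127, 0x3c0aa78547, 0x6060d30127, 0x60d30127, 0x16a58380547, 0x13c1c958487,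
  0x182dc5404e7, 0x5860d30127, 0x5258380547, 0x18258350547, 0x4a58380567, 0x8054d30127,
  0x3c0ae78547, 0xc1a138127, 0x4c18309167, 0xc16c504a7, 0x18258348547, 0x10c1ee30127, 0x141e758027,
  0x11a58380547, 0x18258318547, 0x4c1a700567, 0x4a98380567, 0x149d8380567, 0x280c2d30127,
  0x8046d30127, 0x11220f50487, 0x18258330547, 0x3c0ac78547, 0x7060f28527, 0x1141ef50487,
  0x828e178507, 0x1860d30127, 0x829e438507, 0x805cd30127, 0x11416f50487, 0x3809e150507,
  0x804ad30127, 0x101f058427, 0x3c0a978547, 0x3060d30127, 0x10b60f30107, 0x11404f50487,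
  0x3c0a378547, 0x3c12178547, 0x1141af50487, 0x1809a178507, 0x3a5f058427, 0x18258370547,
  0x141e658027, 0x213d9040487, 0x82dc540547, 0x18258340547, 0x5160f60127, 0x18258308547,
  0x3c1e958027, 0x4c18758567, 0x17a58380547, 0x6258280567, 0x8420430527, 0x3c1e658027,
  0x8420410527, 0x17258380547, 0x8420130527, 0x8050d30127, 0x3c1e358027, 0x8042d30127,
  0x1140ef50487, 0x3c0e678507, 0x8420258487, 0x6898380567, 0x22258380547, 0x82dc540507,
  0x805ed30127, 0x8420530507, 0x10258380547, 0x8420430507, 0x8420130507, 0x1821a300547,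
  0x14c1a410567, 0x1141cf50487, 0x804ed30127, 0x3acb078547, 0x18258341147, 0x18098150507,
  0x3c0ad78547, 0x4060d30127, 0x10c1ab30127, 0x209e0d70107, 0x3c0a178547, 0x241e758027,
  0x3c0a078547, 0x84070404a7, 0x860d30127, 0x5a58380547, 0x18258358547, 0x15c1e248487,
  0x4860d30127, 0x11160f50487, 0x1140af50487, 0x18088178507, 0x18258320547, 0x141a138527,
  0x18090178507, 0x2828e470507, 0x1829e5404c7, 0x4bd8380567, 0x18058350107, 0x1341ee48027,
  0x82dc540427, 0x3c0a278547, 0x8048d30127, 0x1819c550507, 0x51120d10507, 0x3c0ab78547,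
  0x804cd30127, 0x181dc550507, 0x3c0eb78507, 0x16a98380567, 0xc1ab38527, 0x416d50427, 0x3c0a678547,
  0x1360f50487, 0x8420530527, 0x82dc540567, 0x7160f60527, 0x3412178127, 0x18258300547,
  0x18258338547, 0x2540e570507, 0x8056d30127, 0x1060d30127, 0x8058d30127]

def automataSmall : Aut := ⟨
  [[
  0x3ffffffffffffffffffffffffffffffffffffffffffffffffffffffffffffffffffffffffffffffffffffffffffffffffffffffffffffffffffffffffffffffffffffffffffffffffffffffffffffffffffffffffffffffffffffffffffffffffffffffffffffffffffffffffffffffffffffffffffffffffffffffffffffffffffffffffffffffffffffffffffffffffffffffffffffffffffffffffffffffffffffffffffffffffffffffffffffffffffffffffffffffffffffffffffffffffffffffffffffffffff,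
  0, 0, 0],
  [
  0x44c12a0855dcc211f98097db254a76e176265292848b6b01e665b9360beca8bca920277232346f42213eb15ac2726d3592baaae9b1ec69398bc64ffb324fbd35bb00a1fbad6047c10b3237139730f52fff67effdeff0a5fdebe7d9ffde757a0fe6cffecfdd88e8df79b9bc44718064a203621211104a030922025d8accf7e18820006f38620d672c138ff9727f52e9ffe7f3ffbddc5de5096e3feee9267f7f864eefbfb76bbe113ae75b1a15465dc4f0880b1de893bffffdffbfffbf7b77d7ffffbffaffffdefedfff,
  0x280000060020000800000000000000000000000000000000000000000000000000000080084000041000020000000000000000000000000040000000000040000000000000000000000000000001080000000000000000000000000001000000001000000000000000000000020000000000002000000000001000000000080008500000000000010000000000000000000000000000000001401000080000000000000804000000000000000000000040000000000000000000000000000000000000000000000000,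
  0x3933e55f1aa033de6067f6024dab5891e89d9ad65732494ee199a46c9f413574356dfd80dc58990b9cec144a53d8d92ca6d4555124e0396863439b0048db002ca44ff5e04529fb83ef4cdc8ec688c00500098000210025a0204102600008a8140182001000277150006460331805e81553c1dcdccafa17cb6dde5a2713308062517af90c79dd088d2e410068580ad06001804004222a01af690800016c1008079a11040409041eec518a4c4eaa9a01a0f36f4e2176c4000020040004080882000004005000021012000,
  0x80000000000000000800000000000000000808500010000000000000000000000000000200000000080000000000000000040010004000000000400000000000000000000000000000000042028000001000000d000010080000200004b001000030200002208000408a0c211a08c0802002401480400008000400001052c0000000002210000860000800001000000800000102000000000100108000001000000000000000000021001002210001000000000000000000000004000800000000000000000000],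
  [
  0x37d7af60f41d764dfd88ffdd6f7f77fb1efe7bfbf7e77e6d43fd6ff7bef7fbfcf33fff7fe7dbd7efafeff7d6fb9dfd7f2ffff6fbffefffff9feeffdff9d3bfffefffffddf9fbfefb9dfef7ddfffffff7bfffdbfffffffffdffbffbfffff7fdffff6ffffdfbefeffffbebe39f8e9f8e6dfd9f3deefeffffbefb3fb3ffff97fd7edffb4dffbfff9fcdbff7fffffffbefff3f7fffbfff5fffdfffffecefebeeb7fbfffff7efeff7fdffeffbff7ffff7ffffbfff75fdefffffffffdffef77fffffffffffe9fdffffffffff,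
  0x4800000e0120000000000002000000000000800008080000800000080000000108000080082020101000002900400000c0000800001000006001000000240000100000020200000442000020000000084000000000000000004004000000020000000000040000000414000010000110022042100100000000c044000020028000000000000020124000000000040000808000000020000000000200140048040000000000080000100400800000000000008002000000000000000000000000000004020000000000,
  0x108040000000000000000000000000000000000000000000000000000000000000000000000000000000000000000000000000000000000000000000000000000000000000000000000000000000000000000000000000000000000000000000000000100000000000000000000000000000000400000000000000000000000000000000000000000000200000000000000000000000000000000000000010800000000000000000000000000,
  0x3802850910ac289b20277002090808804e1010404001081923c0290004000000204c00000100408004010080004220280100001040000000000100020060840000000002004040100200108020000000000002400000000020000000000080000009000020010100000001c6061607082004080010000004104000800004800002004b200400040200008000000001000000000400080002000001110001100000000081010000000000000000008000040000a00100000000020000080000000000012000000000000],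
  [
  0x6fd5af6e757ef65dfd88ffdb6f7f77fb76ef5afbcfdf7a55f7f5ffbfebefaffcfbb5e7f62efe67e7f12ebfdbeb57ed77cfbeaaffbbff6bfbebefcfdf726fbdb5bf88eddbf9e4fef5dbb7fff3df7ffffffff7fffffffdaffffffffffffff7ffffffcffffffdffefffffffffb7ffbbfefdbfff3ffffeffffffffbfffffffb7ffbfcffbeffffffffffffffff9f27fd6fdffeff7fffdddffe5096f7fefff3eff7f8e5eefffbf6fffffffffff7fb7fffffffbbffffdffffffffffffffffff7f7fdfffffffffffffffffffff,
  0x3802850910a8009a202770020908088048100000000000000000000000000400204400000000000000000000000001280000000000000800000000000040000000010000400000000000000000000000000000000000000000000000000000000001000000000100000000008004001004000000001000000004000000008004000001000000000000000000000000000000800000000008400000000000000000000000000000000000000000000000000000200000000000000000000000000000000000000000000,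
  0x100200008001000000000004000000000810a504302085aa080a004014101001000a1809d10198180ed1402414a800083041550044001404141030208990424a40671220061b010a2448000c2080000000080000000250000000000000080000002000000200000000000000000400000000c000000000000000000000000000100400000000000000000605802902001000000222001a7290801000c1008071a110004090000000000080480000000440000000000000000000000080802000000000000000000000,
  0x40000000020000000000000000000000000040000020000000000000000000000800000000000000000000000000000000000000000000000000000000000000000000000000000000000000000000000000000000000000000000000000]],
  [[
  0x800020000080000000400002000000000000000020004000000000000000000000200000000000000000000000020002200000000000000400000001000000000002001001040000000800020000000000000000000008220100200000004000000080000000000000000002000000000000000000000000000000,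
  0x3ffffffffffffffffffffffffffffffffffffffffffffffffffffffffffffffffffffffffffffffffffffffffffffffffffffffffffffffffffffffffffffffffffffffffffffffffffffffffffff7fffdfffff7fffffffbffffdffffffffffffffffdfffbfffffffffffffffffffffdffffffffffffffffffffffffdfffddffffffffffffffbfffffffefffffffffffdffeffefbfffffff7fffdfffffffffffffffffffff7ddfeffdfffffffbfffffff7ffffffffffffffffffdffffffffffffffffffffffffffffff,
  0, 0],
  [
  0x3977e55f1da1b3da6867f6220dae58b1e89fd2ff7e705dee6093a67b9a223c5e7f27f441e4489007bc848d4a5ad9c82e66d1651197f4377ae9e39f10c100286108fcf6e409180b87ef0af0ee0ba81c814250c40887220284f0817746a401da00c8c002100c15d1c1806022311801a80752c190dc48ce16ca6d1142263b30a242d07ab10df1dd48850c4910080400000020c1409042001000810024400000430000000406018677984381418b248d01c65b415e1d7a481074205437c51a99023a12a7b09a17501816a94,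
  0x120002000004101808015000040200000800010200008108400405410100004803a0181109000068100401201111900610400000080000000000089d1084a4030901c281f00000540800d4008000200110201000052800400000400a0000020010000000041001065002400c00000110490080200011826a180080480420000048800a208038a1100060580af06041100004202a01ad682800013e1008079a11500008000000800008008200000020000060000049000000000040008000000040000002e00000a,
  0x68808a0e05e4c21878001dca250a34c17602500808da2111e641980609cc2818090081e03a666f0431362b1a40626c009288aae680bc085161c60ef3662c7125300001a3046047810a103112057237a9da62bd748ddf8530f3e88b91bf405ef343dedeff3ea2a2e7e998dcca7f217e8ac2e22233701e9241080a5d84487599d2e8506720402374250a6ef97a3f50f9f9e2ebf6b9dd5ee5216d7dbbec1efb4f865eeabf9f67980032c74b2305160fe190490a1828133a68bdfabc83aa5667dc5ed580f65e8ad07e9561,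
  0x100000000000000000000000000000000002000000000000000080000000000000000000000000000000000000000000000080000000004200000000004000000400400080000200000000000000000002010010200000000000000000000000040100000040000100000000400010000000001000000000000000200000000000000000000000000000000000000000000000000000000000864100a044408120020802e00000484000000000000000000000000000000000000000],
  [
  0x3a6fdf5f17e5cbfbfcffffff9fbfdeff7f5ec1adbcf975b54e574e5bbabab87e4ff35663614da096380189f50eb76c9775fb6a85d3bd363ebab284b2d566bedb0bf80ed7abf80bbf191a2b7c39f25d876fff56fbffe70a9fda9d7f97f6f376b0df6cf75ced1e8cddd7abf62bf99eb9b7dcbbfb6e485eeebeee6dfef1ffd8a7dffc1fcf9de26afff3f39d3f9da6fd2bd7ec7bbafa5c0ff65096b5675e938bd7f825eef36be1e26957be6f35e11c57b66fac2eb1ff8ebffdfffffffffffff76dff7ffffeffdffdfffffff,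
  0x400000000000004020000000000000000201002000400000100000004000201200c08100020006846126200200000080000800228000001000c604c20000100500000001006404000a1140100052028900001000000d000252080680000894f001208231280722208500800004140400204048027a011410190010a00015020016030401195000c04624002010004081280050581900802004010216060000080000810061816a84190c20e60a8099001d14e007040000000000000000090008000000000000000000,
  0x800000e01a2000000000002000000000000400000082000000010000040000800000080082420001000008800000000800000000000000040008000000400000000000000000000000008000000000000000000000000000020000080000000001008000410100200001c40620060820400001100100001000000000260000028000200400000000008000000000000000000000000000000200800000000040000000000080000000001001004000000000000100000000000000000000000000010020000000000,
  0x11020a008001400010000004040210080812a504302084ab0a8b0a4414145801000a1849e101d0180ec140251489360820415780442c9c0414113010a990024a407f1284401b400e644c002c60882500000a8040018256000400000010c000020800000002000000004001000000000010000108000000000020004000008000000000208000000080000605802d02001044000226001ad690888000c1428071a110484180500000000080082000000520000000000020000000000000802000000000000020000000],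
  [
  0x7ed7a56ef57db64ded88ffdb6b7d67fb3efd7fffefeffeeed97ee5bbefeffdfdfbbfffbecffbb77fff6ef7ffffdedb7feffffd7bffd3f7ffffffffcf9f7fbf77fff7ff5fb9eebefbfffbb7fdbffbdabfff7d5fbdfe7dfbffffffffffcf7dfefff7cffffffdefffffffffb237f69a87752f7f1ffcffeb7fbeffd7fffbffbf6fed0ffbdddfbfddafdf77b7fff37fd7efffffb7fffffbfdfffffff7feffffbdffbfefffb7feefaf7bbeff5f3bb77ed7fdf7bd1ff5ffa7bfdfffffdfffff7fffffffffffedffffdfffffff,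
  0x3802852910a8249b20277002094829804c100800000000000008000000000020204400000000000800000000000012080000000800028000000000000600000800008000040000004000408004004210000002042010000000000000030020100000000000010000000004dc80945680ad080a003001480010008000400401012e004020040225000884000000000000000480000000200000008000000020000100040011050844100a044008128020802e00a00480000000020000080000000000002000000000000,
  0x1000000000000001000000400000000000000000010011026011204101000000000004130044800009108000020040010000004000000000000003000004008000000a004104100000000020000040000028000008004000000000000000000081000000000000000000000002010800000000000000040000000000000800000002000000000200008000c80001000000000000400000000000100004000400000080000000000000080080000000040000000100000000000000000000000000010000000000000,
  0x8000000000000000000000000000002000010000001000008400000000000000000000000000000000000000000000002000004080000000000008000000000000002010000000040000000004000800000000200000000000000800000002000000200000000000000000000000000400000000000002000000000000010000020000000000000000000280000000000000000000000000000000000000000000000000000000000400000000000000000004020000000000000000000000000000020000000]],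
  [[
  0x3ffffffffffffffffffffffffffffffffffffffffffffffffffffffffffffffffffffffffffffffffffffffffffffffffffffffffffffffffffffffffffffffffffffffffffffffffffffffffffffffffffffffffffffffffffffffffffffffffffffffffffffffffffffffffffffffffffffffffffffffffffffffffffffffffffffffffffffffffffffffffffffffffffffffffffffffffffffffffffffffffffffffffffffffffffffffffffffffffffffffffffffffffffffffffffffffffffffffffffffffffff,
  0, 0, 0],
  [
  0x3eabcd5ff0f6cffae6e7f7faebfafbfd7b7f5a61ebcbbdfbbfe2ba17a5db2d4a76de940b65c6cedb7d09897bd7d66eace77968bd81adb4bc7e339e93d0face53a3784657256a5b3bdf2a735ea1f013d38805ac45081935e22821028080780e240b68d92030e32b4c009c824285240e5024e66c323430812440870c190ca488bc81854b3684100042520240203e02c5021944c02c01ca0002081ec13101cfb8804a0aa081d0014023ad657222126536595410b92280380220205116c482e1800492acb0da03000406800,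
  0x50201500000010004102400050008000000008108480800000000000000000000000000000000000000000000000000000000000000000000000000000000000000000000000000000000000020000000000000000000000000400000000000000400000000000000000000000000000000000000000000,
  0x15412000f09300511180805140504028480a59e14344204400d45e81224d29589216ba49a19310080e41484082981531886174076404b4001400128080510a40c07b9a8ca85a48420548c805a0fac2c77fa039ac2e6c81dc7debc7d1e8701cb749726dfc70c10337f4175bc52db71afcb1813c1838578531b7883c6f14a77017e7034c05ba7f7bdadfdbfdfc1fd3abde6bb3fd3fe35fffdf7e13ecefe30457fb5f55f7e2efeb79842900899e5888186294146957b47fdcfdfaee83b651e7ff36d534f25ecfffbf97ff,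
  0x20a000000000080000000000000000000000000000000010000048000020000000500020002402126200200010000000800208120003808c604427002108508000001010004000810021040040000000000020000200000000002100a010000000000000400000220801280080001001800c484a0688a400702002110042000a8009204808000000000000000040000000000000000000000000000000000000000001000844100a85400812482082ae00080480001000000100180000080000000010000000000],
  [
  0x3fffff7ffffffffffffffffbfffddfdf7fff72fb698fbdfb8ffa7b97eddbe9eb7ecea9deffb65ffdf7ffff3bfd4eb6fbaf2dfffeff7fcbf7dffd7fffbfffeffff7f7fbff7c75f47df7f79ff3fdf47effaa4dbb793a3bf5ee6984b0e8637d247f6bfbdba326663f6f28eee5fffff7beffffff96bfffdfdfeeffffffb576f7fffb7effbbff7def6b5fffffd06afb02d56a2f1dc5bde1fa39a5e85cb5714dff9d87db1becd3cfdfbffefefebef9fffafffbdfffe7f7ffd40904004135d19af8122a12a6917a27021c12a84,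
  0x208000040082400204200080000024020080010001000900000000000000000100000200000000040000000000000010000000000002020000000020000209800004100400800002000060000080000b00000000001088000000010a000008400000000000000000000000004800080000000000000010000000000000040020001040000002000008010000000200000000000004000000000100400200010000000008000008505000100000400100008000008000000004000,
  0x400000020000000086020000080000000000000000000010000010000000000000000000000000000000000080000000000000000000000000000000000800000000000000000000000200000000000000000000000000000000000000000000000000000000000000000000000000000000000000004000000,
  0x8000000000000000040002200000008904143040005005046812001414013056200040a002080000c402b1480450d000010080300820028000400000000808040081880b820808400c0002010011a2408445c4081110194f171482d0809404245cc911c080d7100000000001000000694000202011000000020900000481004400820094a000002f9500f50a95c0a23a421c05c65216a14a8eb000627824e41328302040010001010400040004200010080023a6abffaeca2e2506edd56d596e05d8fda3e957b],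
  [
  0x3fbfedfffbfefffbeee7fffaeffeffddfffff77dffffffffffffbffffffffffff7fef7ffffffdfffffffff7ff7ffffedbfffffffdffffdfffffffffffffffffffffffffff7fbfffbfffffbfff7fdf7ffac5dbd75b819f7ea29659488e17eaf7f2bfad93332ef6f7e09bffbf7ff7eee5d75e7fd7f7d7a87bef6cf6ffe9fbfd8fed39f8fbfee588efb7a03c062ff0af53a5fdcc52da3fa09ad697ed9b11ffffc875a1bbcd5df5dc967bd7f7ff3db77fe7dd6beb9ff8ffc5374205717d4dae9061e92acf1da3352f41681a,
  0x4000000200000000000000000000000000000000000000000000000000000000000000000000000000000000000000000000000000000000000040000000004000002000001a2028240c40811061a081118800080140424ccc1000000760000000000000000000000000120010000100100000000000000000100100004002f9500f50ac580223a421c05c6501681020ea000007824e40328202000000000800400080000000000006003a48bdfa8c82a2506e9416d500e25c8ad03e9561,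
  0x4012000401000411180001100100020000088200000000000040000000000008010800000020000000008008000012000000002000020000000000000000000000000008000004000000000800080012004008072200045080636606015000c00102000c10908180400408008111a28a1802808284584009308000604027012c60704010a7610481fc1008000000002001009040003002800024404000030081004002008236984280000824800182094146001000080000002001001010a00003000004000800284,
  0x4000000000000000000000000000000000000000000000000000000000000000400000000000000080000000000000000000000000000000000000000000000000000000000000000000000000000000000000000000000000000000000000000000000000000000000000000000000000000000000000000000000000000000200000000000000000000000000000000000000000000000000]],
  [[
  0x20000800000000040010000000000000008000000000001000000800000000000000000000000009000002000000000000000000000008000000000000000000005000000000000000000000000000000000000000000010000000000002000000000000000000000000000000000000000000000002010000000010000000000000000080020000008000a000000000000000000000000000000000000000000000000000000000000000000000000000000000,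
  0x3ffffffffffffffffffffffffffffffffffffffffffdffff7fffffffffbffefffffffffffffff7fffffffffffeffffff7fffffffffffffffffffffffff6fffffdfffffffffffffffffffffff7ffffffffffffffffffffafffffffffffffffffffffffffffffffffffffffffffeffffffffffffdfffffffffffffffffffffffffffffffffffffffffffffffdfeffffffffefffffffffffffffff7ffdffffff7fff5fffffffffffffffffffffffffffffffffffffffffffffffffffffffffffffffffffffffffffffffff,
  0, 0],
  [
  0x4d41200031320459118000574041002a405a19c14b7c013cb6545689741511401a8c3a60b102980106900b415262150b9a858c452280020020012a918b30686a743818aa4c0a4b805440290eada000115e2828042c40d19409c185912c500801486245c812400405641243e53d23185c8181761010068160860834651465d197c100a66422237ab899daffd18f51bb7cbaa7e463ebdf7fd6f89063f8d500cfbfef54fec282c81020c543aa94040941a6410a1978a43ac8fdfaec82a25066bc36d504f35e8adbbf956b,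
  0x2000000e408000000000800000104000080140200000204000000800024800088000808048e024845000008c001000300020200200040804400080000005000080048000800400480101c00100088c46208081800222044a0402420001a010040000a0004001001010451c00429062a2244009292851041111a0080202022a002e534801d85c01434601000800020082411009040420000803428c0708441000100100280c236b84280001025880184194146003104114000002011401814300002000004524000294,
  0x382bedff10e4cfba6ee7f7fa8bfaebfd5b7a4a61eb483de83492ba17689a2c6a765614516060c4372a12fb4322d05eac4651a03b8997b61fb8bfe456e748a95950b80655113b1b435aab616f0520531288157465bd1912a218214386e520fe348b68d12078d3ef8c80ba8a01a804885014a3e80c6c7a87a8e4857c390e918046810ac119a0580840420240006602c44010448028010000021002c100000bb200000aa00151014845b12bc5469a376a6182ae186804b80230205117c49ae1800c92adb0ca13000406800,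
  0x100000008001000000000000000000000000000000000000008000000000281000120009001100080840400080880000004050004400940014001000004002000043020420400002000800000052428000001020000c000070280000800004b2011008302080032280000000000400001000000000000000200000080080000000000000000000000000002010800000000010180000800004010000220000400000010061000000000000000000000000000004000400000000000000000000000000000000000000],
  [
  0x3e8ea529f3f2c4fba0a771646f5ebbc4fa37f5353ebbf6b7ef6f8edbd74f5d9fe3efd40a35ceaada7d098978d7876aada1fb688d93aef0b87e329eb9d2f2de53a378ce1625484bbacd0a725cb1f6a0fb09f6ddc5ddd4e7793159d99bd5dcd7ebbc3ced5febb9cdee9e842af235286e5d614434721010202610063b801d2458b8c1950e26cc0010c358012fb7bbf56fd78b267f4f8ccfce501edfd23f81e6aaf86eeeaff8f77c41232d75f3a3424594197410b9de893ba4bbffeddeee6f876fc3ff70be9fdbad03edd71,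
  0x1214056080833004840860800a0401901880a40400009480090312028002220141023f4ca31512582f67686207881401e0495524c51094381cd61462d05212c5c873168d2b5a44132e580a34209410494002020200910800024060420222010004310a010400000612110018806810014a3890d4c4a079966c04464821b0046100ac00922488a200002c0404400102040088000232001af612009803e1044071011100408008844900a0c408832482482ae002044804000000001001028001c008d41402052e00200a,
  0x8000000000000008000000040000000000014000001000000400100040000000010000000000000000000010004000002000000400000000000008000000000000000210000000000004001000000000000000000000000000000008000000000000000000001201040200000000004000212000008001000a000000000200008000100418000000000002800810d0000000000000000000000000000000000000000000000000000400000000000000000000030000120000800080000000000000000000000,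
  0x501a000405080417180093900100220440008a800400000000400000a080000800080000000400000000010800041200000200200002040000000000000080000000810800000400100d0008000e006209021a02220806ce8220600a01000443800200040632110048c40840d110a28a1802808285d8400938801160c0a7012c60315011a76104a7fc100800080000240100b0501030008000244040091100810040030083369842800018358823c2094146013244184400002011005010200002002004001c10284],
  [
  0x3fefd7fffbfbf7fff9ffff697ffcfffffbbf7ef96bcfbfffbff2fb97ad7febeaf6dfa3ffffbf5bfdf7ffffbefd6fb3f9bf2ffffedf7fc5f3dffd7fffbffbfffffff7fb7eb6f3f479f7f7bef3fff9d9d7fe54be7dba193fece0e436cce37f2f30686adb2074e00d5d01e77fffffefbfdffeffbfbf7ddf5ffffdffefedfe7f7ffffffffeefffffeb7ffddfd068fe0af52a7f5dc41c73fa31aff93ee5313fd6ec87db1bfcc4d9cebffffffe7eebeefb9dbfffffeff6bdf85b74005137d1daa9061e92adf1fa2752e80681a,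
  0x280000040800040000968002000004408104943040004005046852801415012054000040a0020800004102904c0440d000010080300c20028000400400000008040001080b820808410c0006262801aa018040c4c0130f1b8811188000cb1514245f831700a25e08800000100000000000400020a0000200101201808000000001100000148002002f9701f50ad580a23b638c05ce5006c11a8e8029107824e40339263100000000801011006200000000010207a48bffaec82e2546e9c16d500e05c8ad17f9561,
  0x100000040000000200000000010000000000020000000000000000000000000800080000000400000000000000000200000000200000000000000000000000000000800800000400000000000000000000400005220000100041220400d004808000000800f200801000000000002000004000820000000000000000000000000000000000000000200000000000000000008000000000000000404000030000000002000040000001010400040040000010080000000000000000001010200002000010000000284,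
  0x8000000000000000000000000000000000000000000000000000000000a00000000000000000000000001400400000000000000000000000100020000000000000000000000000201008000080000200000000000400001000000000000000000000000000000000000000000000000000000000000000000000000000000000000000000000000000000000000000000000000000000000000004000000000000000000000000000000000000000000]]⟩

def automataFive : Aut := ⟨
  [[
  0xffffffffffffffffffffffffffffffffffffffffffffffffffffffffffffffffffffffffffffffffffffffffffffffffffffffffffffffffff,
  0, 0, 0, 0],
  [
  0x39a410080834401106082034082820129040645b186b6a1a928185f4be0855581724c7164604ef201e50664203c2215004b4a24a4c975bd6ff,
  0,
  0x845ba7b7f7cbafe6f9f7df4bf7d79fed6fbb9b84c39495e52d7e7a0b41f7aaa7e8db30e9a8a90009e12f919d583cdaaef34b5db5b368a42900,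
  0x420048400000100800000080000040000000000024000000000000000000000000000800115210d60080082084010401000000000000000000,
  0x4002000000000400000000000000000000000000000000000000020000000080000000000000000],
  [
  0xf9fa6ef6fefdfb76edf7ecfcdf343299d8c86a032dadd87f82dfdeffb6fd3727e747fabcce2dfbeeded2ef6a07f77557efffbf9bf87d47f3f7,
  0x200000000000000000000000000000000000800000000000000000000000020000000000008000000000000000000,
  0x1000000000000000000000000000100808000000000010000000000000000000000010000000000000000000000000000000000000000,
  0x6051009010204891208010320ca45622416047cd25227807c2021000102c0d81038014210120401210d1095f8080aa0100000440782b80c08,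
  0x8000000000000000100000018804022111000000000000000000400008000880040120c000100000000000008000000040200000000000],
  [
  0x7ba4584808344118460832b42861e936b4447b7b3c3b4a5ed2a1acf4fe5a7dd01724ebfe477ffbfbbe526ee2a7c3a55307f7ab9bfc9f5fd7ff,
  0x10000000000000000000000000000000000000000000000020000000000000000000000000000000,
  0x844305b127c9aae331064948c61410c800030404c18011a00004010301008008089a0401a0800004410d911d583c1aacf00810040340a00800,
  0,
  0x18a206d002140488f18403118a06014ba880800244a4012d5a520800a50227e0411000180004000080000000004000080044600020002000],
  [
  0xbfffa7bfffffebfebdf7ed7cdf35fadbd8ce6e3fddbffbffd2dff6ffffffbfe7e75ff6bcce7ffbff5f7ff7df7bfe7fffffffbbffffdfffffff,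
  0x10000040000000002080000000000000000000000000000000,
  0x1000000004014208120320c205240500914002000400242009000000401800200000110004008000000000008000000004000020000000,
  0x400048400000100000000080000800002010008020400000080000000000000000000902000000000000082084010000000000000000000000,
  0x221000000000000010000000000000008800001208000000000000000000000000040000000000000]],
  [[
  0x190000000020000000002000000000000000000000000000000000000600000000000000000000000000400000000000000000000000000000,
  0xe6ffffffffdfffffffffdffffffffffffffffffffffffffffffffffff9ffffffffffffffffffffffffffbfffffffffffffffffffffffffffff,
  0, 0, 0],
  [
  0x99da26b6f6ea8426a9f7ec2314928c08900002000a104c08ac58701106b711a7c04172c000210100201046000040801003630080385844c102,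
  0x81441104400000080401021008808050104900200200086000000000318001c400c2020d40081000000704204140f11c021002040,
  0x622458480000100902080094082860120044647a346b221052818560b808445814248d021752ded70ac028e2a78305010880a04a04861b16bd,
  0x40081000101008010001300010102044b239180c00001e501060a084140aa0028800021a8800008012f101d583c0aa8f00850240300a00800,
  0x1000100002a4000000048620401c02410000000800000000000000000000000020000000000000000000000000004000000000000000000],
  [
  0x5b844848083451180408202309aa24029054224b0c616c4be40306dc965857403708cab45a3737ee1cd24e2225c32151063403d26c1d4fc7d7,
  0x2400000001030080100001000001020068030820c21001b4082420204102a88008800009a4884001012d30dd583c0ea0f04910058300a00800,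
  0x10000000000102000010000040000000401000020200028001000800001800240000004008100000000002000002010208080082100008,
  0x807b27b7f6c8ae66e9f7cc4cd61498d903a88084018c90000158d00320a50027c043340000008000c20081000000d0040880e4001060003020,
  0x80000000000000001280204001240400150030000000100008000000000000100142010000002000000080000008000000200000000000],
  [
  0x39982206d83441148cf1b4b019212205b8d86ea33c3dc85b9adb7cf5debd3f27c74df6fe4e6def7a3ed0664223c2e55b07772b9bf85d47e3d7,
  0x404000801000080100003000000881240061100c200258441000000210080400010010001001085012d1095d8080aa0180004440720a81c00,
  0x2000000000000000000000000800000000000000400000000000000000000000000000000000000000000000000000008080000000000020,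
  0x3000000000000000000000321800000000020000402080000000028800001a08000000000000800340000e00850000000000000,
  0xc243ddf126c8be6b630e484fe6d655e80400005c0182120024208102004240981022080010120000c002892004011004000000200082100008],
  [
  0xbde714b92fffeff3770e697bcfbfbedaf8566a77dffb7ffef68527ffff5afdd8273ee6fcce6dfbfffffdf7df5bfe2fffffffbbdfffdfffdfff,
  0x18a306d000000488f184041040402000010000000000010958d00000a50227c8c11001208004000002000020000000000000200000000000,
  0x420048400000100800000080000000000000040820000000000000000000000010000800101200000000082004010000000000000000000000,
  0x12000000000503a8918000048000002208000000000000000000000000000000000000005000000044000020002000,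
  0x200001000400000000000000000000000000000000000102010000000000000080008000000000000000000000]],
  [[
  0xffffffffffffffffffffffffffffffffffffffffffffffffffffffffffffffffffffffffffffffffffffffffffffffffffffffffffffffffff,
  0, 0, 0, 0],
  [
  0x42a5184900023f494208108be1cb8fe4241424e4334206417c20071a20025058343240281152451880828020800190080000249004b24a4428,
  0,
  0x9c5ae7b6ffddc0b6bdf7cf741e34701bdbebd919c894f9a603dff8e459fdaba7cbcd3fd7eaadbaa5757d3fdd7ffe6bf6f5ffdb6ffb05b4bbd7,
  0x2100000000200000000020000000000000000200042900088000000086000400000000000400000000004000000004010a0000000000000000,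
  0x200000010000000010000000000008000000000420a00000200000000000000000048010000],
  [
  0xdb5beef7fef9be7fedfffc8bf6df577dfc9406f53977de247e7f736ee0a76fafe15dbf625b5694def8928202a074f05aed6b1d2018a2113008,
  0x20000000100000000000000000000800000000000000000000000000080000000000000000000000000001,
  0x1000000000000000000000000000000000000000000018000000000100000000000a08100000000000800000000000000000000000000,
  0x24a41008010641801200015408208882004a680ac08021d300008891174880501222409c04286b20074d55755f8b0ba41094a2dfa75dea4ff4,
  0x22001000000032181000608000880000400001000000c800001000000010020208000000401020040004000048002],
  [
  0x6325d84900227f49420832eff3ff7ff5649c7ffe37efb61bfca08f8ba6524ed8363a0d561d7a6e50ca02e3228681d40d0a3004f144eb1eb56b,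
  0x8000000000000000001000000000000000000000000,
  0x9cc205b02fdd80b235064900040000080b228000c01001a0000020144100a10000004280400401a4151d1c55781c2aa0f40d52042b10e04800,
  0x100000000000000000000000000000000000000000000000000000000000000008000000000,
  0x182206d000000488f18410080080029041000008004844035f506018ad1027c9c5b021a281900b20e000880062015201c2a90a1004010294],
  [
  0xde5bfff7ffdfbeffffffdddff7dfdffd7cde5cfeffdefffffe7bff4fe7a7efbff47fbfeadb5edcf7ff9fddfffe1dfebfff0f1e6d7beab13a08,
  0x20000000000000000000000000000000000004000000001000000000000000000000000000000400000,
  0xa400080000410000000220082020008000210000000000008000b0105800400300001420a020000060220000c201400070211204150ec5f7,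
  0x210000000020000000002000000000000000020100210000000000000800100000000000040102080000000001000000008080808000000000,
  0x321800000000000010400000000000008800001000000000000000000200000000040000000000000]],
  [[
  0x420008400000000800000000000000000000000000000000000000000000000000000000001200000000000000000000000000000000000000,
  0xbdfff7bffffffff7ffffffffffffffffffffffffffffffffffffffffffffffffffffffffffedffffffffffffffffffffffffffffffffffffff,
  0, 0, 0],
  [
  0xc25b6ef6f6c8806fe9f7cc74de3c5202084048080040200000dad90218ad082fc0413940003a8800e0408800268281040080844b1024008396,
  0x8046a1000000008000100088000001401020200002400844000218001100216410530a01400020000601040042502008883100048,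
  0x21a41009002215000208308321c28de4241426e236290459fc000619a60254503422c0281c40455a0a824022800104090a00209004584b4420,
  0x1c00810001010080100003000000001153ab9101c884d9a40301006001008200088c0401a2800001012d309d581c4ab2f14a59244300a03800,
  0x10000004000000000020000000000000100002000020000050000002000080000002040010054001002000001000002000040001],
  [
  0x4321184000222e494200200cc829ca102010227c054a2241022081430608021810384500013201008200c0000182910b0802244200e65211ac,
  0x400400101015080100013d0021410c753eadd83f884d9be900108a0014088800206081602082a01412d11b55e1d4eb4f3d8d90dc309a02a40,
  0x208400080000010000000000204001200400000000000000000002180002004020000000044000100000000080000000000000100410084400,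
  0x805a27b6fedc8036adffcc231582240888050000021004006dde740478b57127cdc1b2e1f88594ee3cd20e4a20602040042500003800058013,
  0x180080000000000000000000000000000000000000210000000000008000040000000008000040000000200000000000000002a00000000000],
  [
  0xda5b6ff7f6c8be6fe9f7dcfcf65d73ed3cdc04f63fe75a1ad07adb0b88b71eafe2533d0a0352d610c000a920a501941d0a90a40850e214a20b,
  0x4001000010200801200030309828c00c0021108c00025c52500040001488010152080601800004b2baf1097584a0be0100002c6030ca10884,
  0x80000000000000000000000080000080000000000400000000000000000000000000000000000000000000000000000,
  0x1000000000000000000000321800000008020020500600000000008840001a08100000000000800344002e14a59000000000000,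
  0x21a4800808344110040020000020001200006a0100100000008020947600214000084294442c29a4145046400280200004250031ac114a5570],
  [
  0xc6e75df92fdfbffb770e59dffeffffef7cde7cfef9d6fffffe20af5e510aebd834328fe25b7f4efee9df9f77ff9fffbffa2b165f6fbebb6fbd,
  0x18a206d000000488f18400000000100320800006290000015b500180a50427c04530000000800100000080000000000180e8209040001000,
  0x10000000020000000002000010000000000020000000000000000002600000000004000000001000200400000000000000000000000400000,
  0x380000000000400000000200000000008001010000000000008400a00800100009880015a48030001420200800600040044401000001000040,
  0x20000000000000000100000000000000000050000002000008000000000000000000000000001000800000048002]]⟩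

def automataEight : Aut := ⟨
  [[0xffffffffffffffffffffffffffffffffffff, 0, 0, 0, 0, 0, 0, 0],
  [0x201020053091543effec30097c797b0c8c0, 0x4000000000000002000000000000000,
  0xfdfef97facf6aa9c100014fb6838680e373f, 0x800000402000010804000000410000, 0, 0, 0, 0],
  [0x32070bb4122977ffeffecbfab7c79fb9cfe1, 0x80000000000000010000000080000000000,
  0x24008090880000002000400000000000, 0x5e0904a6104000000000000000000041010,
  0xc01840010c4200000000140500386002200e, 0x10000000000400000, 0, 0],
  [0x12470e60730975f3efffdbacb7c797f9ddf5, 0x920800a0004000000000000080000000000,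
  0x880000400000040400048020000, 0x2000000000000000, 0x48031848470880810000413000800040208,
  0xc00040010002020000000000003020002002, 0x201800100000000000000000000000000000, 0],
  [0x92472eacd339bdf7effeefbcffd7b7b9cfe1, 0x1800000000000000000000000800000000,
  0x4c80110020c4000010000001000000061014, 0x400000000000000040000008,
  0x40010400000000000000002000000002, 0x212080520000000800001000000008000000,
  0x802020000010042000000402000, 0],
  [0x36833ef4f37dfff7efffebacffcfffffddf9, 0, 0x84400080880000010001000000000000004,
  0x1800000000000000000000000000000000, 0x1010400000800000002003000000000, 0,
  0xc120c0020002000000000451000000002202, 0],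
  [0xbec77ffdf7fdfff7efffffbeffff9fffdfff, 0, 0x60000000, 0x800000000000000000000,
  0x12080020802000000000001000000002000, 0x1800000000000010000000000000000000,
  0x400000000000000000000000000000000000, 0x40000000000000],
  [0xffe7fffffffffffffffffffdffffffffffff, 0, 0x2000000000000, 0, 0, 0, 0,
  0x1800000000000000000000000000000000]],
  [[0, 0xffffffffffffffffffffffffffffffffffff, 0, 0, 0, 0, 0, 0],
  [0x11c090002000000000000008020040061010, 0x400000000000000000000000000000,
  0x203068053095563efffeb04b5c797f1ccc0, 0xc81c61258cf2aa98100014f348382808232e,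
  0x200000180004000400000000000000000001, 0x42008020000000000000000000000000000, 0, 0],
  [0x54010084522035e266af4abc97c797f1cbc0, 0x8002832108010019105010032830200c0420,
  0x100400000000000000000000000, 0x22006c10805a88048900a10000004002200b,
  0x92400420080020000000040400808000000, 0xd810082404000000000400000000001014, 0, 0],
  [0x100322e4920135f366fec2acb7c797bbcde0, 0x4120040a410c000009002800080000040004, 0,
  0x80004001044202080000000000300800200a, 0x26c098102000400480010100400800401010,
  0x804010008b0880010001453000000000201, 0x60000000, 0x1800000000000000000000000000000000],
  [0x39c39e7c732935f76ffeeabcbfc797bddff1, 0x801800810842000000001100003820002008,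
  0x20000000000000080010000000000400000, 0x4000610080108a0000000041000008000006,
  0x4000000000000000000000000, 0x42400020480400000000400400040020000, 0x810000000000000000000,
  0x2000000000000],
  [0x1fe3bea6f34d75f7effeebacbfcfd7bfddf9, 0xc00040010032880000000010403028002002, 0,
  0x201c00100c80000800001001000000000004, 0x1480000020000010000000000400000, 0x442000000000200,
  0x10000000000000000000, 0],
  [0x3ec73ffdf7fdfdf7effffbbcffffdfffdffd, 0xc00040000800020000000403000000000002, 0,
  0x2000000000000000000002000, 0x12080020000000000000040000000000000,
  0x1800000000000010000000000000000000, 0x800000000000020000000, 0],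
  [0xffe7ffffffffffffffffffbdffffffffffff, 0x40000000000000, 0, 0x2000000000000, 0, 0, 0,
  0x1800000000000000000000000000000000]],
  [[0xffffffffffffffffffffffffffffffffffff, 0, 0, 0, 0, 0, 0, 0],
  [0x25b898120024020000010030000040400101, 0, 0xda4767e9dfdbfdeffffefec7ffffbfb7ecee,
  0x42000001000000000000000081010, 0x108000000000000, 0x200, 0, 0],
  [0x35fc9b56232540b5281000728001680b9111, 4, 0x800064008810880000402000023000000002,
  0x4200008850080242060b1b0c15c617f00880, 0x803002104c21508d1a4c481680880046668,
  0x200000000000000000000000, 0, 0],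
  [0x25b898d640244210000108900000404e0005, 0x800400e0a020411c615b00000,
  0xc04301000800000001004042601020004400, 0, 0x1a046609a093a88f305034208e000a01b392,
  0x2015401120c0248108002800000828, 0x200040000800001000180000040, 0],
  [0x65fcfb76b43ccaa0200185de000068439a33, 0x150841a40000000080000040,
  0x8002008808020006000010002c0002000484, 0x180100000000201080004000000000006000,
  0x4010080000000002000400800000000, 0x2000000420100410e5a0a2093f715bc0100,
  0x140000010000000000000000008, 0x1000000000000],
  [0xe5ffbbfeabb6ea3a2901d95ea401624af6b5, 0, 0x180040001008000000000081083008040802,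
  0x20000004000040010800020000080000140, 0x10401000580500000020000000000, 0,
  0x400004011c0462e260051ce15b10008, 0],
  [0xfffefbffffbfeabfa9519dfe6e316a4fbfb7, 0, 0x100000000000000004000000000004000,
  0x110040240000000000000000, 0x400040160a020011c615b00008, 0x40000800000000880000040,
  0x4000000000000002000000000000000, 0x1800000000000],
  [0xfffffffffffffbffff7ffffe3ff77fffffbf, 0, 0, 0x800000000, 0, 0x800000000000, 0x1400000000000,
  0x40000800000000080000040]],
  [[0, 0xffffffffffffffffffffffffffffffffffff, 0, 0, 0, 0, 0, 0],
  [0x5203008840002062020ad080340411104480, 0x4000200000000004400842010228000020,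
  0x25b8981620240210000101380000404a1311, 0x880466418dd3dd8df9b42401ca388005a04e,
  0x100120000000000020000c100a00800, 0x8000000000004000006000000, 0, 0],
  [0x26b8801630200180ec25030801c242e19810, 0x2484c01400500101000020c10060000,
  0x21000000000000000080000, 0x11477d2082d6a8200040e0f2a0012800672b,
  0xc000000001080048020a0804103005100004, 0x800008100000402118004014c00800000c0,
  0x100000000000000000000000, 0],
  [0x64fa807a2031f901c074888ca20040021430, 0x1041000008c0240020b137310c02df00104,
  0x100000000000000000000000000000000000, 0x4001054200000100000000380000220a,
  0x20009844a00003a0c000000050712080081, 0x880026009000008430002400480000058800,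
  0x100000000000000004000000000004000, 0x40000800000000080000040],
  [0xa7f893fa522c42c2260b9a7615c771f389a0, 0x400408002442350849a40000000880043259,
  0x80000000000002000000100000000000000, 0x200089918805905000080a3000080004, 0,
  0x10034405000000100000648060000e004402, 0x800000000000, 0x1000000000000],
  [0x7fff9bda28b7eb7bcf7f53f637c677f27795, 0x80002400844000802000a000000008018008, 0,
  0x40250200040010800009080180040062, 0x1100000400000800003000080800,
  0x4008000000000400000000000000, 0x100000000000800000000000, 0x400800000000],
  [0xfffffbfffebfeabfa951d9feae316a4fffb7, 0x4000100000010002400400000000000, 0,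
  0x40110040240000000800000008, 0x40060a020011c615b00000, 0x40000800000000080000040, 0,
  0x1000000000000],
  [0xfffffffffffffbffff7ffffebff77fffffbf, 0x1400000000000, 0, 0, 0, 0, 0,
  0x40000800000000880000040]]⟩

def automataTwelve : Aut := ⟨
  [[0x3ffff, 0, 0, 0, 0, 0, 0, 0, 0, 0, 0, 0],
  [0x4011, 0, 0x3bbee, 0x400, 0, 0, 0, 0, 0, 0, 0, 0],
  [0x4f75, 0, 0x2200a, 0, 0x19080, 0, 0, 0, 0, 0, 0, 0],
  [0x4f11, 0, 0x1044, 0, 0x2002a, 0x2000, 0x18080, 0, 0, 0, 0, 0],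
  [0x4491, 0, 0xb24, 0x20002, 0x8008, 0x2000, 0x1040, 0, 0x10000, 0, 0, 0],
  [0x4f1d, 0, 0x1080, 0, 0, 0x2000, 0x20042, 0x20, 0, 0x18000, 0, 0],
  [0x27f57, 0, 0x28, 0, 0x8000, 0x10000, 0, 0, 0x80, 0, 0, 0],
  [0x26f1f, 0, 0x20, 0, 0, 0, 0x40, 0x10000, 0, 0x1000, 0x80, 0x8000],
  [0x24f1f, 0, 0x13000, 0, 0x80, 0, 0x40, 0x20, 0, 0x8000, 0, 0],
  [0x26f1f, 0, 0x20, 0, 0x8000, 0, 0x10040, 0, 0, 0, 0x1000, 0x80],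
  [0x36f5f, 0, 0x8000, 0, 0, 0, 0x1000, 0x20, 0, 0, 0, 0x80],
  [0x37f7f, 0, 0, 0, 0x8080, 0, 0, 0, 0, 0, 0, 0]],
  [[0, 0x3ffff, 0, 0, 0, 0, 0, 0, 0, 0, 0, 0],
  [0, 0, 0x4411, 0x3bbee, 0, 0, 0, 0, 0, 0, 0, 0],
  [0x4011, 0x420, 0, 0x20002, 0x2b4c, 0x19080, 0, 0, 0, 0, 0, 0],
  [0x4411, 0x20002, 0, 0xb04, 0, 0x1068, 0x2000, 0x18080, 0, 0, 0, 0],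
  [0x4411, 0x10084, 0, 0xb40, 0, 0x2000a, 0x2020, 0x1000, 0x8000, 0, 0, 0],
  [0x4f15, 0x20002, 0, 0x10080, 0, 0x1000, 8, 0xa040, 0x20, 0, 0, 0],
  [0x4f15, 0x20002, 0, 0x28, 0, 0x10000, 0, 0, 0x3040, 0x80, 0x8000, 0],
  [0x24f1f, 0, 0, 0, 0, 0x1000, 0, 0x18080, 0x2000, 0x60, 0, 0],
  [0x24f1f, 0, 0, 0x12040, 0, 0x1080, 0, 0x8000, 0, 0, 0x20, 0],
  [0x26f1f, 0, 0, 0xa0, 0, 0, 0, 0x10000, 0x1000, 0x40, 0x8000, 0],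
  [0x36f5f, 0, 0, 0, 0, 0, 0, 0x9000, 0, 0x80, 0x20, 0],
  [0x37f7f, 0, 0, 0, 0, 0x8080, 0, 0, 0, 0, 0, 0]],
  [[0x3ffff, 0, 0, 0, 0, 0, 0, 0, 0, 0, 0],
  [0x10000, 0, 0x2ffff, 0, 0, 0, 0, 0, 0, 0, 0],
  [0x11000, 0, 0x20002, 0x20, 0xefdd, 0, 0, 0, 0, 0, 0],
  [0x10400, 0x8000, 0x1a00, 0, 0, 0x221e6, 0x4019, 0, 0, 0, 0],
  [0x10440, 0, 0x9000, 0, 0x2008, 0x20202, 0x924, 0x80, 0x4011, 0, 0],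
  [0x11220, 0, 0x800, 0, 0, 0x100, 0x2044a, 0xa080, 4, 0x4011, 0],
  [0x11944, 0x8000, 0, 0, 0, 0x24093, 0, 0x28, 0x2600, 0, 0],
  [0x114c0, 0, 0x200, 0, 0x8000, 0x24, 0, 0x6019, 0x20902, 0, 0],
  [0x394ea, 0, 0x4011, 0, 0, 0x100, 4, 0, 0, 0x2000, 0xa00],
  [0x395ea, 0, 0xa04, 0, 0, 0, 0x4011, 0, 0, 0x2000, 0],
  [0x3f5fb, 0, 0, 0, 0, 0x204, 0x800, 0, 0, 0, 0]],
  [[0, 0x3ffff, 0, 0, 0, 0, 0, 0, 0, 0, 0],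
  [0, 0x20, 0x10000, 0x2fbdf, 0, 0x400, 0, 0, 0, 0, 0],
  [0x10000, 0x180, 0, 0x2644, 0x21022, 0xc819, 0, 0, 0, 0, 0],
  [0x10408, 0x28022, 0, 0x344, 0x1000, 0x800, 0x2080, 0x4011, 0, 0, 0],
  [0x10400, 0x241f3, 0, 0x2000, 0x1000, 8, 0x8200, 0x804, 0, 0, 0],
  [0x11008, 0x4a0, 0, 0xc055, 0, 0x800, 0x2000, 0x20302, 0, 0, 0],
  [0x11000, 0x2a142, 0, 0, 0x20, 0x4811, 0x80, 0x400, 8, 0x204, 0],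
  [0x11440, 0x282a2, 0, 0x100, 0, 0, 0x2000, 0x4011, 8, 0x800, 4],
  [0x194e0, 0x2220a, 0, 0x4011, 0, 0x800, 0, 0x104, 0, 0, 0],
  [0x395ea, 0x2200, 0, 4, 0, 0x800, 0, 0x4011, 0, 0, 0],
  [0x3f5fb, 0, 0, 4, 0, 0, 0x200, 0x800, 0, 0, 0]]⟩

def automataLarge : Aut := ⟨
  [[0xf, 0, 0, 0, 0, 0, 0, 0, 0, 0, 0, 0, 0, 0, 0, 0, 0, 0, 0],
  [0, 0, 0xf, 0, 0, 0, 0, 0, 0, 0, 0, 0, 0, 0, 0, 0, 0, 0, 0],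
  [0, 0, 0, 0, 0xf, 0, 0, 0, 0, 0, 0, 0, 0, 0, 0, 0, 0, 0, 0],
  [0, 0, 0, 0, 0, 0, 0xf, 0, 0, 0, 0, 0, 0, 0, 0, 0, 0, 0, 0],
  [5, 0, 0, 0, 0, 0, 0, 0, 0xa, 0, 0, 0, 0, 0, 0, 0, 0, 0, 0],
  [0, 0, 0, 0, 0, 0, 0, 0, 5, 0xa, 0, 0, 0, 0, 0, 0, 0, 0, 0],
  [0, 0, 0, 0, 1, 0, 0, 0, 6, 0, 0, 8, 0, 0, 0, 0, 0, 0, 0],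
  [0, 0, 0, 0, 0, 0, 0, 0, 0, 5, 0, 0, 2, 8, 0, 0, 0, 0, 0],
  [0xa, 0, 0, 0, 5, 0, 0, 0, 0, 0, 0, 0, 0, 0, 0, 0, 0, 0, 0],
  [0, 0, 0, 0, 0, 0, 0, 0, 8, 0, 5, 0, 0, 2, 0, 0, 0, 0, 0],
  [4, 0, 0, 0, 1, 0, 0, 0, 0, 0, 0, 0, 0, 0, 0xa, 0, 0, 0, 0],
  [5, 0, 0, 0, 8, 0, 0, 0, 0, 0, 0, 0, 0, 0, 0, 2, 0, 0, 0],
  [5, 0, 0, 0, 0, 0, 0, 0, 0, 0, 0, 0, 0, 0, 0, 8, 2, 0, 0],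
  [5, 0, 0, 0, 0, 0, 0, 0, 2, 0, 0, 0, 0, 0, 0, 0, 8, 0, 0],
  [5, 0, 0, 0, 0, 0, 0, 0, 0, 0, 0, 0, 0, 0, 0, 0, 0, 0xa, 0],
  [5, 0, 0, 0, 0, 0, 0, 0, 0, 0, 0, 0, 0, 0, 0, 0, 0, 0, 0xa],
  [5, 0, 0, 0, 8, 0, 0, 0, 2, 0, 0, 0, 0, 0, 0, 0, 0, 0, 0],
  [7, 0, 0, 0, 8, 0, 0, 0, 0, 0, 0, 0, 0, 0, 0, 0, 0, 0, 0],
  [0xd, 0, 0, 0, 0, 0, 0, 0, 2, 0, 0, 0, 0, 0, 0, 0, 0, 0, 0]],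
  [[0, 0xf, 0, 0, 0, 0, 0, 0, 0, 0, 0, 0, 0, 0, 0, 0, 0, 0, 0],
  [0, 0, 0, 0xf, 0, 0, 0, 0, 0, 0, 0, 0, 0, 0, 0, 0, 0, 0, 0],
  [0, 0, 0, 0, 0, 0xf, 0, 0, 0, 0, 0, 0, 0, 0, 0, 0, 0, 0, 0],
  [0, 0, 0, 0, 0, 0, 0, 0xf, 0, 0, 0, 0, 0, 0, 0, 0, 0, 0, 0],
  [0, 0xf, 0, 0, 0, 0, 0, 0, 0, 0, 0, 0, 0, 0, 0, 0, 0, 0, 0],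
  [0, 0, 0, 5, 0, 0, 0, 0, 0, 0, 0xa, 0, 0, 0, 0, 0, 0, 0, 0],
  [0, 0, 0, 0, 0, 5, 0, 0, 0, 0, 0, 2, 8, 0, 0, 0, 0, 0, 0],
  [0, 0, 0, 0, 0, 0, 0, 0xf, 0, 0, 0, 0, 0, 0, 0, 0, 0, 0, 0],
  [0, 0xa, 0, 0, 0, 5, 0, 0, 0, 0, 0, 0, 0, 0, 0, 0, 0, 0, 0],
  [0, 5, 0, 0, 0, 0xa, 0, 0, 0, 0, 0, 0, 0, 0, 0, 0, 0, 0, 0],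
  [0, 1, 0, 0, 0, 4, 0, 0xa, 0, 0, 0, 0, 0, 0, 0, 0, 0, 0, 0],
  [5, 8, 0, 0, 0, 0, 0, 0, 0, 0, 2, 0, 0, 0, 0, 0, 0, 0, 0],
  [5, 0, 0, 0, 0, 0, 0, 0, 0, 0, 8, 2, 0, 0, 0, 0, 0, 0, 0],
  [5, 2, 0, 0, 0, 0, 0, 0, 0, 0, 0, 0, 8, 0, 0, 0, 0, 0, 0],
  [5, 0, 0, 0, 0, 0, 0, 0, 0, 0, 0, 2, 8, 0, 0, 0, 0, 0, 0],
  [5, 0, 0, 0, 0, 0xa, 0, 0, 0, 0, 0, 0, 0, 0, 0, 0, 0, 0, 0],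
  [5, 0xa, 0, 0, 0, 0, 0, 0, 0, 0, 0, 0, 0, 0, 0, 0, 0, 0, 0],
  [5, 0xa, 0, 0, 0, 0, 0, 0, 0, 0, 0, 0, 0, 0, 0, 0, 0, 0, 0],
  [5, 0xa, 0, 0, 0, 0, 0, 0, 0, 0, 0, 0, 0, 0, 0, 0, 0, 0, 0]],
  [[0xf, 0, 0, 0, 0, 0, 0, 0, 0, 0, 0, 0, 0, 0, 0, 0, 0, 0, 0],
  [0, 0, 0xf, 0, 0, 0, 0, 0, 0, 0, 0, 0, 0, 0, 0, 0, 0, 0, 0],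
  [0, 0, 0, 0, 0xf, 0, 0, 0, 0, 0, 0, 0, 0, 0, 0, 0, 0, 0, 0],
  [0, 0, 0, 0, 0, 0, 0xf, 0, 0, 0, 0, 0, 0, 0, 0, 0, 0, 0, 0],
  [0xf, 0, 0, 0, 0, 0, 0, 0, 0, 0, 0, 0, 0, 0, 0, 0, 0, 0, 0],
  [0, 0, 0, 0, 0, 0, 0, 0xa, 5, 0, 0, 0, 0, 0, 0, 0, 0, 0, 0],
  [0, 0, 0, 0, 0, 0, 0, 0, 0, 0xa, 5, 0, 0, 0, 0, 0, 0, 0, 0],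
  [0, 0, 0, 0, 0, 0, 0, 0, 0, 0xa, 0, 0, 5, 0, 0, 0, 0, 0, 0],
  [0, 0, 0, 0, 0, 0, 0, 0, 0, 0, 0xa, 0, 0, 5, 0, 0, 0, 0, 0],
  [0xa, 0, 0, 0, 0, 0, 0, 0, 0, 0, 0, 0, 0, 0, 5, 0, 0, 0, 0],
  [4, 0, 0, 0, 0, 0, 0, 0, 0, 0xa, 0, 0, 0, 1, 0, 0, 0, 0, 0],
  [0xa, 0, 0, 0, 0, 0, 0, 0, 0, 0, 0, 0, 0, 0, 0, 5, 0, 0, 0],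
  [0xa, 0, 0, 0, 0, 0, 0, 0, 0, 0, 0, 0, 0, 0, 0, 0, 5, 0, 0],
  [0xa, 0, 0, 0, 1, 0, 0, 0, 0, 0, 4, 0, 0, 0, 0, 0, 0, 0, 0],
  [0xa, 0, 0, 0, 0, 0, 0, 0, 0, 0, 0, 0, 0, 0, 0, 0, 0, 5, 0],
  [0xa, 0, 0, 0, 0, 0, 0, 0, 0, 0, 0, 0, 0, 0, 0, 0, 0, 0, 5],
  [0xe, 0, 0, 0, 0, 0, 0, 0, 0, 0, 0, 0, 0, 1, 0, 0, 0, 0, 0],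
  [0xe, 0, 0, 0, 0, 0, 0, 0, 0, 0, 0, 0, 0, 1, 0, 0, 0, 0, 0],
  [0xa, 0, 0, 0, 1, 0, 0, 0, 0, 0, 4, 0, 0, 0, 0, 0, 0, 0, 0]],
  [[0, 0xf, 0, 0, 0, 0, 0, 0, 0, 0, 0, 0, 0, 0, 0, 0, 0, 0, 0],
  [0, 0, 0, 0xf, 0, 0, 0, 0, 0, 0, 0, 0, 0, 0, 0, 0, 0, 0, 0],
  [0, 0, 0, 0, 0, 0xf, 0, 0, 0, 0, 0, 0, 0, 0, 0, 0, 0, 0, 0],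
  [0, 0, 0, 0xa, 0, 0, 0, 5, 0, 0, 0, 0, 0, 0, 0, 0, 0, 0, 0],
  [0, 0xd, 0, 0, 0, 2, 0, 0, 0, 0, 0, 0, 0, 0, 0, 0, 0, 0, 0],
  [0, 0, 0, 0, 0, 0, 0, 0, 0xa, 5, 0, 0, 0, 0, 0, 0, 0, 0, 0],
  [0, 0xa, 0, 0, 0, 0, 0, 0, 0, 0, 0, 5, 0, 0, 0, 0, 0, 0, 0],
  [0, 0, 0, 0, 0, 0xa, 0, 5, 0, 0, 0, 0, 0, 0, 0, 0, 0, 0, 0],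
  [0, 0, 0, 0xa, 0, 5, 0, 0, 0, 0, 0, 0, 0, 0, 0, 0, 0, 0, 0],
  [0, 8, 0, 0, 0, 2, 0, 5, 0, 0, 0, 0, 0, 0, 0, 0, 0, 0, 0],
  [0, 0xf, 0, 0, 0, 0, 0, 0, 0, 0, 0, 0, 0, 0, 0, 0, 0, 0, 0],
  [0xa, 0, 0, 0, 0, 0, 0, 0, 0, 5, 0, 0, 0, 0, 0, 0, 0, 0, 0],
  [0xa, 0, 0, 0, 0, 0, 0, 0, 0, 0, 0, 5, 0, 0, 0, 0, 0, 0, 0],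
  [0xa, 5, 0, 0, 0, 0, 0, 0, 0, 0, 0, 0, 0, 0, 0, 0, 0, 0, 0],
  [0xa, 0, 0, 0, 0, 0, 0, 0, 0, 0, 0, 5, 0, 0, 0, 0, 0, 0, 0],
  [0xa, 0, 0, 0, 0, 5, 0, 0, 0, 0, 0, 0, 0, 0, 0, 0, 0, 0, 0],
  [0xa, 5, 0, 0, 0, 0, 0, 0, 0, 0, 0, 0, 0, 0, 0, 0, 0, 0, 0],
  [0xa, 5, 0, 0, 0, 0, 0, 0, 0, 0, 0, 0, 0, 0, 0, 0, 0, 0, 0],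
  [0xa, 5, 0, 0, 0, 0, 0, 0, 0, 0, 0, 0, 0, 0, 0, 0, 0, 0, 0]]⟩

def closureEight : Clo := ⟨
  [[[0xffffffffffffffffffffffffffffffffffff, 0x9498050064a448e2001101a0401c6063000,
  0x210118263020440000000080a000a04a40c0, 0x454044050424000000815a00218c0c0b00,
  0x180404800208001200006c0004200601c065, 0x80020008000008020000020480000040000,
  0x104000000000000002400000000010040, 0x1000000000000],
  [0x21206204c010045025a20403214511bc410, 0x22024a44082100f12a5a0040120451560400,
  0x2060421001100508410520411184200, 0x2000088050041025a0052002000080618,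
  0x4202000004000040020a040c22000000c420, 0x800000040401200120500001100411148000,
  0x400000000000000],
  [0x82201500404111cc5a4520029ea20a03004, 0x4c814004003114c5a45002882900001006,
  0x10210302000511445a4120021ca20a20000, 0x40010000021120c1a4424281eb00a42000,
  0x80000000000001404005000802800000004, 0x20409c200a40002, 0x4000000800000000, 0x800000000000],
  [0x4e0000d2134c80408010c00000040020008, 0x210080040128400000000910000040060200,
  0x10008020000000000010410000000000208, 0x400080104000000000043002000040200,
  0x40008000000000c00000000000001, 0, 0x400000000000000],
  [0x210008004c2020800000140000000000010, 0x208018004c2000000000042000040462000,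
  0x20000000000000000000000000000, 0x1000004000000000140000000000010,
  0x20000800000000000000000000000000000, 0x40000],
  [0x1000500820000000010400400028000002, 0x400800000800000010000000000200,
  0x100020000000010400000020000200, 0x800000000000052000008000200, 0x400000000000002,
  0x400000000000, 0x400000000000000],
  [0x2040000000000010000000000040000000, 0x880000000000010000000000040000000,
  0x10000000000000000000000000000000000, 0x40000000000000000000000000000000,
  0x40000000000010000000000000000000, 0x10000000000000000000],
  [0, 0, 0, 0x2000000000000]],
  [[0x24b001082006000020005000200000004200, 0xdb4880100040001400011a000821c80830c5,
  0x3140050200000008000070202000244bc840, 0x40808000c008420004400040006004040,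
  0x4002002001000003a00002180098284, 0x80000000000008020000400080088000100, 0x4000000],
  [0xd210062850254249125a70882010400bc600, 0x60002b010108a8a20419b2dc031440a0840,
  0x62640b9c801001020000410c60b8000, 0x4608404402c0220a701888010009c280,
  0x120000000090882800005180a00080004740, 0x4a01000000200102000001004098840,
  0x4000000000010002000000080010000, 0x800000000000],
  [0x202007500400401200005204a1e208a1c404, 0x80c8a0004080014200014000d22c6080004,
  0x210003400440401a00005080a000a00a44c0, 0x200040020040000060000c08ca08800,
  0x400000000100000700004200609c045, 0x80004000008000020000400080000018000,
  0x4000000000000002000000000010040],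
  [0x4e0008c20348a0800011920000000080200, 0x140801000108880000008000830400a1000,
  0x14004860030880000003000000040480000, 0x4000c000c020008019130000000000300,
  0x4002010880800002800000000000200, 0x80000000000008000000000080000000000, 0, 0x1000000000000],
  [0x1040000084400000000400000000000000, 0x20800000042020000010400000000002000,
  0x20080400800000000000000000000, 0x4000000000400000000000000,
  0x20040000080000000000000000000000000, 0x400400000000000, 0x400000000000000],
  [0x201000080000000000000000002040022200, 0x40000000000000000000000000048000000,
  0x200000000000000000000000000020420000, 0x80000000000000000000000000200, 0x2200,
  0x80000000000000000000000000008000000],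
  [0x2000100002000000010400000040000000, 0xc00880000000000800000400000000000000,
  0x10000000000000000000000000040000000, 0x10400000000000000, 0x2000000000000000000000000,
  0x400000000000000, 0x400000000000000]],
  [[0x30c40201100e5a4424207c3c6afffff, 0x103410100001108c4a4021803cac0aa60d8,
  0x80023e9c7c0401001004a0003ca04ae5c61, 0x41031900400002000400000086002609c046,
  0x80002001a0821188e1a4420001c280a00286, 0x40200300001000800000020880098100,
  0x100000000118044240000800004004000, 0x800000000],
  [0xfffffffffffffffffffffffffbfe39fc0420, 0x10300241020440000001080a00120018003,
  0x280023f98481401500104108800000040000, 0x11075400000c020200003410200120098000,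
  0x76801a0c2240828005020200800000600, 0x4201000041020002480000000080200,
  0x100000000000000000401000800000000],
  [0x21a860848010049025a20423005511b8410, 0x2010001400100508042100459198014,
  0x4002030843014041025a00002000000e1420, 0x82000000400000400a0a0000100411102004,
  0x1000900500000100411100004, 0x300000000000000000008018000, 0x40020a0000000000000000],
  [0x203820338c00020481000040001000011200, 0x10000000400080409000400400000000000,
  0x200020108440200400000800000000000001, 0x400008000400020401000400000020000000,
  0x800020008000000481000000000000000200, 0x400000400000000000200],
  [0xce010422880400c0001000000084040200c, 0x10000010000000000000002000840022008,
  0x80001400080400400000000000800040000, 0x10000000000000000000000000000000,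
  0x2080000800000000000800000000, 0x800000000, 0, 0x800000000],
  [0x800804b4880010000400000000000200, 0x40010020000800000400000000000000,
  0x80000080400000010000000000000000000, 0x4000010000400000020000000, 0x200,
  0x40000000000000000400000000000200, 0x10000400000000000000],
  [0x800000000000000000002, 0x40000000000000, 0, 0x20000002, 0x800000000000000000002]],
  [[0x400203100c5a440428601c6063400, 0x107000000001110c5a40056c008c00e801c,
  0x3a65c70040b0200040008209440e0704, 0x4042000000005006000040806058201,
  0x220080003198e1a40000000080083000, 0x304004440000000802000020180000000,
  0x100000300110044240000000004000000],
  [0x2959a1d0874a449e2001581a082000440c20, 0x21671c5627200410000128020020024409a0,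
  0xcf9e347842c609420009852482008040020, 0x41032480860800922001701408000040000a,
  0x800020008142040800004009000000000400, 0x1000400000480200008080020020008a0,
  0x8000000000000000000000],
  [0x2220202088100692a5b4042100551560480, 0x4bb84020005001100502042000000098201,
  0x1a922100834059025a4004000d500e0688, 0x201080028000040220b0000900001558200,
  0x2000001001928504000000000080000, 0x204000000000020002000400900000000,
  0x1000000000040020a0000800000000000],
  [0x4a0e1068824009c81000040000040001100, 0x210080140822001081000050002040040010,
  0x48382903c100001400000053000000000000, 0x800004000004000001002000000000040100,
  0x20048800008881000000000000001000, 0x4004000008400002000000000000000,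
  0x100008000000000000000000000],
  [0x201c80500080400000000100000800040206, 0x1180800080000000001000000084046220c,
  0x4a000420004400800000040000840040204, 0x400000000000000000100000800000200,
  0x400000800000000000000000800000202, 0x40000000000000000000000000, 0x800000000],
  [0x58080004a0000010000010000000000000, 0x6410022000000000000011000000000000,
  0x84080000420000010000042000000000000, 0x10000010000000000000, 0x8000000000800000000000000000000,
  0, 0x10000000000000000000],
  [0x2000020800000000000000000000002200, 0x1880000000000000000000000000000200, 0x200,
  0x800000000000000000000000200, 0x2200],
  [0x2000000000000, 0x2000000000000]],
  [[0x2309820e00290181a05a5042120571108010, 0x14b0134c6c225308c5a440402011000fc002,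
  0xc303421000191543d7fe58025014111a0038, 0x34023a18a8899d8e2af5004300411504001,
  0x509084150040004000001000100083000, 0x100002010001008121500800001000018022,
  0x440020a4000100411104000],
  [0x210b80000050001100401a0027dac6a07fef, 0x2002180000018824002e7823ca04afcc60,
  0x500000010010104421802061886080220, 0x1040301000001902003320021ca00e04682,
  0x30000005000000400000022088000774b, 0x2000000000100400c00001004008860, 0x2020001ca80a04000],
  [0x114240eb388242d06001affeb1c651f80400, 0x4f003212880c80860002040801020080000,
  0x10200c00080025040000003a000000a0410, 0x114003211a82884840010030000000400000,
  0x1080000000000000000000000080000, 0x2010000000020002400000000000000, 0x4000000400000000000000],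
  [0x800a4818008010003001483868000034, 0x41018401c008801000040000000060200,
  0x40000050000001001004000800000208, 0x1010008000000003000000000000201,
  0x408084010000010000000000800000000, 0x8008001002000000800000000, 0x400000000000,
  0x1000000000000],
  [0x200880040020880000000000000000001000, 0xc01000000022880000000005001000060000, 0,
  0x1000000880800000000000000000000, 0x1000],
  [0x10800000010420000000000000020000200, 0x2000080020400800000410001020000202,
  0xc00400000000020000000000400000000200, 0x10401000000000000000000000000000200, 0x1000000000200,
  0x400000000000002],
  [0x20800000000000410000040000000, 0x1000000800000000000000000000000000, 0,
  0x800000000000010000000000000, 0, 0x400000000000000, 0x400000000000000],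
  [0, 0, 0x2000000000000]],
  [[0xda0bc29a485900018058105e100431108010, 0x503f6dffafff7ffffe00422000200c4000,
  0x603021440210451025a183a101411100021, 0x104121a08188cc8024000410100411119000,
  0x80040081a011113c1f49000400000080010, 0x200040540080040028a040020000001c008,
  0x40110044240000100411104000, 0x1000000000000],
  [0xb0000080140058018120003ca80a060c8, 0x2661c7014645025a0240a3c208a1d045,
  0x400000000015105c5f400008218a0004006, 0x122008e016043065a120021c200a1c080,
  0xa070000414015444bae1000820880002048, 0x11501c4740000800800004040, 0x80020001c280a00000],
  [0x43803f10a1ca0180181080a00002080000, 0x1050236d84a5d91de5f425182000020dc000,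
  0x300100091555347fe1012201000082020, 0x24021209080db44ebae2404000000005001,
  0x1080c0001041504501180000002080000, 0x100000010000000400000400200000018000,
  0x440020a0000000000004000],
  [0x40a4018000480009100000020000012, 0x4140d692cc88409000000000020042000,
  0x20000004020000400001810001020000001, 0x10800a000001400000000000000,
  0x80000080800000481000000000000000010, 0x20004004008000000008500000000000000],
  [0x8008408e0c80080000410400008000001, 0x1020008c828a0800000450000000000000,
  0x40000040030400090000002000000000000, 0x20848000880010000410000000000000,
  0x20000000800000000000000000008000001, 0x80000400000000000008, 0x40000010000400400000000000],
  [0xc00110882000000000000000020000004, 0x400020000000000000000020001005,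
  0x100020000010000010000000000004, 0x401000800000010000400000000000000,
  0x400000002000000000000400000000000, 0x400000000000000, 0x10000000000000000000],
  [0xc00040020000020000000413000000000000, 0x1000000000000010000402000000000000, 0x10000020000000,
  0x20000000410000000000000, 0x40000000000010000000000000000000, 0x10000400000000000000,
  0x400000000000000, 0x1000000000000],
  [0x40000000000000, 0x40000000000000]],
  [[0x1b00021000010041025a0640010631840000, 0x22002282c0010041125a4000122431560400,
  0x6f882000805aa6d0a5b02400beb48a00006, 0x80022009412000000004a2011d611b42420,
  0x100100a00001880100500000121c11104018, 0x200000040000040020a060001eb00a00000,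
  0x4000000000000000],
  [0x842001920009900c4a4500228210800141c, 0x204020300020001015082200000020700,
  0x14f880000004990cc4a40000082040000004, 0x224082240000005005c80281000001600,
  0x80200200100990441a45000200808000418, 0x1120c4240400002000000000, 0x804000000800000000],
  [0x21013408c309040200100040041286044fe2, 0x16402c019000000100000143096044020,
  0x60188008400d040a001000400003802006c0, 0x120008012000000000000101294246b20,
  0x100000000040000100000141016004240, 0x44004008000000000000000300200000,
  0x100000000040000000000000000004040],
  [0xb00044808c0880000001000002000440000, 0xc80002800000000402080020062000,
  0xa3800000840880c0800100000004040000a, 0x4000000000000001400001000040000,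
  0x880000880400000000000000000000, 0x20004000000000000000400080000000000],
  [0x2010a890000090000000000040001010, 0x20008090020000010000002000020000,
  0x4a000000804000090000000000048000000, 0x2000a010000010000000000000001000, 0x10,
  0x80000000000000000000, 0x10000000000000000000],
  [0x284040080080000000001000000020400004, 0x480000020000000000001400002020000200,
  0x204080000000000800001000000000400004, 0x80000000000000400000000000200,
  0x40000000000000001000000000000000, 0x80000000000000000000400000000000000],
  [0x10000000000000000000040000000000200, 0, 0x40000040000200, 0x200, 0x200]],
  [[0x9050004002000842000061801026185c00a, 0x21800100003040802000428207da60e78c20,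
  0x9210000120002040001834593e751b64300, 0x90101000010000000000000520c11144230,
  0x20200000020889d200a00802, 0x2000080280040a8860000018400, 0x4400100511100008],
  [0x183110d08201110e5a44614a5030188c000, 0x21000105102040902c0042021bdf31f98430,
  0x24090900001010018040001e2411180001, 0x9011100000000300000420001c300a84400,
  0x300050000110041a40020220000004008, 0x1000100020004400100411188000, 0x80060101c200a00000,
  0x800000000],
  [0x310300000310040400000200211a45844c60, 0x8005000010400000004102101415100620,
  0x810330008300ae240800024021ea40a64640, 0x1000500101000000000420011c615b40a30,
  0x100120008000040000000000181c15104040, 0x30000000000820001ca00a00400, 0x40000004000000000000040],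
  [0x408000000000000002480080040400001, 0x210010010010400000002000001040040000,
  0x12001000000000000010080002000000200, 0x4000000000000000020000000440200,
  0x408000000000000000000080000000001, 0x8002400000000000000, 0x400000000000000, 0x400000000000],
  [0x10080010000080000000000020040208, 0x10001000010000000000000000860460200,
  0x2001080000880000000100000040040200, 0x11000010000000000000000800000200, 0x200, 0, 8],
  [0x98000000820000000000410001000000000, 0x800000000020000000000000000000000010,
  0x401000000020000010000000000000200, 0x90000000000000000000000400000000200, 0, 0x400000000000000,
  0x400000000000000],
  [0x200000000000000000000000000000400202, 0x200, 0x10000000000000000000041000000000200, 0x400200,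
  0x202],
  [0, 0x2000000000000]]],
  [0xffffffffffffffffffffffffffffffffffff, 0xfdfffbffa4f6ebbd24435cff2838684ff73f,
  0xc5f8d34b6b06404840010046103370663016, 0xe5bcf99f887e8a0c1900045340306006220b,
  0x25b891522886420800010042000048463010, 0xc97cc10a0420000800000453400020000206,
  0x13880020800000800000040000060000000, 0x2000000000000],
  [0xffffffffffffffffffffffffffffffffffff, 0xee3f6fffdf6d77ffffffffffffffbff9cfeb,
  0x3bffbf7bb49fff7feffef3c6bdfeffbffcf5, 0x2fe49d1f693cc88c8901bd73483060441311,
  0x63821828cd6ca089001014240084042200c, 0x281c015808a0020810010452400028400200,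
  0xc138c0020000000010000041000020000002, 0x2000000000000],
  [0xffffffffffffffffffffffffffffffffffff, 0xda4767edfffbfdfffffeffcfffffffbffefe,
  0x6a0302b854c93757d7ffdb8df7ce97f84ee8, 0x12476728bfdfbde7fffef73cbfcf9fb1fffa,
  0x1a07408843413557dffe5a20b7ff97b847ce, 0x1a004401500915c5f6fe26a05bce9db18942,
  0x100000000154056ae460191ce95b04040, 0x1800800000000],
  [0xffffffffffffffffffffffffffffffffffff, 0xa5fc9f773f3fdf9dedf52f7fcbfbe6efbb75,
  0xddfbfbefc7fdfc7f13dad8f7fe3dfd1e47ef, 0xd3053f84de0c02f63f0b77341dcf17fdcb81,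
  0x90076805a9d3bd3dc9f44189a2088e08765b, 0x424530814842080ac08c83980098860,
  0x154056ae060051ce95b00040, 0x1000000000000]⟩

def closureTwelve : Clo := ⟨
  [[[0x3ffff, 0x5010, 0x14201, 0x4800, 0x21211, 0x8050, 0x80a1, 0x484, 0x6210, 0x4804],
  [0x104, 0x504, 0x1050c, 0x28900, 0x180, 0x8000, 0x100, 0x8e, 0x100, 4],
  [0x10c00, 0x840, 0x8000, 0x880, 0, 0x2400, 0x480, 0x404, 0, 0x804],
  [0x80, 0, 0x60, 0x8000, 0x88, 0, 0, 0x80],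
  [0x19000, 0x1020, 0x11000, 0, 0, 0x8000],
  [0xa, 0, 0x12000, 0, 0, 2],
  [0x31040, 0x80, 0x9008, 0x80, 0x20000, 0x40, 0x80, 8],
  [0xa0, 0, 0, 0, 0x80, 0, 0x20, 0x80],
  [0, 0, 0x10000, 0x8000],
  [0, 0, 0x8000],
  [0x1000, 0x1080, 0x1000, 0x80, 0, 0, 0x80]],
  [[0x10080, 0x20005, 0x1079, 0x2401, 0x1810, 0x480, 0x810, 0x84, 1, 1, 0x800],
  [0x88, 0x1411, 0x10, 0x1010, 0x1001, 0x81, 0x80, 0x20480, 0x11, 0x10],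
  [0x11820, 0x1014, 0x1081, 0x400, 0x811, 0x20490, 0x801, 0x20, 0x10, 0, 0x800],
  [0x80, 0, 0, 0, 0, 0x80, 0x88, 0x80],
  [0x11000, 0, 0, 0, 0x20000],
  [0, 0, 8, 0, 0, 0x40, 0x20],
  [0x10088, 0x20000, 0xc0, 0, 0, 0x80, 0, 0x80],
  [0x80, 0x1000, 0x20, 0, 0x1000, 0x80, 0x80, 0x80],
  [],
  [0x1000, 0, 0x1000],
  [0x80, 0, 0x80, 0, 0, 0x80, 0, 0x80]],
  [[0x17, 0x9101, 0x11, 0x25, 0x852, 8, 0xa10, 0x300, 1, 1, 0x804],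
  [0x3ffe8, 0x5200, 0x1200, 0x46, 0x4820, 0xc4a0, 0x2300, 0x280, 0x4000, 0, 0x800],
  [0x14, 0x1414, 0, 4, 0x810, 0x10, 0xa00, 0x200, 0x10, 0, 0x804],
  [0x100, 0x108, 0x180, 0, 0x100, 0x8080, 0x108, 0x100],
  [0x10820, 0, 0, 0x2000, 0, 0x20],
  [0x10000, 0x8060, 8, 0, 0, 8],
  [0xa, 0x8000, 0, 0, 2],
  [0x1080, 0x3000, 0x1080, 0, 0x40, 0x80, 0, 0x80],
  [0x19040, 0x1000, 0x1000, 0x60, 0, 0x8000],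
  [0x20, 0, 0, 0, 0x20, 0x20],
  [0, 0x8000],
  [0, 0x8000]],
  [[0x4010, 0xa30a, 0x4810, 0x100, 0x814, 0, 0x214, 0, 0x4804, 0x4000],
  [0x5000, 0x14d00, 0x39800, 0x88, 0xc000, 0x4000, 0x480, 0x902, 0x4008],
  [0x10c04, 0x10300, 0x800, 0, 4, 0x402, 0x2004, 0, 0x804],
  [0x100, 0x38900, 0x8100, 0, 0x100, 8, 0x140, 0x20],
  [0x10840, 0x800, 0x10000, 0, 2, 0, 0x40, 0x800],
  [0, 0x88, 0x10000, 0x2080, 0, 0, 0x80],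
  [0x10020, 2, 0, 8, 0, 0, 0, 0x20, 8],
  [0x1000, 0x8000],
  [0, 0x10000, 0x18000],
  [0x80, 0x10080, 0, 0x80, 0, 0x80, 0x80, 0x80]],
  [[0x100, 0x10100, 0x2b100, 0x200, 0x104, 0x800, 0x104, 0x800, 4, 0x200],
  [0x4817, 0x14811, 0x1870, 0x210, 0x4005, 0x4801, 0x20000, 0x800, 0x6015, 0x10],
  [0x4380, 0x30200, 0x4000, 0x280, 0x4104, 0x880, 0x4184, 0x880, 4, 0x200],
  [0x1068, 0x11000, 0x9000, 0, 0, 0x22000, 0, 0x20],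
  [4],
  [0x1000, 0, 0x21000, 8],
  [0x20, 0x88, 0x2000, 0x80, 0, 0, 0x80, 0x20],
  [0, 0, 0x8000],
  [0, 0x10000, 0, 0, 0, 0, 0, 0, 0x2000],
  [0, 0x10000, 0x40],
  [0x80, 0x80, 0x20, 0x80, 0, 0x80, 0x80, 0x80]],
  [[0x9101, 0xc00, 0x1505, 0, 0x304, 0x304, 0x100, 0x8800, 0x20001, 1, 0x200],
  [1, 0x25, 0xe, 0, 1, 0x401, 0, 0x8004, 1],
  [0x4204, 0xc00, 0xc004, 0, 0x4200, 0x204, 0x4000, 0, 0, 0, 0x200],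
  [0x400, 6, 0x60, 8, 0, 0x400, 0x400],
  [0x29004, 0x24, 0x1000, 0, 0, 0, 0x20000, 0x8004],
  [8],
  [0x1000, 0, 0x9008, 0, 0, 0, 0, 0, 0x20000],
  [0x40, 0, 0, 0, 0, 0, 0x40],
  [0x20, 0, 0, 0, 0, 0, 0, 0x20],
  [0, 0x20, 0x8000],
  [0x1000, 0, 0x1000]],
  [[0x1904, 0, 0x14d06, 0, 0xef04, 0x304, 0x4100, 0, 0x800, 0, 0x200],
  [0x701, 0x101, 0x12100, 0x80, 0x301, 1, 0x582, 0x20000, 0x401, 0, 0x200],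
  [0x1011, 0x8092, 0x8401, 0, 0x611, 0x610, 0x81, 0, 0x10, 0, 0x200],
  [0x100, 0x2000, 0x100, 0, 0x100, 0x102, 0x100],
  [0x1380, 0, 0x10100, 0x80, 0x100, 0x80, 0x180, 0x80],
  [0x20000, 0, 0x10002, 0, 0, 0x20000],
  [0, 0x8000, 0, 0, 0x2000],
  [0, 0, 0, 0x80, 0, 0, 0x80],
  [0, 0, 0x12000],
  [0x1000, 0x8000],
  [0, 0x80, 0, 0, 0, 0, 0x80],
  [0x80, 0, 0, 0x80, 0, 0x80, 0x80, 0x80]],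
  [[0x8108, 0x14000, 0x14300, 0x4040, 0x320, 0, 0x580, 0x8000, 0x4302, 0x6000],
  [0x110, 0x4668, 0x10710, 0, 0xc100, 0x4000, 0x300, 0x2000, 0x4010, 0x10],
  [0x611, 0x10058, 0x4201, 0, 0x4011, 0x410, 0x4409, 0, 0x210],
  [8, 0x200, 0, 0, 0xa000, 0, 0x80],
  [0x202, 0x2a0, 0x10008, 0x80, 0, 0, 0x282],
  [0, 0, 0x10000, 8],
  [0xa000, 8, 0, 0, 0, 0, 0x2000, 0x8000, 2, 0x2000],
  [0, 0, 0, 0x40, 0, 0, 0x80],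
  [0x80, 0x100c0, 0x10000, 0x80, 0x8020, 0x80, 0x80, 0x2080],
  [0, 0x10020],
  [],
  [0x8080, 0x80, 0, 0x80, 0, 0x80, 0x80, 0x8080]]],
  [0x3ffff, 0x3bfae, 0x11e84, 0x3a1ea, 0x11020, 0x3000a, 0x1a088, 0x90c0, 0x1a020, 0x11020, 0x80,
  0x8000],
  [0x3ffff, 0x3ffff, 0x1efd5, 0xa0e8, 0x39022, 0x12068, 0x3b0ca, 0x10e0, 0x1a060, 0x8020, 0x1080],
  [0x3ffff, 0x2ffff, 0xfffd, 0x61d9, 0x24b37, 0x2e4d7, 0x67b9, 0x209a6, 0x6b11, 0x4011],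
  [0x3ffff, 0x3ff9f, 0x3d57b, 0x2088, 0xcb15, 0x24793, 0x26fdf, 0x88a4, 0x4015, 0, 0xa00]⟩

def closureLarge : Clo := ⟨
  [[[0xf, 0, 0xc, 0, 1, 0, 8, 0, 4, 2, 0xa, 0, 0, 0, 0, 0, 0, 0, 1],
  [3, 3, 0, 2, 0, 1, 0, 8, 2, 2, 9, 0, 0, 0, 0, 0, 1],
  [8, 0, 0, 0, 6, 0, 8, 2, 0, 0, 4, 0, 0, 0, 0, 0, 0, 4],
  [5, 0, 1, 0, 0, 2, 4, 8, 3, 0, 2, 0, 4],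
  [],
  [6, 4, 1, 2, 4, 0, 1, 0, 0, 2, 8, 4, 0, 4, 1],
  [0, 0, 8, 0, 2],
  [1, 0, 0, 1, 1, 2, 0, 1, 0, 0, 2, 0, 0, 0, 0, 0, 0, 0, 1],
  [],
  [4, 0, 4, 0, 0, 0, 0, 2, 4],
  [0, 0, 0, 0, 0, 0, 0, 8, 2],
  [0, 2],
  [],
  [0, 0, 8],
  [0, 0, 0, 0, 2],
  [8, 0, 0, 0, 0, 0, 8]],
  [[1, 0, 0xd, 0, 0, 0, 0, 0, 1, 0, 0, 0, 0, 0, 0, 4],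
  [4, 4, 0, 0, 0, 4, 8],
  [0, 0, 8, 0, 1, 0, 4, 0, 0, 0, 1, 0, 4, 0, 0, 0, 0, 1],
  [1, 0, 4, 0, 0, 0, 9, 0, 4, 0, 0, 0, 1],
  [],
  [0, 0, 4, 0, 1, 0, 4, 0, 0, 0, 0, 0, 0, 1, 4],
  [],
  [],
  [],
  [1, 0, 5, 0, 0, 0, 0, 0, 1, 0, 0, 0, 0, 0, 0, 4],
  [0, 0, 0, 0, 0, 0, 8],
  [],
  [],
  [],
  [],
  [0, 0, 8]],
  [[0xb, 0, 1, 0, 4, 2, 2, 0, 2, 8, 8, 0, 0, 0, 0, 1, 0, 0, 4],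
  [0xc, 0xc, 0, 8, 0, 6, 0, 0, 8, 8, 4, 0, 0, 0, 0, 0, 4],
  [3, 0, 0, 0, 8, 0, 3, 8, 0, 0, 0, 0, 1],
  [4, 0, 4, 0, 0, 8, 0, 0, 0xc, 0, 8],
  [0, 0, 2, 0, 0, 2],
  [8, 0, 4, 8, 0, 0, 4, 0, 0, 8, 0, 0, 0, 0, 4],
  [1, 1, 0, 0, 8, 1, 0, 0, 2],
  [4, 0, 0, 4, 4, 8, 0, 4, 0, 0, 8, 0, 0, 0, 0, 0, 0, 0, 4],
  [0, 1, 2, 1, 0, 0, 0, 0, 0, 1],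
  [3, 0, 1, 0, 0, 0, 2, 8, 0, 0, 0, 0, 0, 0, 0, 1],
  [0, 0, 0, 0, 0, 0, 0, 0, 8],
  [0, 0, 0, 0, 0, 2],
  [0, 8, 0, 0, 0, 0, 0, 0, 2],
  [0, 0, 0, 0, 0, 2],
  [0, 0, 0, 0, 8],
  [],
  [],
  [0, 0, 2]],
  [[4, 2, 4, 0, 0, 0, 0, 0, 4],
  [0, 2],
  [3, 0, 1, 0, 4, 2, 2, 0, 2, 0, 4, 0, 0, 0, 0, 1, 0, 4],
  [4, 0, 0, 0, 0, 0, 4, 0, 0, 0, 0, 0, 4],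
  [],
  [0, 2, 0, 0, 4, 0, 0, 0, 0, 0, 0, 0, 0, 4],
  [0, 0, 2, 0, 0, 2],
  [],
  [],
  [4, 1, 4, 1, 0, 0, 0, 0, 6, 1],
  [],
  [],
  [0, 0, 2],
  [],
  [0, 0, 0, 0, 0, 2],
  [2, 0, 0, 0, 0, 0, 2]],
  [[9, 3, 4, 2, 0, 9, 8, 0, 0xa, 0, 0, 0, 0, 0, 0, 4],
  [0, 3, 0, 0, 0, 8, 0, 0, 0, 0, 0, 1],
  [0xc, 0, 0, 0, 0, 2, 0xc, 0, 2, 0, 0, 0, 4],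
  [0, 1, 0, 3, 0, 0, 0, 0, 0, 1],
  [2, 0, 9, 2, 0, 8, 1, 0, 0, 0, 0, 0, 0, 0, 1],
  [0, 2, 0, 1, 0, 0, 0, 1],
  [5, 4, 0, 1, 0, 6, 0, 1, 8],
  [0, 1, 0, 2, 0, 1],
  [0, 6, 1, 4, 0, 8, 0, 0, 1, 4],
  [0xc, 0, 4, 0, 0, 0, 8, 0, 2, 0, 0, 0, 0, 0, 0, 4],
  [1, 1, 0, 0, 0, 1],
  [0, 0, 8],
  [0, 0, 0, 0, 0, 8],
  [0, 0, 0, 0, 0, 0, 0, 0, 8],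
  [0, 0, 0, 0, 0, 2],
  [],
  [0, 2],
  [0, 0, 8],
  [2, 0, 0, 2]],
  [[2, 8, 0, 0, 0, 0, 2, 0, 2],
  [0, 8],
  [0xe, 0, 4, 0, 0, 8, 0xa, 0, 8, 0, 0, 0, 0, 0, 0, 4],
  [],
  [0, 0, 2, 0, 0, 2],
  [0, 8],
  [0, 0, 8, 0, 0, 8, 0, 0, 2],
  [],
  [0, 0, 2],
  [2, 4, 0, 4, 0, 0, 2, 0, 8, 4],
  [],
  [],
  [0, 0, 0, 0, 0, 0, 0, 0, 2],
  [0, 0, 8, 0, 0, 2],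
  [0, 0, 0, 0, 0, 8],
  [8, 0, 0, 0, 0, 0, 8],
  [],
  [0, 0, 2]],
  [[5, 0xc, 3, 8, 0, 4, 2, 0, 9, 0, 2],
  [0, 0xc, 0, 0, 0, 0, 0, 2, 0, 0, 2, 4],
  [2, 0, 0, 0, 1, 8, 2, 0, 8, 0, 1, 0, 0, 0, 0, 0, 0, 1],
  [1, 4, 0, 0xc, 0, 0, 1, 2, 0, 4, 0, 0, 1],
  [8, 0, 4, 8, 0, 0, 4, 0, 0, 0, 0, 0, 0, 0, 4],
  [1, 9, 0, 4, 1, 0, 0, 4, 0, 0, 2, 1, 0, 1],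
  [4, 0, 2, 4, 0, 8, 0, 4],
  [0, 4, 0, 8, 0, 4],
  [0, 0, 4, 0, 0, 0, 0, 0, 4],
  [1, 0, 1, 0, 0, 0, 0, 0, 9],
  [4, 4, 0, 0, 0, 4, 0, 2],
  [0, 8],
  [0, 0, 2],
  [],
  [0, 0, 0, 0, 0, 8],
  [2, 0, 0, 0, 0, 0, 2],
  [0, 8],
  [],
  [8, 0, 0, 8]],
  [[8, 0, 3, 0, 0, 0, 8, 0, 8, 0, 0, 0, 0, 0, 0, 1],
  [1, 1, 0, 0, 0, 1, 2],
  [8, 0, 2, 0, 0, 0, 9, 0, 0, 0, 0, 0, 1],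
  [0, 0, 1, 0, 0, 0, 2, 0, 1],
  [0, 0, 8, 0, 0, 8],
  [0, 0, 1, 0, 0, 0, 1, 0, 0, 0, 0, 0, 0, 0, 1],
  [0, 0, 0, 0, 0, 0, 0, 0, 8],
  [],
  [0, 0, 0, 0, 0, 8],
  [8, 0, 1, 0, 0, 0, 8, 0, 0, 0, 0, 0, 0, 0, 0, 1],
  [0, 0, 0, 0, 0, 0, 2],
  [0, 0, 8],
  [],
  [0, 0, 0, 0, 0, 0, 0, 0, 8],
  [],
  [0, 0, 2],
  [],
  [0, 0, 8]]],
  [0xf, 0xf, 0xf, 0xf, 0, 0xf, 0xa, 0xf, 0, 0xf, 0xa, 2, 0xa, 8, 0xa, 0xa],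
  [0xf, 0xa, 0xf, 0xf, 0, 0xf, 0xa, 0, 0, 5, 0xa, 0, 2, 8, 0, 0xa],
  [0xf, 0xf, 0xf, 0xf, 0, 0xf, 0xf, 5, 0xf, 5, 0, 5, 5, 0, 5, 5],
  [0xf, 5, 0xf, 5, 0, 0xf, 0xf, 0, 0xa, 5, 0, 0, 5, 0, 0, 5]⟩

end BB4

noncomputable section
namespace BB4

/-- The codes of the entries tagged `t`. -/
def pick (t : Nat) (l : List Nat) : List Nat :=
  List.rec [] (fun x _ ih => cond (Nat.beq (Nat.shiftRight x 40) t)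
    (Nat.land x (full 40) :: ih) ih) l

def leftover : List Nat :=
  List.append leftover0 (List.append leftover1 (List.append leftover2 (List.append leftover3
    (List.append leftover4 (List.append leftover5 (List.append leftover6 leftover7))))))

def checked (t : Nat) (G : Aut) (S : Clo) : Bool :=
  (fun l => Nat.beq (unclosed (full (len l)) (codeTab l) G S) 0) (pick t leftover)

def closed (t : Nat) (G : Aut) (n : Nat) : Bool :=
  (fun l => (fun F => Nat.beq (closure F (codeTab l) G n) 0) (full (len l))) (pick t leftover)

def looped (t n k : Nat) : Bool :=
  (fun l => (fun C F => Nat.beq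
      (andNot F (loops C F (stps C n (sim0 F [])) k (stps C n (sim0 F [])) ⟨[], [], [], []⟩)) 0)
    (codeTab l) (full (len l))) (pick t leftover)

/-- All tags of `l` are at most `5`. -/
def tagged (l : List Nat) : Bool :=
  List.rec true (fun x _ ih => cond (Nat.ble (Nat.shiftRight x 40) 5) ih false) l

end BB4
end

namespace BB4

/-! ### The remaining machines -/

theorem mem_pick {l : List ℕ} {x : ℕ} (hx : x ∈ l) :
    Nat.land (full 40) x ∈ pick (Nat.shiftRight x 40) l := by
  induction l with
  | nil => cases hx
  | cons y l ih =>
    have e : ∀ t, pick t (y :: l) = cond (Nat.beq (Nat.shiftRight y 40) t)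
      (Nat.land y (full 40) :: pick t l) (pick t l) := fun _ => rfl
    rw [e, beq_eq]
    rcases List.mem_cons.1 hx with rfl | hx
    · rw [decide_eq_true rfl, cond_true]
      exact List.mem_cons.2 (Or.inl (Nat.and_comm _ _))
    · cases decide (Nat.shiftRight y 40 = Nat.shiftRight x 40)
      · exact ih hx
      · exact List.mem_cons_of_mem _ (ih hx)

theorem le_of_tagged {l : List ℕ} (h : tagged l = true) {x : ℕ} (hx : x ∈ l) :
    Nat.shiftRight x 40 ≤ 5 := by
  induction l with
  | nil => cases hx
  | cons y l ih =>
    have e : tagged (y :: l) = cond (Nat.ble (Nat.shiftRight y 40) 5) (tagged l) false := rfl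
    rw [e, ble_eq, Bool.cond_false_right, Bool.and_eq_true, decide_eq_true_eq] at h
    rcases List.mem_cons.1 hx with rfl | hx
    · exact h.1
    · exact ih h.2 hx

theorem codeTab_long (l : List ℕ) : (codeTab l).Long :=
  tab_long fun j e => comb (chop l) (Nat.add j e)

theorem never_of_lanes {l : List ℕ}
    (h : ∀ i, (full (len l)).testBit i = true → (lane (codeTab l) i).Never) {c : ℕ} (hc : c ∈ l) :
    (dec c).Never := by
  obtain ⟨i, hi, rfl⟩ := List.mem_iff_getElem.1 hc
  have h1 := (lane_codeTab l i).never (lane_small _ _) (h i (by simp [len_eq, hi]))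
  rwa [nth_eq, List.getD_eq_getElem _ _ hi] at h1

theorem never_of_checked {t : ℕ} {G : Aut} {S : Clo} (h : checked t G S = true) {c : ℕ}
    (hc : c ∈ pick t leftover) : (dec c).Never := by
  unfold checked at h
  generalize pick t leftover = l at h hc
  exact never_of_lanes (fun i hi => never_of_unclosed hi (codeTab_long l)
    (by rw [Nat.eq_of_beq_eq_true h]; exact Nat.zero_testBit i)) hc

theorem never_of_closed {t n : ℕ} {G : Aut} (h : closed t G n = true) {c : ℕ}
    (hc : c ∈ pick t leftover) : (dec c).Never :=
  never_of_checked (S := rnds (full (len (pick t leftover))) (codeTab (pick t leftover)) G n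
    (clo0 (full (len (pick t leftover))))) h hc

theorem never_of_looped {t n k : ℕ} (h : looped t n k = true) {c : ℕ}
    (hc : c ∈ pick t leftover) : (dec c).Never := by
  unfold looped at h
  generalize pick t leftover = l at h hc
  refine never_of_lanes (fun i hi => ?_) hc
  have h1 := congrArg (fun x => x.testBit i) (Nat.eq_of_beq_eq_true h)
  simp only [testBit_andNot, hi, Nat.zero_testBit, Bool.true_and, Bool.not_eq_false'] at h1
  exact never_of_loops hi (loops_act h1) h1


/-! ### The computations -/

set_option maxRecDepth 100000 in
theorem leaves_slice0 : leaves (grow (take (drop frontier 0) 28)) leftover0 = true := by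
  decide +kernel

set_option maxRecDepth 100000 in
theorem leaves_slice1 : leaves (grow (take (drop frontier 28) 24)) leftover1 = true := by
  decide +kernel

set_option maxRecDepth 100000 in
theorem leaves_slice2 : leaves (grow (take (drop frontier 52) 40)) leftover2 = true := by
  decide +kernel

set_option maxRecDepth 100000 in
theorem leaves_slice3 : leaves (grow (take (drop frontier 92) 23)) leftover3 = true := by
  decide +kernel

set_option maxRecDepth 100000 in
theorem leaves_slice4 : leaves (grow (take (drop frontier 115) 12)) leftover4 = true := by
  decide +kernel

set_option maxRecDepth 100000 in
theorem leaves_slice5 : leaves (grow (take (drop frontier 127) 13)) leftover5 = true := by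
  decide +kernel

set_option maxRecDepth 100000 in
theorem leaves_slice6 : leaves (grow (take (drop frontier 140) 26)) leftover6 = true := by
  decide +kernel

set_option maxRecDepth 100000 in
theorem leaves_slice7 : leaves (grow (drop frontier 166)) leftover7 = true := by
  decide +kernel

set_option maxRecDepth 100000 in
theorem tagged_leftover : tagged leftover = true := by decide +kernel

set_option maxRecDepth 100000 in
theorem closed_small : closed 0 automataSmall 24 = true := by decide +kernel

set_option maxRecDepth 100000 in
theorem closed_five : closed 1 automataFive 36 = true := by decide +kernel

set_option maxRecDepth 100000 in
theorem checked_eight : checked 2 automataEight closureEight = true := by decide +kernel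

set_option maxRecDepth 100000 in
theorem checked_twelve : checked 3 automataTwelve closureTwelve = true := by decide +kernel

set_option maxRecDepth 100000 in
theorem checked_large : checked 4 automataLarge closureLarge = true := by decide +kernel

set_option maxRecDepth 100000 in
theorem looped_long : looped 5 128 92 = true := by decide +kernel

theorem never_of_mem_leftover {d : ℕ} (hd : d ∈ leftover) :
    (dec (Nat.land (full 40) d)).Never := by
  have h := le_of_tagged tagged_leftover hd
  have hp := mem_pick hd
  generalize Nat.shiftRight d 40 = t at h hp
  interval_cases t
  · exact never_of_closed closed_small hp
  · exact never_of_closed closed_five hp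
  · exact never_of_checked checked_eight hp
  · exact never_of_checked checked_twelve hp
  · exact never_of_checked checked_large hp
  · exact never_of_looped looped_long hp

theorem okay_of_grow {l : List Item} (h : ∀ x ∈ grow l, x.Okay) : ∀ x ∈ l, x.Okay :=
  okay_of_flat (fun _ => okay_of_branch) (okay_of_flat (fun _ => okay_of_branch)
    (okay_of_flat (fun _ => okay_of_leaf) h))

theorem okay_of_leaves_grow {l : List Item} {D : List ℕ} (h : leaves (grow l) D = true)
    (hD : ∀ d ∈ D, d ∈ leftover) : ∀ x ∈ l, x.Okay :=
  okay_of_grow fun _ hx => okay_of_leaves h (fun d hd => never_of_mem_leftover (hD d hd)) hx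

theorem mem_slices {α : Type} {l : List α} {x : α} (hx : x ∈ l) :
    x ∈ take (drop l 0) 28 ∨ x ∈ take (drop l 28) 24 ∨ x ∈ take (drop l 52) 40 ∨
      x ∈ take (drop l 92) 23 ∨ x ∈ take (drop l 115) 12 ∨ x ∈ take (drop l 127) 13 ∨
      x ∈ take (drop l 140) 26 ∨ x ∈ drop l 166 := by
  simp only [take_eq, drop_eq]
  have key : ∀ n m, x ∈ l.drop n → x ∈ (l.drop n).take m ∨ x ∈ l.drop (n + m) := fun n m h => by
    rw [← List.take_append_drop m (l.drop n), List.mem_append, List.drop_drop] at h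
    exact h
  exact (key 0 28 hx).imp_right fun h => (key 28 24 h).imp_right fun h =>
    (key 52 40 h).imp_right fun h => (key 92 23 h).imp_right fun h =>
    (key 115 12 h).imp_right fun h => (key 127 13 h).imp_right (key 140 26)

theorem mem_leftover {d : ℕ} : d ∈ leftover ↔ d ∈ leftover0 ∨ d ∈ leftover1 ∨ d ∈ leftover2 ∨
    d ∈ leftover3 ∨ d ∈ leftover4 ∨ d ∈ leftover5 ∨ d ∈ leftover6 ∨ d ∈ leftover7 := by
  have e : leftover = leftover0 ++ (leftover1 ++ (leftover2 ++ (leftover3 ++ (leftover4 ++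
    (leftover5 ++ (leftover6 ++ leftover7)))))) := rfl
  simp only [e, List.mem_append]

theorem okay_of_mem_frontier {x : Item} (hx : x ∈ frontier) : x.Okay := by
  rcases mem_slices hx with h | h | h | h | h | h | h | h
  · exact okay_of_leaves_grow leaves_slice0 (fun d hd => mem_leftover.2 (by simp [hd])) x h
  · exact okay_of_leaves_grow leaves_slice1 (fun d hd => mem_leftover.2 (by simp [hd])) x h
  · exact okay_of_leaves_grow leaves_slice2 (fun d hd => mem_leftover.2 (by simp [hd])) x h
  · exact okay_of_leaves_grow leaves_slice3 (fun d hd => mem_leftover.2 (by simp [hd])) x h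
  · exact okay_of_leaves_grow leaves_slice4 (fun d hd => mem_leftover.2 (by simp [hd])) x h
  · exact okay_of_leaves_grow leaves_slice5 (fun d hd => mem_leftover.2 (by simp [hd])) x h
  · exact okay_of_leaves_grow leaves_slice6 (fun d hd => mem_leftover.2 (by simp [hd])) x h
  · exact okay_of_leaves_grow leaves_slice7 (fun d hd => mem_leftover.2 (by simp [hd])) x h

theorem good {T : Tab} (hT : T.Small) (h : T.OneHalt) : T.Good :=
  good_of_root (okay_of_flat (fun _ => okay_of_branch) (okay_of_flat (fun _ => okay_of_branch)
    fun _ => okay_of_mem_frontier)) hT h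

end BB4

/-- Every 4-state 2-symbol machine that halts from the all-blank tape takes at most
107 steps and leaves at most 13 non-blank cells; both bounds are attained.
That is, `S(4,2) = 107` and `Σ(4,2) = 13`. -/
theorem busy_beaver_values_4_2 :
    (∀ M : Machine 4 2, Valid M → ∀ t : ℕ, HaltsIn M (init 4 2) t →
        t ≤ 107 ∧ sigmaCount ((step M)^[t] (init 4 2)) ≤ 13) ∧
    (∃ M : Machine 4 2, Valid M ∧ HaltsIn M (init 4 2) 107) ∧
    (∃ M : Machine 4 2, Valid M ∧ ∃ t : ℕ, HaltsIn M (init 4 2) t ∧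
        sigmaCount ((step M)^[t] (init 4 2)) = 13) ∧
    bbS 4 2 = 107 ∧ bbSigma 4 2 = 13 :=
  BB4.values_of_good fun _ => BB4.good
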